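/- arXiv:0903.5125 — 3 statements merged into one kernel-verified Lean document; each statement's English description precedes it below -/
import Mathlib

section
/- Let λ : [0,1) → [0,∞) be an increasing function with λ(0) = 0 such that λ(t) = o(t·|log t|^ω) as t → 0 for every ω > 0. Then for every zero-free function f in the Korenblum class A^{-∞}, the Hausdorff measure H_λ of the set D_+(f) is zero. -/
open Filter MeasureTheory

noncomputable section

/-- Hausdorff measure on `ℝ` with gauge function `lam`:
`H_lam(C) = lim_{ε→0} inf {Σ_s lam(|J_s|) : C ⊆ ⋃_s J_s, |J_s| < ε}`. -/
def hausdorffGauge (lam : ℝ → ℝ) : Measure ℝ :=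
  Measure.mkMetric fun d => ENNReal.ofReal (lam d.toReal)

/-- The Korenblum class `A^{-∞}`: `f` analytic on the unit disc with
`|f(z)| ≤ C (1-|z|)^{-k}` for some constants `C, k > 0`. -/
def Korenblum (f : ℂ → ℂ) : Prop :=
  DifferentiableOn ℂ f (Metric.ball 0 1) ∧
    ∃ C k : ℝ, 0 < C ∧ 0 < k ∧ ∀ z ∈ Metric.ball (0:ℂ) 1, ‖f z‖ ≤ C / (1 - ‖z‖) ^ k

/-- `D_+(f)`: the set of `θ ∈ [0, 2π)` such that
`liminf_{r→1⁻} log|f(re^{iθ})| / |log(1-r)| > 0`. -/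
def Dplus (f : ℂ → ℂ) : Set ℝ :=
  {θ | θ ∈ Set.Ico 0 (2 * Real.pi) ∧
    ∃ c : ℝ, 0 < c ∧ ∀ᶠ r : ℝ in nhdsWithin 1 (Set.Iio 1),
      c ≤ Real.log ‖f ((r : ℂ) * Complex.exp (Complex.I * (θ : ℂ)))‖ / |Real.log (1 - r)|}

theorem norm_sub_le_of_re_le {F : ℂ → ℂ} {w₀ w : ℂ} {R M : ℝ} (hR : 0 < R)
    (hF : DifferentiableOn ℂ F (Metric.ball w₀ R)) (hM : ∀ z ∈ Metric.ball w₀ R, (F z).re ≤ M)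
    (h0 : (F w₀).re < M) (hw : ‖w - w₀‖ ≤ R / 2) :
    ‖F w - F w₀‖ ≤ 4 * (M - (F w₀).re) / R * ‖w - w₀‖ := by
  have hmaps : ∀ z ∈ Metric.ball (0 : ℂ) R, z + w₀ ∈ Metric.ball w₀ R := by
    intro z hz; simpa using hz
  have key := Complex.borelCaratheodory_zero (f := fun z => F (z + w₀) - F w₀) (R := R)
    (M := M - (F w₀).re) (z := w - w₀) (by linarith) ?_ ?_ hR ?_ (by simp)
  · simp only [sub_add_cancel] at key
    refine key.trans ?_
    rw [div_mul_eq_mul_div, div_le_div_iff₀ (by linarith) hR]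
    have h1 : 0 ≤ (M - (F w₀).re) * ‖w - w₀‖ := mul_nonneg (by linarith) (norm_nonneg _)
    nlinarith
  · exact (hF.comp (by fun_prop) hmaps).sub_const _
  · intro z hz
    simpa using hM _ (hmaps z hz)
  · simp only [Metric.mem_ball, dist_zero_right]; linarith

/-- Hyperbolic Lipschitz bound for an analytic function on the upper half-plane whose real part
grows at most logarithmically at the real axis. -/
theorem norm_sub_le_of_log_growth {F : ℂ → ℂ} {K : ℝ} (hK : 0 < K)
    (hF : DifferentiableOn ℂ F {w | 0 < w.im})
    (hub : ∀ w : ℂ, 0 < w.im → w.im ≤ 1 / 2 → (F w).re ≤ K * -Real.log w.im)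
    {w w' : ℂ} (hw : 0 < w.im) (hw4 : w.im ≤ 1 / 4) (hww : ‖w' - w‖ ≤ w.im / 4) :
    ‖F w' - F w‖ ≤ 8 * (2 * K * -Real.log w.im - (F w).re) / w.im * ‖w' - w‖ := by
  have him : ∀ z ∈ Metric.ball w (w.im / 2), w.im / 2 < z.im ∧ z.im < 3 / 2 * w.im := by
    intro z hz
    rw [Metric.mem_ball, dist_eq_norm] at hz
    have := (Complex.abs_im_le_norm (z - w)).trans_lt hz
    rw [Complex.sub_im, abs_lt] at this
    constructor <;> linarith
  have hlog : Real.log w.im ≤ -Real.log 2 := by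
    rw [← Real.log_inv]; exact Real.log_le_log hw (by linarith)
  have hl2 := Real.log_pos one_lt_two
  have key := norm_sub_le_of_re_le (F := F) (w₀ := w) (w := w') (R := w.im / 2)
    (M := 2 * K * -Real.log w.im) (by linarith) (hF.mono fun z hz => ?_) (fun z hz => ?_) ?_
    (by linarith)
  · convert! key using 2; field_simp; ring
  · have := (him z hz).1
    show 0 < z.im
    linarith
  · obtain ⟨h1, h2⟩ := him z hz
    refine (hub z (by linarith) (by linarith)).trans ?_
    have h3 : Real.log (w.im / 2) ≤ Real.log z.im := Real.log_le_log (by linarith) h1.le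
    rw [Real.log_div hw.ne' two_ne_zero] at h3
    nlinarith
  · have := hub w hw (by linarith)
    nlinarith

theorem norm_deriv_le_of_log_growth {F : ℂ → ℂ} {K : ℝ} (hK : 0 < K)
    (hF : DifferentiableOn ℂ F {w | 0 < w.im})
    (hub : ∀ w : ℂ, 0 < w.im → w.im ≤ 1 / 2 → (F w).re ≤ K * -Real.log w.im)
    {w : ℂ} (hw : 0 < w.im) (hw4 : w.im ≤ 1 / 4) :
    ‖deriv F w‖ ≤ 8 * (2 * K * -Real.log w.im - (F w).re) / w.im := by
  refine norm_deriv_le_of_lip' ?_ ?_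
  · refine div_nonneg ?_ hw.le
    have h1 := hub w hw (by linarith)
    have h2 : Real.log w.im ≤ 0 := Real.log_nonpos hw.le (by linarith)
    nlinarith
  · filter_upwards [Metric.closedBall_mem_nhds w (show 0 < w.im / 4 by linarith)] with z hz
    exact norm_sub_le_of_log_growth hK hF hub hw hw4 (by simpa [dist_eq_norm] using hz)

/-- Logarithmic lower bounds along a vertical segment propagate to a thin cone around it. -/
theorem le_re_of_mem_cone {F : ℂ → ℂ} {K c a y x x₀ : ℝ} (hc : 0 < c) (hcK : c ≤ K)
    (ha : a = c / (64 * K))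
    (hF : DifferentiableOn ℂ F {w | 0 < w.im})
    (hub : ∀ w : ℂ, 0 < w.im → w.im ≤ 1 / 2 → (F w).re ≤ K * -Real.log w.im)
    (hy : 0 < y) (hy4 : y ≤ 1 / 4) (hx : |x - x₀| ≤ 2 * a * y)
    (hlb : c * -Real.log y ≤ (F (x₀ + y * Complex.I)).re) :
    c / 2 * -Real.log y ≤ (F (x + y * Complex.I)).re := by
  have hK : 0 < K := hc.trans_le hcK
  have ha64 : a ≤ 1 / 64 := by
    rw [ha, div_le_div_iff₀ (by positivity) (by norm_num)]; linarith
  have hn : ‖((x : ℂ) + y * Complex.I) - (x₀ + y * Complex.I)‖ = |x - x₀| := by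
    rw [add_sub_add_right_eq_sub, ← Complex.ofReal_sub, Complex.norm_real, Real.norm_eq_abs]
  have key := norm_sub_le_of_log_growth hK hF hub (w := x₀ + y * Complex.I)
    (w' := x + y * Complex.I) (by simpa using hy) (by simpa using hy4)
    (by rw [hn]; simp; nlinarith)
  rw [hn] at key
  simp only [Complex.add_im, Complex.ofReal_im, Complex.mul_im, Complex.ofReal_re, Complex.I_im,
    mul_one, Complex.I_re, mul_zero, add_zero, zero_add] at key
  have hL : 0 ≤ -Real.log y := by
    have := Real.log_nonpos hy.le (by linarith); linarith
  set u := (F (x₀ + y * Complex.I)).re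
  have hu : 0 ≤ u := le_trans (by positivity) hlb
  have hb : 8 * (2 * K * -Real.log y - u) / y * |x - x₀| ≤ c / 2 * -Real.log y := by
    calc _ ≤ 8 * (2 * K * -Real.log y) / y * (2 * a * y) := by
          gcongr; linarith
      _ = c / 2 * -Real.log y := by rw [ha]; field_simp; ring
  have h3 := (abs_le.1 ((Complex.abs_re_le_norm _).trans (key.trans hb))).1
  rw [Complex.sub_re] at h3
  linarith

theorem le_geometric_of_sum_le {s : ℕ → ℝ} {c B P : ℝ} (hc : 0 < c) (hB : 0 < B)
    (h : ∀ n, (c + B) * (2 ^ n * s n) ≤ B * (P + ∑ i ∈ Finset.range n, 2 ^ i * s i)) (hP : 0 ≤ P) :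
    ∀ n, s n ≤ P * ((1 + B / (c + B)) / 2) ^ n := by
  set β := B / (c + B) with hβ
  have hβ0 : 0 < β := by positivity
  have hβ1 : β ≤ 1 := by rw [hβ, div_le_one (by positivity)]; linarith
  have h' : ∀ n, 2 ^ n * s n ≤ β * (P + ∑ i ∈ Finset.range n, 2 ^ i * s i) := by
    intro n
    rw [hβ, div_mul_eq_mul_div, le_div_iff₀ (by positivity), mul_comm]
    exact h n
  have hT : ∀ n, P + ∑ i ∈ Finset.range n, 2 ^ i * s i ≤ P * (1 + β) ^ n := by
    intro n
    induction n with
    | zero => simp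
    | succ n ih =>
      rw [Finset.sum_range_succ, pow_succ]
      nlinarith [h' n]
  intro n
  have h1 : 2 ^ n * s n ≤ P * (1 + β) ^ n := by
    have h2 : 0 ≤ P * (1 + β) ^ n := by positivity
    exact (h' n).trans ((mul_le_mul_of_nonneg_left (hT n) hβ0.le).trans (by nlinarith))
  rw [div_pow, ← mul_div_assoc, le_div_iff₀ (by positivity), mul_comm]
  exact h1

/-- The boundary identity: integrating over the graph of a periodic Lipschitz function. -/
theorem integral_graph_eq_zero {F G : ℂ → ℂ} {d : ℝ → ℝ} {h H : ℝ} {L : NNReal} {T : ℝ}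
    (hF : DifferentiableOn ℂ F {w | 0 < w.im})
    (hG : ∀ w : ℂ, 0 < w.im → HasDerivAt G (F w) w)
    (hFper : ∀ w, F (w + T) = F w) (hGper : ∀ w, G (w + T) = G w)
    (hd : LipschitzWith L d) (hdper : d T = d 0) (hh : 0 < h) (hhd : ∀ x, h ≤ d x)
    (hdH : ∀ x, d x ≤ H) :
    ∃ J : ℝ → ℝ, IntervalIntegrable J volume 0 T ∧ ∫ x in 0..T, J x = 0 ∧
      ∀ᵐ x, ∃ d' : ℝ, |d'| ≤ L ∧ J x = (F (x + d x * Complex.I)).re +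
        (d x - h) * (deriv F (x + d x * Complex.I) * (1 + d' * Complex.I)).im := by
  set γ : ℝ → ℂ := fun x => x + d x * Complex.I with hγ
  set Φ : ℝ → ℝ := fun x => (G (γ x)).re + (d x - h) * (F (γ x)).im with hΦ
  have hopen : IsOpen {w : ℂ | 0 < w.im} := isOpen_lt continuous_const Complex.continuous_im
  have hGd : DifferentiableOn ℂ G {w | 0 < w.im} := fun w hw =>
    (hG w hw).differentiableAt.differentiableWithinAt
  have hγL : ∃ K, LipschitzWith K γ := by
    have h1 : LipschitzWith 1 (fun x : ℝ => (x : ℂ)) := Complex.isometry_ofReal.lipschitz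
    have h2 : LipschitzWith (L * ‖Complex.I‖₊) (fun x : ℝ => (d x : ℂ) * Complex.I) := by
      refine LipschitzWith.of_dist_le_mul fun x y => ?_
      rw [dist_eq_norm, ← sub_mul, norm_mul, ← Complex.ofReal_sub, Complex.norm_real,
        ← dist_eq_norm]
      simpa using hd.dist_le_mul x y
    exact ⟨_, h1.add h2⟩
  obtain ⟨Kγ, hγL⟩ := hγL
  have hac : AbsolutelyContinuousOnInterval Φ 0 T := by
    set S : Set ℂ := Set.uIcc 0 T ×ℂ Set.Icc h H with hS
    have hSc : IsCompact S := isCompact_uIcc.reProdIm isCompact_Icc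
    have hSconv : Convex ℝ S := by
      have : S = Complex.reCLM ⁻¹' Set.uIcc 0 T ∩ Complex.imCLM ⁻¹' Set.Icc h H := by
        ext w; simp [hS, Complex.mem_reProdIm]
      rw [this]
      exact ((convex_uIcc _ _).linear_preimage _).inter ((convex_Icc _ _).linear_preimage _)
    have hSU : S ⊆ {w | 0 < w.im} := fun w hw => hh.trans_le hw.2.1
    have hγS : Set.MapsTo γ (Set.uIcc 0 T) S := fun x hx => by
      simp only [hS, Complex.mem_reProdIm, hγ]
      simpa using ⟨hx, hhd x, hdH x⟩
    have hlip : ∀ {A : ℂ → ℂ}, DifferentiableOn ℂ A {w | 0 < w.im} →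
        ∃ K, LipschitzOnWith K (A ∘ γ) (Set.uIcc 0 T) := by
      intro A hA
      have h1 : ContDiffOn ℝ 1 A S := ((hA.contDiffOn hopen).mono hSU).restrict_scalars ℝ
      obtain ⟨K, hK⟩ := h1.exists_lipschitzOnWith one_ne_zero hSconv hSc
      exact ⟨_, hK.comp (hγL.lipschitzOnWith) hγS⟩
    obtain ⟨K1, h1⟩ := hlip hGd
    obtain ⟨K2, h2⟩ := hlip hF
    have h1' : AbsolutelyContinuousOnInterval (fun x => (G (γ x)).re) 0 T :=
      (Complex.reCLM.lipschitz.comp_lipschitzOnWith h1).absolutelyContinuousOnInterval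
    have h2' : AbsolutelyContinuousOnInterval (fun x => (F (γ x)).im) 0 T :=
      (Complex.imCLM.lipschitz.comp_lipschitzOnWith h2).absolutelyContinuousOnInterval
    have h3' : AbsolutelyContinuousOnInterval (fun x => d x - h) 0 T :=
      ((hd.sub (LipschitzWith.const h)).lipschitzOnWith).absolutelyContinuousOnInterval
    exact h1'.add (h3'.mul h2')
  refine ⟨deriv Φ, hac.intervalIntegrable_deriv, ?_, ?_⟩
  · rw [hac.integral_deriv_eq_sub]
    have e : γ T = γ 0 + T := by simp only [hγ, hdper]; push_cast; ring
    simp only [hΦ, e, hFper, hGper, hdper, sub_self]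
  · filter_upwards [hd.ae_differentiableAt_real] with x hx
    refine ⟨deriv d x, by simpa using norm_deriv_le_of_lipschitz (x₀ := x) hd, ?_⟩
    have hγx : HasDerivAt γ (1 + deriv d x * Complex.I) x :=
      (Complex.ofRealCLM.hasDerivAt).add ((hx.hasDerivAt.ofReal_comp).mul_const _)
    have him : 0 < (γ x).im := by simpa [hγ] using hh.trans_le (hhd x)
    have hFx : HasDerivAt F (deriv F (γ x)) (γ x) :=
      (hF.differentiableAt (hopen.mem_nhds him)).hasDerivAt
    have h1 := (hG _ him).comp_of_eq x hγx rfl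
    have h2 := hFx.comp_of_eq x hγx rfl
    have h1' := Complex.reCLM.hasFDerivAt.comp_hasDerivAt x h1
    have h2' := Complex.imCLM.hasFDerivAt.comp_hasDerivAt x h2
    have h3 := h1'.add ((hx.hasDerivAt.sub_const h).mul h2')
    refine (h3.deriv).trans ?_
    simp
    ring

/-- Elementary bound for the truncated logarithm by the dyadic layers of its level sets. -/
theorem neg_log_min_le_sum {D y₁ : ℝ} (h0 : 0 < y₁) (h1 : y₁ < 1) (n : ℕ) (hD : y₁ ^ 2 ^ n < D) :
    -Real.log (min D y₁) ≤
      -Real.log y₁ * (1 + ∑ i ∈ Finset.range n, if D ≤ y₁ ^ 2 ^ i then (2 : ℝ) ^ i else 0) := by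
  have hL : 0 < -Real.log y₁ := by linarith [Real.log_neg h0 h1]
  induction n with
  | zero =>
    simp only [pow_zero, pow_one] at hD
    simp [min_eq_right hD.le]
  | succ n ih =>
    rw [Finset.sum_range_succ]
    by_cases hn : y₁ ^ 2 ^ n < D
    · rw [if_neg (not_le.2 hn), add_zero]
      exact ih hn
    · have hle : ∀ i ∈ Finset.range (n + 1), D ≤ y₁ ^ 2 ^ i := fun i hi =>
        (not_lt.1 hn).trans (pow_le_pow_of_le_one h0.le h1.le
          (Nat.pow_le_pow_right two_pos (Nat.lt_succ_iff.1 (Finset.mem_range.1 hi))))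
      rw [← Finset.sum_range_succ, Finset.sum_congr rfl fun i hi => if_pos (hle i hi),
        geom_sum_eq (by norm_num)]
      have hpos : 0 < y₁ ^ 2 ^ (n + 1) := by positivity
      have h2 : y₁ ^ 2 ^ (n + 1) ≤ y₁ := pow_le_of_le_one h0.le h1.le (by positivity)
      have h3 := Real.log_le_log hpos (le_min hD.le h2)
      rw [Real.log_pow] at h3
      push_cast at h3
      have h4 : (1 + ((2 : ℝ) ^ (n + 1) - 1) / (2 - 1)) = 2 ^ (n + 1) := by ring
      rw [h4]
      linarith

/-- The `h`-neighbourhoods of the set where `Re F` grows logarithmically shrink like a power of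
`1 / log (1 / h)`. -/
theorem volume_neighborhood_le {F G : ℂ → ℂ} {K c y₁ T : ℝ} {E : Set ℝ} (hc : 0 < c) (hcK : c ≤ K)
    (hT : 0 < T) (hy₁ : 0 < y₁) (hy₁4 : y₁ ≤ 1 / 4)
    (hF : DifferentiableOn ℂ F {w | 0 < w.im})
    (hG : ∀ w : ℂ, 0 < w.im → HasDerivAt G (F w) w)
    (hFper : ∀ w, F (w + T) = F w) (hGper : ∀ w, G (w + T) = G w)
    (hub : ∀ w : ℂ, 0 < w.im → w.im ≤ 1 / 2 → (F w).re ≤ K * -Real.log w.im)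
    (hE : E = {x : ℝ | ∀ y : ℝ, 0 < y → y ≤ y₁ → c * -Real.log y ≤ (F (x + y * Complex.I)).re})
    (hne : E.Nonempty) :
    ∃ a q : ℝ, 0 < a ∧ 0 < q ∧ q < 1 ∧ ∀ n : ℕ,
      volume.real {x ∈ Set.Icc 0 T | Metric.infDist x E ≤ a * y₁ ^ 2 ^ n} ≤ T * q ^ n := by
  have hK : 0 < K := hc.trans_le hcK
  set a : ℝ := c / (64 * K) with ha
  have ha0 : 0 < a := by positivity
  set D : ℝ → ℝ := fun x => Metric.infDist x E / a with hD
  have hEper : ∀ x, x + T ∈ E ↔ x ∈ E := by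
    intro x
    have : ∀ y : ℝ, F (((x + T : ℝ) : ℂ) + y * Complex.I) = F (x + y * Complex.I) := by
      intro y
      rw [← hFper (x + y * Complex.I)]; push_cast; ring_nf
    simp only [hE, Set.mem_ofPred_eq, this]
  have hDper : D T = D 0 := by
    have h1 : (fun x => T + x) '' E = E := by
      ext x
      constructor
      · rintro ⟨y, hy, rfl⟩
        simpa [add_comm] using (hEper y).2 hy
      · intro hx
        exact ⟨x - T, (hEper _).1 (by simpa using hx), by simp⟩
    have h2 := Metric.infDist_image (isometry_add_left T) (t := E) (x := 0)
    rw [h1, add_zero] at h2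
    simp only [hD, h2]
  have hDlip : LipschitzWith (Real.toNNReal (1 / a)) D := by
    refine LipschitzWith.of_dist_le_mul fun x y => ?_
    have := (Metric.lipschitz_infDist_pt E).dist_le_mul x y
    rw [Real.coe_toNNReal _ (by positivity)]
    simp only [hD, Real.dist_eq, ← sub_div, abs_div, abs_of_pos ha0] at this ⊢
    rw [one_div, ← div_eq_inv_mul]
    exact div_le_div_of_nonneg_right (by simpa using this) ha0.le
  set L₀ := -Real.log y₁ with hL₀
  have hL₀pos : 0 < L₀ := by linarith [Real.log_neg hy₁ (by linarith : y₁ < 1)]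
  obtain ⟨M, hM⟩ : ∃ M, ∀ x ∈ Set.Icc 0 T,
      ‖F (x + y₁ * Complex.I)‖ + y₁ * (‖deriv F (x + y₁ * Complex.I)‖ * (1 + 1 / a)) ≤ M := by
    have hopen : IsOpen {w : ℂ | 0 < w.im} := isOpen_lt continuous_const Complex.continuous_im
    have hm : Set.MapsTo (fun x : ℝ => (x : ℂ) + y₁ * Complex.I) (Set.Icc 0 T)
        {w | 0 < w.im} := fun x _ => by simpa using hy₁
    have hcγ : ContinuousOn (fun x : ℝ => (x : ℂ) + y₁ * Complex.I) (Set.Icc 0 T) := by fun_prop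
    have h1 := hF.continuousOn.comp hcγ hm
    have h2 := (hF.deriv hopen).continuousOn.comp hcγ hm
    have h3 : ContinuousOn (fun x : ℝ => ‖F (x + y₁ * Complex.I)‖ +
        y₁ * (‖deriv F (x + y₁ * Complex.I)‖ * (1 + 1 / a))) (Set.Icc 0 T) :=
      h1.norm.add (continuousOn_const.mul (h2.norm.mul continuousOn_const))
    obtain ⟨M, hM⟩ := isCompact_Icc.exists_bound_of_continuousOn h3
    exact ⟨M, fun x hx => (le_abs_self _).trans (hM x hx)⟩
  have hM0 : 0 ≤ M := le_trans (by positivity) (hM 0 ⟨le_rfl, hT.le⟩)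
  set B := 16 * K * (1 + 1 / a) + M / L₀ with hB
  have hB0 : 0 < B := by positivity
  have hcone : ∀ x y : ℝ, 0 < y → y ≤ y₁ → D x ≤ y →
      c / 2 * -Real.log y ≤ (F (x + y * Complex.I)).re := by
    intro x y hy hyy hDy
    have h1 : Metric.infDist x E < 2 * a * y := by
      rw [hD] at hDy
      have := (div_le_iff₀ ha0).1 hDy
      nlinarith [mul_pos ha0 hy]
    obtain ⟨x₀, hx₀, hd⟩ := (Metric.infDist_lt_iff hne).1 h1
    rw [hE] at hx₀
    exact le_re_of_mem_cone hc hcK ha hF hub hy (hyy.trans hy₁4) hd.le (hx₀ y hy hyy)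
  refine ⟨a, (1 + B / (c / 2 + B)) / 2, ha0, by positivity, ?_, ?_⟩
  · have : B / (c / 2 + B) < 1 := by rw [div_lt_one (by positivity)]; linarith
    linarith
  set s : ℕ → ℝ := fun n => volume.real {x ∈ Set.Icc 0 T | Metric.infDist x E ≤ a * y₁ ^ 2 ^ n}
    with hs
  refine le_geometric_of_sum_le (s := s) (by positivity) hB0 (fun n => ?_) hT.le
  set h := y₁ ^ 2 ^ n with hh
  have hh0 : 0 < h := by positivity
  have hhy : h ≤ y₁ := pow_le_of_le_one hy₁.le (by linarith) (by positivity)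
  set d : ℝ → ℝ := fun x => max h (min (D x) y₁) with hd
  have hdlip : LipschitzWith (Real.toNNReal (1 / a)) d := by
    have := (hDlip.min_const y₁).const_max h
    exact this
  obtain ⟨J, hJi, hJ0, hJ⟩ := integral_graph_eq_zero (h := h) (H := y₁) hF hG hFper hGper hdlip
    (by simp only [hd, hDper]) hh0 (fun x => le_max_left _ _)
    (fun x => max_le hhy (min_le_right _ _))
  rw [Real.coe_toNNReal _ (by positivity)] at hJ
  set Q : ℕ → ℝ → ℝ := fun i x => if D x ≤ y₁ ^ 2 ^ i then (2 : ℝ) ^ i else 0 with hQ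
  have hstep : ∀ i, {x ∈ Set.Icc 0 T | Metric.infDist x E ≤ a * y₁ ^ 2 ^ i} =
      Set.Icc 0 T ∩ {x | D x ≤ y₁ ^ 2 ^ i} := by
    intro i; ext x
    simp only [hD, Set.mem_inter_iff, Set.mem_ofPred_eq, div_le_iff₀ ha0, mul_comm]
  have hmeas : ∀ i, MeasurableSet {x | D x ≤ y₁ ^ 2 ^ i} := fun i =>
    (isClosed_le hDlip.continuous continuous_const).measurableSet
  have hQeq : ∀ i, Q i = Set.indicator {x | D x ≤ y₁ ^ 2 ^ i} fun _ => (2 : ℝ) ^ i := by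
    intro i; ext x; simp [hQ, Set.indicator_apply]
  have hQi : ∀ i, IntervalIntegrable (Q i) volume 0 T := by
    intro i
    rw [hQeq, intervalIntegrable_iff]
    have : IsFiniteMeasure (volume.restrict (Set.uIoc 0 T)) :=
      ⟨by simp [Set.uIoc_of_le hT.le]⟩
    exact (integrable_const _).indicator (hmeas i)
  have hQint : ∀ i, ∫ x in 0..T, Q i x = 2 ^ i * s i := by
    intro i
    rw [hQeq, intervalIntegral.integral_of_le hT.le, ← integral_Icc_eq_integral_Ioc,
      integral_indicator_const _ (hmeas i), measureReal_restrict_apply (hmeas i), Set.inter_comm,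
      ← hstep, smul_eq_mul, mul_comm]
  have hlow : ∀ᵐ x ∂(volume.restrict (Set.Icc 0 T)),
      L₀ * ((c / 2 + B) * Q n x - B * (1 + ∑ i ∈ Finset.range n, Q i x)) ≤ J x := by
    filter_upwards [ae_restrict_of_ae hJ, ae_restrict_mem measurableSet_Icc] with x ⟨d', hd', hJx⟩ hx
    rw [hJx]
    have hprod : ∀ z : ℂ, -(‖z‖ * (1 + 1 / a)) ≤ (z * (1 + d' * Complex.I)).im := by
      intro z
      refine neg_le_of_abs_le ((Complex.abs_im_le_norm _).trans ?_)
      rw [norm_mul]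
      gcongr
      refine (norm_add_le _ _).trans ?_
      simpa using hd'
    by_cases hDx : D x ≤ h
    · have hdx : d x = h := max_eq_left ((min_le_left _ _).trans hDx)
      have hQn : Q n x = 2 ^ n := if_pos hDx
      have hsum : (2 : ℝ) ^ n ≤ 1 + ∑ i ∈ Finset.range n, Q i x := by
        have : ∀ i ∈ Finset.range n, Q i x = 2 ^ i := fun i hi => if_pos <| hDx.trans <|
          pow_le_pow_of_le_one hy₁.le (by linarith)
            (Nat.pow_le_pow_right two_pos (Finset.mem_range.1 hi).le)
        rw [Finset.sum_congr rfl this, geom_sum_eq (by norm_num)]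
        apply le_of_eq; ring
      have h1 := hcone x h hh0 hhy hDx
      have h2 : -Real.log h = 2 ^ n * L₀ := by rw [hh, Real.log_pow, hL₀]; push_cast; ring
      rw [h2] at h1
      rw [hdx, sub_self, zero_mul, add_zero, hQn]
      refine le_trans ?_ h1
      have h3 := mul_le_mul_of_nonneg_left hsum (mul_pos hL₀pos hB0).le
      nlinarith
    · rw [not_le] at hDx
      have hQn : Q n x = 0 := if_neg (not_le.2 hDx)
      have hdx : d x = min (D x) y₁ := max_eq_right (le_min hDx.le hhy)
      have hlogd := neg_log_min_le_sum hy₁ (by linarith) n hDx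
      rw [← hdx] at hlogd
      have hd0 : 0 < d x := hh0.trans_le (le_max_left _ _)
      have hdh : h ≤ d x := le_max_left _ _
      have hdy : d x ≤ y₁ := hdx ▸ min_le_right _ _
      have hLd : L₀ ≤ -Real.log (d x) := neg_le_neg (Real.log_le_log hd0 hdy)
      suffices hmain : -(B * -Real.log (d x)) ≤ (F (x + d x * Complex.I)).re +
          (d x - h) * (deriv F (x + d x * Complex.I) * (1 + d' * Complex.I)).im by
        refine le_trans ?_ hmain
        rw [hQn]
        have := mul_le_mul_of_nonneg_left hlogd hB0.le
        linarith
      set z := deriv F (x + d x * Complex.I) with hz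
      have hz0 : 0 ≤ ‖z‖ * (1 + 1 / a) := by positivity
      have hflux : -(d x * (‖z‖ * (1 + 1 / a))) ≤ (d x - h) * (z * (1 + d' * Complex.I)).im := by
        have h1 := mul_le_mul_of_nonneg_left (hprod z) (sub_nonneg.2 hdh)
        nlinarith
      by_cases hDy : D x ≤ y₁
      · have hdD : D x ≤ d x := by rw [hdx, min_eq_left hDy]
        have h1 := hcone x (d x) hd0 hdy hdD
        have h2 := norm_deriv_le_of_log_growth hK hF hub (w := x + d x * Complex.I)
          (by simpa using hd0) (by simpa using hdy.trans hy₁4)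
        simp only [Complex.add_im, Complex.ofReal_im, Complex.mul_im, Complex.ofReal_re,
          Complex.I_im, mul_one, Complex.I_re, mul_zero, add_zero, zero_add, ← hz] at h2
        rw [le_div_iff₀ hd0] at h2
        have h4 : 0 ≤ (F (x + d x * Complex.I)).re :=
          (mul_nonneg (by positivity) (hL₀pos.le.trans hLd)).trans h1
        have h3 : d x * (‖z‖ * (1 + 1 / a)) ≤ 16 * K * -Real.log (d x) * (1 + 1 / a) := by
          rw [← mul_assoc]
          exact mul_le_mul_of_nonneg_right (by linarith) (by positivity)
        have h5 : 0 ≤ M / L₀ * -Real.log (d x) := by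
          exact mul_nonneg (by positivity) (hL₀pos.le.trans hLd)
        rw [hB, add_mul, mul_right_comm (16 * K)]
        linarith
      · have hdy' : d x = y₁ := by rw [hdx, min_eq_right (not_le.1 hDy).le]
        have h1 := hM x hx
        rw [← hdy', ← hz] at h1
        have h2 := neg_le_of_abs_le (Complex.abs_re_le_norm (F (x + d x * Complex.I)))
        have h5 : M ≤ B * -Real.log (d x) := by
          rw [hdy', ← hL₀, hB, add_mul, div_mul_cancel₀ _ hL₀pos.ne']
          have : 0 ≤ 16 * K * (1 + 1 / a) * L₀ := by positivity
          linarith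
        linarith
  have hsumi : IntervalIntegrable (fun x => ∑ i ∈ Finset.range n, Q i x) volume 0 T := by
    have := IntervalIntegrable.sum (Finset.range n) (f := Q) (fun i _ => hQi i)
    simpa [Finset.sum_fn] using this
  have hint1 := (hQi n).const_mul (c / 2 + B)
  have hint2 := ((intervalIntegrable_const (c := (1 : ℝ))).add hsumi).const_mul B
  have key := intervalIntegral.integral_mono_ae_restrict hT.le ((hint1.sub hint2).const_mul L₀)
    hJi hlow
  rw [hJ0, intervalIntegral.integral_const_mul, intervalIntegral.integral_sub hint1 hint2,
    intervalIntegral.integral_const_mul, intervalIntegral.integral_const_mul,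
    intervalIntegral.integral_add intervalIntegrable_const hsumi,
    intervalIntegral.integral_finsetSum fun i _ => hQi i] at key
  simp only [hQint, intervalIntegral.integral_const, sub_zero, smul_eq_mul, mul_one] at key
  have := nonpos_of_mul_nonpos_right key hL₀pos
  linarith

/-- A set with small neighbourhoods along a doubly exponential sequence of scales is null for
every gauge that is `o(t |log t| ^ ω)` for all `ω > 0`. -/
theorem mkMetric_eq_zero_of_volume_neighborhood_le {lam : ℝ → ℝ}
    (hsmall : ∀ ω : ℝ, 0 < ω →
      Tendsto (fun t : ℝ => lam t / (t * |Real.log t| ^ ω)) (nhdsWithin 0 (Set.Ioi 0)) (nhds 0))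
    {E E' : Set ℝ} {T a y₁ q : ℝ} (hT : 0 < T) (ha : 0 < a) (hy₁ : 0 < y₁) (hy₁1 : y₁ < 1)
    (hq : 0 < q) (hq1 : q < 1) (hE : E ⊆ Set.Ico 0 T) (hEE' : E ⊆ E')
    (hvol : ∀ n : ℕ,
      volume.real {x ∈ Set.Icc 0 T | Metric.infDist x E' ≤ a * y₁ ^ 2 ^ n} ≤ T * q ^ n) :
    (Measure.mkMetric fun d => ENNReal.ofReal (lam d.toReal) : Measure ℝ) E = 0 := by
  classical
  set h : ℕ → ℝ := fun n => a * y₁ ^ 2 ^ n with hh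
  have hh0 : ∀ n, 0 < h n := fun n => by positivity
  have hhlim : Tendsto h atTop (nhds 0) := by
    have h1 : Tendsto (fun n : ℕ => y₁ ^ 2 ^ n) atTop (nhds 0) :=
      (tendsto_pow_atTop_nhds_zero_of_lt_one hy₁.le hy₁1).comp
        (tendsto_pow_atTop_atTop_of_one_lt one_lt_two)
    simpa using h1.const_mul a
  set N : ℕ → ℕ := fun n => ⌈T / h n⌉₊ with hN
  have hN0 : ∀ n, 0 < N n := fun n => Nat.ceil_pos.2 (div_pos hT (hh0 n))
  set δ : ℕ → ℝ := fun n => T / N n with hδ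
  have hN0' : ∀ n, (0 : ℝ) < N n := fun n => Nat.cast_pos.2 (hN0 n)
  have hδ0 : ∀ n, 0 < δ n := fun n => div_pos hT (hN0' n)
  have hδh : ∀ n, δ n ≤ h n := fun n => by
    have := Nat.le_ceil (T / h n)
    rw [div_le_iff₀ (hh0 n)] at this
    rw [hδ]
    exact (div_le_iff₀ (hN0' n)).2 (by rw [mul_comm]; exact this)
  have hδlow : ∀ n, h n ≤ T → h n / 2 ≤ δ n := fun n hn => by
    have h1 := Nat.ceil_lt_add_one (div_pos hT (hh0 n)).le
    have h2 : (1 : ℝ) ≤ T / h n := (one_le_div (hh0 n)).2 hn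
    have h3 : (N n : ℝ) ≤ 2 * (T / h n) := by
      simp only [hN]; linarith
    rw [hδ]
    refine (le_div_iff₀ (hN0' n)).2 ?_
    calc h n / 2 * N n ≤ h n / 2 * (2 * (T / h n)) := by gcongr
      _ = T := by field_simp [(hh0 n).ne']
  have hδlim : Tendsto δ atTop (nhds 0) :=
    tendsto_of_tendsto_of_tendsto_of_le_of_le tendsto_const_nhds hhlim (fun n => (hδ0 n).le) hδh
  set I : ℕ → ℕ → Set ℝ := fun n j => Set.Ico (j * δ n) (j * δ n + δ n) with hI
  set S : ℕ → Finset ℕ := fun n => (Finset.range (N n)).filter fun j => (I n j ∩ E).Nonempty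
    with hS
  have hediam : ∀ n j, Metric.ediam (I n j) = ENNReal.ofReal (δ n) := by
    intro n j
    simp [hI, Real.ediam_Ico]
  have hcover : ∀ n, E ⊆ ⋃ j : S n, I n j := by
    intro n x hx
    have hx0 := hE hx
    have hpos : 0 ≤ x / δ n := div_nonneg hx0.1 (hδ0 n).le
    have h1 := Nat.floor_le hpos
    have h2 := Nat.lt_floor_add_one (x / δ n)
    rw [le_div_iff₀ (hδ0 n)] at h1
    rw [div_lt_iff₀ (hδ0 n), add_mul, one_mul] at h2
    have hxI : x ∈ I n ⌊x / δ n⌋₊ := ⟨h1, h2⟩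
    refine Set.mem_iUnion.2 ⟨⟨⌊x / δ n⌋₊, Finset.mem_filter.2 ⟨Finset.mem_range.2 ?_, x, hxI, hx⟩⟩,
      hxI⟩
    rw [Nat.floor_lt hpos, div_lt_iff₀ (hδ0 n), hδ, mul_div_cancel₀ _ (hN0' n).ne']
    exact hx0.2
  have hcard : ∀ n, (S n).card * δ n ≤ T * q ^ n := by
    intro n
    refine le_trans ?_ (hvol n)
    have hdisj : Set.PairwiseDisjoint (S n : Set ℕ) (I n) := by
      intro i _ j _ hij
      wlog hlt : i < j generalizing i j
      · exact (this ‹_› ‹_› hij.symm (lt_of_le_of_ne (not_lt.1 hlt) hij.symm)).symm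
      refine Set.disjoint_left.2 fun x hx hx' => ?_
      have h1 : (i : ℝ) + 1 ≤ j := by exact_mod_cast hlt
      have h2 := mul_le_mul_of_nonneg_right h1 (hδ0 n).le
      have h3 := hx.2
      have h4 := hx'.1
      linarith
    have hU : volume.real (⋃ j ∈ S n, I n j) = (S n).card * δ n := by
      rw [measureReal_biUnion_finset hdisj (fun _ _ => measurableSet_Ico)
        (fun _ _ => by simp [hI])]
      simp [hI, (hδ0 n).le]
    rw [← hU]
    refine measureReal_mono (fun x hx => ?_)
      (measure_ne_top_of_subset (Set.sep_subset _ _) (by simp))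
    obtain ⟨j, hj, hxj⟩ := Set.mem_iUnion₂.1 hx
    obtain ⟨hjN, z, hzI, hzE⟩ := Finset.mem_filter.1 hj
    have h1 : (j : ℝ) + 1 ≤ N n := by exact_mod_cast Finset.mem_range.1 hjN
    have h2 := mul_le_mul_of_nonneg_right h1 (hδ0 n).le
    have h3 : N n * δ n = T := by rw [hδ]; exact mul_div_cancel₀ _ (hN0' n).ne'
    refine ⟨⟨le_trans (mul_nonneg j.cast_nonneg (hδ0 n).le) hxj.1, ?_⟩, ?_⟩
    · linarith [hxj.2]
    · refine (Metric.infDist_le_dist_of_mem (hEE' hzE)).trans (le_trans ?_ (hδh n))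
      rw [Real.dist_eq, abs_le]
      constructor <;> linarith [hxj.1, hxj.2, hzI.1, hzI.2]
  set ω : ℝ := -Real.log q / Real.log 2 with hω
  have hl2 := Real.log_pos one_lt_two
  have hω0 : 0 < ω := div_pos (by linarith [Real.log_neg hq hq1]) hl2
  have h2ω : (2 : ℝ) ^ ω = q⁻¹ := by
    rw [Real.rpow_def_of_pos two_pos, hω, mul_div_cancel₀ _ hl2.ne', Real.exp_neg, Real.exp_log hq]
  have hratio := (hsmall ω hω0).comp (tendsto_nhdsWithin_iff.2
    ⟨hδlim, Eventually.of_forall fun n => hδ0 n⟩)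
  set A : ℝ := |Real.log (a / 2)| + -Real.log y₁ with hA
  have hA0 : 0 ≤ A := by
    have := Real.log_neg hy₁ hy₁1
    have := abs_nonneg (Real.log (a / 2))
    linarith
  have hlogδ : ∀ᶠ n in atTop, |Real.log (δ n)| ≤ A * 2 ^ n := by
    filter_upwards [hhlim.eventually_lt_const hT, hδlim.eventually_lt_const one_pos] with n hn hn1
    have h1 := Real.log_le_log (by linarith [hh0 n]) (hδlow n hn.le)
    have h2 : h n / 2 = a / 2 * y₁ ^ 2 ^ n := by simp only [hh]; ring
    rw [h2, Real.log_mul (by positivity) (by positivity), Real.log_pow] at h1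
    push_cast at h1
    rw [abs_of_nonpos (Real.log_nonpos (hδ0 n).le hn1.le), hA, add_mul]
    have h3 : |Real.log (a / 2)| ≤ |Real.log (a / 2)| * 2 ^ n :=
      le_mul_of_one_le_right (abs_nonneg _) (one_le_pow₀ one_le_two)
    have h4 := neg_abs_le (Real.log (a / 2))
    linarith
  have hbound : ∀ᶠ n in atTop, (S n).card * lam (δ n) ≤
      T * A ^ ω * |lam (δ n) / (δ n * |Real.log (δ n)| ^ ω)| := by
    filter_upwards [hlogδ, hδlim.eventually_lt_const one_pos] with n hn hn1
    have hlog : 0 < |Real.log (δ n)| := abs_pos.2 (Real.log_neg (hδ0 n) hn1).ne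
    have hp : 0 < |Real.log (δ n)| ^ ω := Real.rpow_pos_of_pos hlog ω
    have h1 : |Real.log (δ n)| ^ ω ≤ A ^ ω * (q⁻¹) ^ n := by
      refine (Real.rpow_le_rpow hlog.le hn hω0.le).trans_eq ?_
      rw [Real.mul_rpow hA0 (by positivity), ← h2ω, ← Real.rpow_natCast, ← Real.rpow_natCast,
        ← Real.rpow_mul two_pos.le, ← Real.rpow_mul two_pos.le, mul_comm ω]
    have h2 : (S n).card * (δ n * |Real.log (δ n)| ^ ω) ≤ T * A ^ ω := by
      calc (S n).card * (δ n * |Real.log (δ n)| ^ ω)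
          = ((S n).card * δ n) * |Real.log (δ n)| ^ ω := by ring
        _ ≤ (T * q ^ n) * (A ^ ω * (q⁻¹) ^ n) :=
          mul_le_mul (hcard n) h1 hp.le (by positivity)
        _ = T * A ^ ω * (q ^ n * (q⁻¹) ^ n) := by ring
        _ = T * A ^ ω := by rw [← mul_pow, mul_inv_cancel₀ hq.ne', one_pow, mul_one]
    have hden : 0 < δ n * |Real.log (δ n)| ^ ω := mul_pos (hδ0 n) hp
    calc (S n).card * lam (δ n)
        = (S n).card * (δ n * |Real.log (δ n)| ^ ω) *
          (lam (δ n) / (δ n * |Real.log (δ n)| ^ ω)) := by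
          rw [mul_assoc, mul_div_cancel₀ _ hden.ne']
      _ ≤ (S n).card * (δ n * |Real.log (δ n)| ^ ω) *
          |lam (δ n) / (δ n * |Real.log (δ n)| ^ ω)| := by
          gcongr; exact le_abs_self _
      _ ≤ _ := by gcongr
  have hlim : Tendsto (fun n => ENNReal.ofReal ((S n).card * lam (δ n))) atTop (nhds 0) := by
    have h1 := (hratio.abs.const_mul (T * A ^ ω))
    rw [abs_zero, mul_zero] at h1
    have h2 := ENNReal.tendsto_ofReal h1
    rw [ENNReal.ofReal_zero] at h2
    exact tendsto_of_tendsto_of_tendsto_of_le_of_le' tendsto_const_nhds h2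
      (Eventually.of_forall fun n => zero_le)
      (hbound.mono fun n hn => ENNReal.ofReal_le_ofReal hn)
  have hmk := Measure.mkMetric_le_liminf_sum (ι := fun n => S n) E (l := atTop)
    (fun n => ENNReal.ofReal (δ n)) (by simpa using ENNReal.tendsto_ofReal hδlim)
    (fun n j => I n j) (Eventually.of_forall fun n j => (hediam n j).le)
    (Eventually.of_forall hcover) (fun d => ENNReal.ofReal (lam d.toReal))
  refine le_antisymm (hmk.trans ?_) zero_le
  simp only [hediam, ENNReal.toReal_ofReal (hδ0 _).le, Finset.sum_const, Finset.card_univ,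
    Fintype.card_coe, nsmul_eq_mul]
  refine le_of_eq (Eq.trans ?_ hlim.liminf_eq)
  congr 1
  ext n
  rw [ENNReal.ofReal_mul (Nat.cast_nonneg _), ENNReal.ofReal_natCast]

theorem exists_exp_eq {f : ℂ → ℂ} (hf : DifferentiableOn ℂ f (Metric.ball 0 1))
    (hzf : ∀ z ∈ Metric.ball (0 : ℂ) 1, f z ≠ 0) :
    ∃ g : ℂ → ℂ, DifferentiableOn ℂ g (Metric.ball 0 1) ∧
      ∀ z ∈ Metric.ball (0 : ℂ) 1, f z = Complex.exp (g z) := by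
  have h0 : (0 : ℂ) ∈ Metric.ball (0 : ℂ) 1 := by simp
  obtain ⟨g, hg0, hg⟩ := ((hf.deriv Metric.isOpen_ball).div hf hzf).isExactOn_ball.with_val_at 0
    (Complex.log (f 0))
  refine ⟨g, fun z hz => (hg z hz).differentiableAt.differentiableWithinAt, fun z hz => ?_⟩
  have hd : ∀ w ∈ Metric.ball (0 : ℂ) 1,
      HasDerivAt (fun w => f w * Complex.exp (-g w)) 0 w := by
    intro w hw
    have h1 := (hf.differentiableAt (Metric.isOpen_ball.mem_nhds hw)).hasDerivAt
    have h2 := h1.mul (hg w hw).neg.cexp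
    convert! h2 using 1
    have := hzf w hw
    simp only [Pi.div_apply]
    field_simp
    ring
  have hconst := Metric.isOpen_ball.is_const_of_deriv_eq_zero (convex_ball 0 1).isPreconnected
    (fun w hw => (hd w hw).differentiableAt.differentiableWithinAt) (fun w hw => (hd w hw).deriv)
    hz h0
  simp only [hg0, Complex.exp_neg, Complex.exp_log (hzf 0 h0), mul_inv_cancel₀ (hzf 0 h0)] at hconst
  exact eq_of_div_eq_one (by rw [div_eq_mul_inv]; exact hconst)

theorem one_half_mul_le_one_sub_exp_neg {y : ℝ} (hy : 0 ≤ y) (hy1 : y ≤ 1) :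
    y / 2 ≤ 1 - Real.exp (-y) := by
  have h1 := Real.add_one_le_exp y
  rw [Real.exp_neg]
  have h2 : (Real.exp y)⁻¹ ≤ (y + 1)⁻¹ := inv_anti₀ (by linarith) h1
  have h3 : (y + 1)⁻¹ ≤ 1 - y / 2 := by
    rw [inv_le_iff_one_le_mul₀ (by linarith)]; nlinarith
  linarith

/-- A zero-free function in the Korenblum class lifts to the upper half-plane as `f = exp (F + b)`,
where `F` has a periodic primitive `G`. -/
theorem Korenblum.exists_lift {f : ℂ → ℂ} (hf : Korenblum f)
    (hzf : ∀ z ∈ Metric.ball (0 : ℂ) 1, f z ≠ 0) :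
    ∃ (F G : ℂ → ℂ) (b K : ℝ), DifferentiableOn ℂ F {w | 0 < w.im} ∧
      (∀ w : ℂ, 0 < w.im → HasDerivAt G (F w) w) ∧
      (∀ w, F (w + (2 * Real.pi : ℝ)) = F w) ∧ (∀ w, G (w + (2 * Real.pi : ℝ)) = G w) ∧
      (∀ w : ℂ, 0 < w.im → (F w).re = Real.log ‖f (Complex.exp (Complex.I * w))‖ - b) ∧
      ∀ w : ℂ, 0 < w.im → w.im ≤ 1 / 2 → (F w).re ≤ K * -Real.log w.im := by
  obtain ⟨hfd, C, k, hC, hk, hbd⟩ := hf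
  obtain ⟨g, hg, hfg⟩ := exists_exp_eq hfd hzf
  have h0 : (0 : ℂ) ∈ Metric.ball (0 : ℂ) 1 := by simp
  have hball : ∀ w : ℂ, 0 < w.im → Complex.exp (Complex.I * w) ∈ Metric.ball (0 : ℂ) 1 := by
    intro w hw
    rw [mem_ball_zero_iff, Complex.norm_exp]
    simpa using hw
  have hper : ∀ w : ℂ, Complex.exp (Complex.I * (w + (2 * Real.pi : ℝ))) =
      Complex.exp (Complex.I * w) := by
    intro w
    rw [← Complex.exp_periodic (Complex.I * w)]
    push_cast
    ring_nf
  have hexp : ∀ w : ℂ, HasDerivAt (fun w => Complex.exp (Complex.I * w))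
      (Complex.exp (Complex.I * w) * Complex.I) w := fun w => by
    simpa using ((hasDerivAt_id w).const_mul Complex.I).cexp
  have hds : DifferentiableOn ℂ (dslope g 0) (Metric.ball 0 1) :=
    (Complex.differentiableOn_dslope (Metric.isOpen_ball.mem_nhds h0)).2 hg
  obtain ⟨Q, hQ⟩ := hds.isExactOn_ball
  have hre : ∀ w : ℂ, 0 < w.im → (g (Complex.exp (Complex.I * w)) - g 0).re =
      Real.log ‖f (Complex.exp (Complex.I * w))‖ - (g 0).re := by
    intro w hw
    rw [hfg _ (hball w hw), Complex.norm_exp, Real.log_exp, Complex.sub_re]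
  have hl2 := Real.log_pos one_lt_two
  refine ⟨fun w => g (Complex.exp (Complex.I * w)) - g 0,
    fun w => -Complex.I * Q (Complex.exp (Complex.I * w)), (g 0).re,
    2 * k + (|Real.log C| + |(g 0).re|) / Real.log 2, ?_, ?_, ?_, ?_, hre, ?_⟩
  · refine DifferentiableOn.sub_const ?_ _
    exact hg.comp (fun w _ => (hexp w).differentiableAt.differentiableWithinAt) hball
  · intro w hw
    have h1 := ((hQ _ (hball w hw)).comp w (hexp w)).const_mul (-Complex.I)
    convert! h1 using 1
    have h2 := sub_smul_dslope g 0 (Complex.exp (Complex.I * w))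
    rw [sub_zero, smul_eq_mul] at h2
    show g (Complex.exp (Complex.I * w)) - g 0 = _
    rw [← h2]
    linear_combination (Complex.exp (Complex.I * w) *
      dslope g 0 (Complex.exp (Complex.I * w))) * Complex.I_sq
  · intro w
    simp only [hper]
  · intro w
    simp only [hper]
  · intro w hw hw2
    rw [hre w hw]
    have hz := hball w hw
    have hn : ‖Complex.exp (Complex.I * w)‖ = Real.exp (-w.im) := by
      rw [Complex.norm_exp]; simp
    have h1 := hbd _ hz
    rw [hn] at h1
    have h2 := one_half_mul_le_one_sub_exp_neg hw.le (by linarith)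
    have hpos : 0 < 1 - Real.exp (-w.im) := by linarith
    have h3 := Real.log_le_log (norm_pos_iff.2 (hzf _ hz)) h1
    rw [Real.log_div hC.ne' (Real.rpow_pos_of_pos hpos k).ne', Real.log_rpow hpos] at h3
    have h4 := Real.log_le_log (by linarith) h2
    rw [Real.log_div hw.ne' two_ne_zero] at h4
    have h5 : Real.log 2 ≤ -Real.log w.im := by
      rw [← Real.log_inv]
      exact Real.log_le_log two_pos ((le_inv_comm₀ two_pos hw).2 (by linarith))
    have h6 : |Real.log C| + |(g 0).re| ≤
        (|Real.log C| + |(g 0).re|) / Real.log 2 * -Real.log w.im := by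
      rw [div_mul_eq_mul_div, le_div_iff₀ hl2]
      gcongr
    have h7 := le_abs_self (Real.log C)
    have h8 := neg_le_abs (g 0).re
    have h9 := mul_le_mul_of_nonneg_left h4 hk.le
    have h10 := mul_le_mul_of_nonneg_left h5 hk.le
    rw [add_mul]
    linarith

/-- The ray condition defining `Dplus` in terms of the half-plane variable. -/
theorem exists_le_re_of_mem_Dplus {f F : ℂ → ℂ} {b θ : ℝ} (hθ : θ ∈ Dplus f)
    (hre : ∀ w : ℂ, 0 < w.im → (F w).re = Real.log ‖f (Complex.exp (Complex.I * w))‖ - b) :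
    ∃ N : ℕ, ∀ y : ℝ, 0 < y → y ≤ 1 / ((N : ℝ) + 4) →
      1 / ((N : ℝ) + 1) * -Real.log y ≤ (F (θ + y * Complex.I)).re := by
  obtain ⟨-, c, hc, hev⟩ := hθ
  obtain ⟨r₀, hr₀, hr⟩ := (mem_nhdsLT_iff_exists_Ioo_subset' (zero_lt_one' ℝ)).1 hev
  have hr₀1 : r₀ < 1 := hr₀
  have hsmall : ∀ᶠ t : ℝ in atTop, 1 / (t + 4) < 1 - r₀ ∧ 1 / (t + 1) ≤ c / 2 ∧
      |b| ≤ c / 2 * Real.log (t + 4) := by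
    have h1 : Tendsto (fun t : ℝ => t + 4) atTop atTop :=
      tendsto_atTop_add_const_right _ _ tendsto_id
    have h2 : Tendsto (fun t : ℝ => t + 1) atTop atTop :=
      tendsto_atTop_add_const_right _ _ tendsto_id
    simp only [one_div]
    refine ((tendsto_inv_atTop_zero.comp h1).eventually_lt_const (by linarith)).and
      (((tendsto_inv_atTop_zero.comp h2).eventually_le_const (by positivity)).and
        (((Real.tendsto_log_atTop.comp h1).const_mul_atTop (by positivity)).eventually_ge_atTop _))
  obtain ⟨N, hN1, hN2, hN3⟩ := (tendsto_natCast_atTop_atTop.eventually hsmall).exists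
  refine ⟨N, fun y hy hyN => ?_⟩
  have hN4 : (0 : ℝ) < (N : ℝ) + 4 := by positivity
  have hy4 : y ≤ 1 / 4 := hyN.trans (one_div_le_one_div_of_le (by norm_num) (by simp))
  have hlogy : Real.log (N + 4) ≤ -Real.log y := by
    rw [← Real.log_inv]
    exact Real.log_le_log hN4 ((le_inv_comm₀ hN4 hy).2 (by rwa [← one_div]))
  have hlow := one_half_mul_le_one_sub_exp_neg hy.le (by linarith)
  have hup : 1 - Real.exp (-y) ≤ y := by linarith [Real.add_one_le_exp (-y)]
  have hlog0 : 0 ≤ -Real.log y := by linarith [Real.log_nonpos hy.le (by linarith : y ≤ 1)]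
  have hlog : -Real.log y ≤ |Real.log (1 - Real.exp (-y))| :=
    (neg_le_neg (Real.log_le_log (by linarith) hup)).trans (neg_le_abs _)
  have hpos : 0 < |Real.log (1 - Real.exp (-y))| :=
    abs_pos.2 (Real.log_neg (by linarith) (by linarith)).ne
  have hmem : Real.exp (-y) ∈ Set.Ioo r₀ 1 := ⟨by linarith, by linarith⟩
  have hray := hr hmem
  rw [Set.mem_ofPred_eq, le_div_iff₀ hpos] at hray
  have hexp : Complex.exp (Complex.I * (θ + y * Complex.I)) =
      (Real.exp (-y) : ℂ) * Complex.exp (Complex.I * θ) := by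
    rw [Complex.ofReal_exp, ← Complex.exp_add]
    congr 1
    push_cast
    linear_combination (y : ℂ) * Complex.I_sq
  rw [hre _ (by simpa using hy), hexp]
  have h1 := mul_le_mul_of_nonneg_left hlog hc.le
  have h2 := mul_le_mul_of_nonneg_right hN2 hlog0
  have h3 := mul_le_mul_of_nonneg_left hlogy (half_pos hc).le
  linarith [le_abs_self b]

/-- If `λ` is increasing with `λ(0)=0` and `λ(t) = o(t |log t|^ω)` as `t → 0⁺` for every
`ω > 0`, then `H_λ(D_+(f)) = 0` for every zero-free `f ∈ A^{-∞}`. -/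
theorem stmt0 (lam : ℝ → ℝ)
    (hmono : MonotoneOn lam (Set.Ico 0 1))
    (hnonneg : ∀ t ∈ Set.Ico (0:ℝ) 1, 0 ≤ lam t)
    (hlam0 : lam 0 = 0)
    (hsmall : ∀ ω : ℝ, 0 < ω →
      Tendsto (fun t : ℝ => lam t / (t * |Real.log t| ^ ω))
        (nhdsWithin 0 (Set.Ioi 0)) (nhds 0))
    (f : ℂ → ℂ) (hf : Korenblum f)
    (hzf : ∀ z ∈ Metric.ball (0:ℂ) 1, f z ≠ 0) :
    hausdorffGauge lam (Dplus f) = 0 := by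
  obtain ⟨F, G, b, K, hF, hG, hFper, hGper, hre, hub⟩ := hf.exists_lift hzf
  set E : ℕ → Set ℝ := fun N => {x : ℝ | ∀ y : ℝ, 0 < y → y ≤ 1 / ((N : ℝ) + 4) →
    1 / ((N : ℝ) + 1) * -Real.log y ≤ (F (x + y * Complex.I)).re} with hE
  have hcover : Dplus f ⊆ ⋃ N, Dplus f ∩ E N := fun θ hθ =>
    let ⟨N, hN⟩ := exists_le_re_of_mem_Dplus hθ hre
    Set.mem_iUnion.2 ⟨N, hθ, hN⟩
  refine measure_mono_null hcover (measure_iUnion_null fun N => ?_)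
  rcases (E N).eq_empty_or_nonempty with hN | hN
  · simp [hN]
  · have hT : 0 < 2 * Real.pi := Real.two_pi_pos
    have hy₁ : 0 < 1 / ((N : ℝ) + 4) := by positivity
    have hy₁4 : 1 / ((N : ℝ) + 4) ≤ 1 / 4 := one_div_le_one_div_of_le (by norm_num) (by simp)
    have hub' : ∀ w : ℂ, 0 < w.im → w.im ≤ 1 / 2 →
        (F w).re ≤ max K (1 / ((N : ℝ) + 1)) * -Real.log w.im := fun w hw hw2 =>
      (hub w hw hw2).trans (mul_le_mul_of_nonneg_right (le_max_left _ _)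
        (neg_nonneg.2 (Real.log_nonpos hw.le (by linarith))))
    obtain ⟨a, q, ha, hq, hq1, hvol⟩ := volume_neighborhood_le (by positivity) (le_max_right _ _)
      hT hy₁ hy₁4 hF hG hFper hGper hub' rfl hN
    exact mkMetric_eq_zero_of_volume_neighborhood_le hsmall hT ha hy₁ (by linarith) hq hq1
      (fun x hx => hx.1.1) Set.inter_subset_right hvol
end
end

section
/- Let λ : [0,1) → [0,∞) be an increasing function with λ(0) = 0 such that λ(t) = o(t·|log t|^ω) as t → 0 for every ω > 0. Then for every function f in the Korenblum class A^{-∞}, the Hausdorff measure H_λ of the set D_−(f) is zero. -/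
open Filter MeasureTheory

noncomputable section

/-- `D_-(f)`: the set of `θ ∈ [0, 2π)` such that
`limsup_{r→1⁻} log|f(re^{iθ})| / |log(1-r)| < 0`. -/
def Dminus (f : ℂ → ℂ) : Set ℝ :=
  {θ | θ ∈ Set.Ico 0 (2 * Real.pi) ∧
    ∃ c : ℝ, 0 < c ∧ ∀ᶠ r : ℝ in nhdsWithin 1 (Set.Iio 1),
      Real.log ‖f ((r : ℂ) * Complex.exp (Complex.I * (θ : ℂ)))‖ / |Real.log (1 - r)| ≤ -c}

theorem one_le_norm_canonicalFactor {R : ℝ} {a z : ℂ} (ha : a ∈ Metric.ball 0 R)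
    (hz : z ∈ Metric.closedBall 0 R) (hza : z ≠ a) :
    1 ≤ ‖Complex.canonicalFactor R a z‖ := by
  rw [mem_ball_zero_iff] at ha
  rw [mem_closedBall_zero_iff] at hz
  have hR : 0 < R := (norm_nonneg a).trans_lt ha
  have hd : 0 < ‖z - a‖ := norm_pos_iff.mpr (sub_ne_zero.mpr hza)
  rw [Complex.canonicalFactor_apply, norm_div, norm_mul, Complex.norm_of_nonneg hR.le,
    one_le_div (mul_pos hR hd)]
  refine abs_le_of_sq_le_sq' ?_ (norm_nonneg _) |>.2
  have h1 : (R * ‖z - a‖) ^ 2 = R ^ 2 * ((z.re - a.re) ^ 2 + (z.im - a.im) ^ 2) := by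
    rw [mul_pow, ← Complex.normSq_eq_norm_sq, Complex.normSq_apply, Complex.sub_re,
      Complex.sub_im]
    ring
  have h2 : ‖(R : ℂ) ^ 2 - (starRingEnd ℂ) a * z‖ ^ 2 =
      (R ^ 2 - (a.re * z.re + a.im * z.im)) ^ 2 + (a.re * z.im - a.im * z.re) ^ 2 := by
    rw [← Complex.normSq_eq_norm_sq, Complex.normSq_apply]
    simp [← Complex.ofReal_pow]; ring
  have h3 : a.re ^ 2 + a.im ^ 2 ≤ R ^ 2 := by
    have := Complex.normSq_eq_norm_sq a
    rw [Complex.normSq_apply] at this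
    nlinarith [norm_nonneg a]
  have h4 : z.re ^ 2 + z.im ^ 2 ≤ R ^ 2 := by
    have := Complex.normSq_eq_norm_sq z
    rw [Complex.normSq_apply] at this
    nlinarith [norm_nonneg z]
  rw [h1, h2]
  nlinarith [mul_nonneg (sub_nonneg.mpr h3) (sub_nonneg.mpr h4)]

/-- **Poisson–Jensen inequality** for a function analytic on a closed disc and without zeros on its
boundary circle. -/
theorem log_norm_le_circleAverage_poissonKernel {f : ℂ → ℂ} {R : ℝ} {w : ℂ}
    (hf : AnalyticOnNhd ℂ f (Metric.closedBall 0 R)) (hw : w ∈ Metric.ball 0 R) (hfw : f w ≠ 0)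
    (hs : ∀ z ∈ Metric.sphere 0 R, f z ≠ 0) :
    Real.log ‖f w‖ ≤
      Real.circleAverage (poissonKernel 0 w • fun z => Real.log ‖f z‖) 0 R := by
  have hR : 0 < R := Metric.pos_of_mem_ball hw
  have hwc := Metric.ball_subset_closedBall hw
  have hord : ∀ z ∈ Metric.closedBall (0 : ℂ) R, f z ≠ 0 → meromorphicOrderAt f z = 0 := by
    intro z hz hfz
    rw [(hf z hz).meromorphicOrderAt_eq, (hf z hz).analyticOrderAt_eq_zero.mpr hfz]; rfl
  have htop : ∀ u : Metric.closedBall (0 : ℂ) R, meromorphicOrderAt f u ≠ ⊤ := by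
    rw [← hf.meromorphicOn.exists_meromorphicOrderAt_ne_top_iff_forall
      ⟨⟨w, hwc⟩, (convex_closedBall 0 R).isPreconnected⟩]
    exact ⟨⟨w, hwc⟩, by simp [hord w hwc hfw]⟩
  obtain ⟨h, D⟩ := hf.meromorphicOn.exists_ecanonicalDecomp htop
  have hsph : ∀ i, MeromorphicOn.divisor f (Metric.sphere 0 R) i = 0 := by
    intro i
    by_cases hi : i ∈ Metric.sphere (0 : ℂ) R
    · rw [MeromorphicOn.divisor_apply (hf.meromorphicOn.mono_set Metric.sphere_subset_closedBall) hi,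
        hord i (Metric.sphere_subset_closedBall hi) (hs i hi)]
      rfl
    · exact Function.locallyFinsuppWithin.apply_eq_zero_of_notMem _ hi
  have hlog : ∀ z ∈ Metric.closedBall (0 : ℂ) R, f z ≠ 0 → Real.log ‖h z‖ =
      (∑ᶠ i, (MeromorphicOn.divisor f (Metric.ball 0 R) i) *
        Real.log ‖Complex.canonicalFactor R i z‖) + Real.log ‖f z‖ := by
    intro z hz hfz
    rw [D.log_norm_eq hz (hord z hz hfz) hR, (hf z hz).meromorphicTrailingCoeffAt_of_ne_zero hfz]
    simp [hsph]
  have hpoisson : Real.circleAverage (poissonKernel 0 w • fun z => Real.log ‖h z‖) 0 R =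
      Real.log ‖h w‖ :=
    InnerProductSpace.HarmonicOnNhd.circleAverage_poissonKernel_smul (f := fun z => Real.log ‖h z‖)
      (fun z hz => (D.analyticOnNhd z hz).harmonicAt_log_norm (D.ne_zero z hz)) hw
  have hcircle : Real.circleAverage (poissonKernel 0 w • fun z => Real.log ‖h z‖) 0 R =
      Real.circleAverage (poissonKernel 0 w • fun z => Real.log ‖f z‖) 0 R := by
    refine Real.circleAverage_congr_sphere fun z hz => ?_
    rw [abs_of_pos hR] at hz
    simp only [Pi.smul_apply', smul_eq_mul]
    congr 1
    rw [hlog z (Metric.sphere_subset_closedBall hz) (hs z hz), add_eq_right]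
    refine finsum_eq_zero_of_forall_eq_zero fun i => ?_
    by_cases hi : i ∈ Metric.ball (0 : ℂ) R
    · rw [Complex.norm_canonicalFactor_eval_circle_eq_one hi hz]; simp
    · simp [hi]
  rw [← hcircle, hpoisson, hlog w hwc hfw]
  refine le_add_of_nonneg_left (finsum_nonneg fun i => ?_)
  by_cases hi : i ∈ Metric.ball (0 : ℂ) R
  · refine mul_nonneg ?_ ?_
    · have := MeromorphicOn.AnalyticOnNhd.divisor_nonneg
        (hf.mono (Metric.ball_subset_closedBall (x := (0 : ℂ)) (ε := R)))
      exact_mod_cast this i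
    · by_cases hiw : w = i
      · subst hiw; simp
      · exact Real.log_nonneg (one_le_norm_canonicalFactor hi hwc hiw)
  · simp [hi]

/-- The Poisson kernel of the disc of radius `R` at a point of modulus `r`, as a function of the
angle. -/
def anglePoissonKernel (r R t : ℝ) : ℝ :=
  (R ^ 2 - r ^ 2) / ((R - r) ^ 2 + 4 * R * r * Real.sin (t / 2) ^ 2)

theorem poissonKernel_circleMap (r R θ φ : ℝ) :
    poissonKernel 0 (circleMap 0 r θ) (circleMap 0 R φ) = anglePoissonKernel r R (θ - φ) := by
  have hn : ∀ s x : ℝ, ‖circleMap 0 s x‖ ^ 2 = s ^ 2 := by simp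
  rw [poissonKernel_def, anglePoissonKernel]
  simp only [sub_zero, hn]
  congr 1
  rw [← Complex.normSq_eq_norm_sq, Complex.normSq_apply]
  have h1 : Real.sin ((θ - φ) / 2) ^ 2 = (1 - Real.cos (θ - φ)) / 2 := by
    rw [Real.sin_sq_eq_half_sub]; ring_nf
  rw [h1, Real.cos_sub]
  simp [circleMap, Complex.exp_re, Complex.exp_im]
  linear_combination r ^ 2 * Real.sin_sq_add_cos_sq θ + R ^ 2 * Real.sin_sq_add_cos_sq φ

theorem integral_anglePoissonKernel {r R : ℝ} (hr : 0 ≤ r) (hrR : r < R) (θ : ℝ) :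
    ∫ φ in 0..2 * Real.pi, anglePoissonKernel r R (θ - φ) = 2 * Real.pi := by
  have hw : circleMap 0 r θ ∈ Metric.ball (0 : ℂ) R := by simp [abs_of_nonneg hr, hrR]
  have h := InnerProductSpace.HarmonicOnNhd.circleAverage_poissonKernel_smul (f := fun _ => (1 : ℝ))
      (fun z _ => InnerProductSpace.harmonicAt_const 1) hw
  rw [Real.circleAverage] at h
  simp only [Pi.smul_apply', poissonKernel_circleMap, smul_eq_mul, mul_one] at h
  field_simp at h
  linarith

theorem log_norm_le_integral_anglePoissonKernel {f : ℂ → ℂ} {r R θ : ℝ} (hr : 0 ≤ r) (hrR : r < R)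
    (hf : AnalyticOnNhd ℂ f (Metric.closedBall 0 R)) (hfw : f (circleMap 0 r θ) ≠ 0)
    (hs : ∀ z ∈ Metric.sphere 0 R, f z ≠ 0) :
    2 * Real.pi * Real.log ‖f (circleMap 0 r θ)‖ ≤
      ∫ φ in 0..2 * Real.pi, anglePoissonKernel r R (θ - φ) * Real.log ‖f (circleMap 0 R φ)‖ := by
  have hw : circleMap 0 r θ ∈ Metric.ball (0 : ℂ) R := by simp [abs_of_nonneg hr, hrR]
  have h := log_norm_le_circleAverage_poissonKernel hf hw hfw hs
  rw [Real.circleAverage] at h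
  simp only [Pi.smul_apply', poissonKernel_circleMap, smul_eq_mul] at h
  rw [inv_mul_eq_div, le_div_iff₀ Real.two_pi_pos] at h
  linarith

theorem anglePoissonKernel_nonneg {r R : ℝ} (hr : 0 ≤ r) (hrR : r ≤ R) (t : ℝ) :
    0 ≤ anglePoissonKernel r R t := by
  have : 0 ≤ R := hr.trans hrR
  refine div_nonneg (by nlinarith) (by positivity)

theorem anglePoissonKernel_denom_pos {r R : ℝ} (hr : 0 ≤ r) (hrR : r < R) (t : ℝ) :
    0 < (R - r) ^ 2 + 4 * R * r * Real.sin (t / 2) ^ 2 := by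
  have : 0 < R := hr.trans_lt hrR
  have : 0 < R - r := sub_pos.mpr hrR
  positivity

theorem continuous_anglePoissonKernel {r R : ℝ} (hr : 0 ≤ r) (hrR : r < R) :
    Continuous (anglePoissonKernel r R) :=
  Continuous.div (by fun_prop) (by fun_prop) fun t => (anglePoissonKernel_denom_pos hr hrR t).ne'

theorem anglePoissonKernel_neg (r R t : ℝ) :
    anglePoissonKernel r R (-t) = anglePoissonKernel r R t := by
  simp [anglePoissonKernel, neg_div]

theorem anglePoissonKernel_periodic (r R : ℝ) :
    Function.Periodic (anglePoissonKernel r R) (2 * Real.pi) := by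
  intro t
  have : (t + 2 * Real.pi) / 2 = t / 2 + Real.pi := by ring
  simp [anglePoissonKernel, this, Real.sin_add_pi]

theorem le_anglePoissonKernel {r R s t : ℝ} (hr : 0 ≤ r) (hrR : r < R) (ht : |t| ≤ s) :
    (R ^ 2 - r ^ 2) / ((R - r) ^ 2 + R * r * s ^ 2) ≤ anglePoissonKernel r R t := by
  have hR : 0 < R := hr.trans_lt hrR
  refine div_le_div_of_nonneg_left (by nlinarith) (anglePoissonKernel_denom_pos hr hrR t) ?_
  have h1 : Real.sin (t / 2) ^ 2 ≤ (s / 2) ^ 2 := by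
    refine sq_le_sq' ?_ ?_ <;>
    · have := abs_le.mp (Real.abs_sin_le_abs (x := t / 2))
      rw [abs_div, abs_two] at this
      linarith
  nlinarith [mul_le_mul_of_nonneg_left h1 (mul_nonneg hR.le hr)]

theorem anglePoissonKernel_le {r R t : ℝ} (hr : 0 < r) (hrR : r < R) (ht0 : t ≠ 0)
    (ht : |t| ≤ Real.pi) :
    anglePoissonKernel r R t ≤ (R ^ 2 - r ^ 2) * Real.pi ^ 2 / (4 * R * r) * (t ^ 2)⁻¹ := by
  have hR : 0 < R := hr.trans hrR
  have h1 : 2 / Real.pi * |t / 2| ≤ |Real.sin (t / 2)| :=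
    Real.mul_abs_le_abs_sin (by rw [abs_div, abs_two]; linarith)
  have h2 : (t / Real.pi) ^ 2 ≤ Real.sin (t / 2) ^ 2 := by
    rw [← sq_abs (Real.sin _), ← sq_abs (t / Real.pi)]
    refine pow_le_pow_left₀ (abs_nonneg _) (le_trans (le_of_eq ?_) h1) 2
    rw [abs_div, abs_div, abs_two, abs_of_pos Real.pi_pos]
    field_simp
  have h3 : (R ^ 2 - r ^ 2) * Real.pi ^ 2 / (4 * R * r) * (t ^ 2)⁻¹ =
      (R ^ 2 - r ^ 2) / (4 * R * r * (t / Real.pi) ^ 2) := by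
    field_simp
  rw [h3]
  refine div_le_div_of_nonneg_left (by nlinarith) (by positivity) ?_
  nlinarith [mul_le_mul_of_nonneg_left h2 (by positivity : 0 ≤ 4 * R * r), sq_nonneg (R - r)]

theorem intervalIntegrable_indicator_mul {S : Set ℝ} (hS : MeasurableSet S) {g : ℝ → ℝ}
    (hg : Continuous g) (a b : ℝ) :
    IntervalIntegrable (fun θ => S.indicator 1 θ * g θ) volume a b := by
  have : (fun θ => S.indicator 1 θ * g θ) = S.indicator g := by
    ext θ; by_cases h : θ ∈ S <;> simp [h]
  rw [this]
  exact ⟨(hg.intervalIntegrable a b).1.indicator hS, (hg.intervalIntegrable a b).2.indicator hS⟩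

theorem intervalIntegral_anglePoissonKernel_indicator_comm {r R : ℝ} {S : Set ℝ}
    (hper : Function.Periodic (S.indicator (1 : ℝ → ℝ)) (2 * Real.pi)) (φ a : ℝ) :
    ∫ θ in 0..2 * Real.pi, S.indicator 1 θ * anglePoissonKernel r R (θ - φ) =
      ∫ θ in a..a + 2 * Real.pi, S.indicator 1 θ * anglePoissonKernel r R (θ - φ) := by
  have hp : Function.Periodic
      (fun θ => S.indicator (1 : ℝ → ℝ) θ * anglePoissonKernel r R (θ - φ)) (2 * Real.pi) := by
    intro θ
    have : θ + 2 * Real.pi - φ = θ - φ + 2 * Real.pi := by ring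
    simp only [hper θ, this, anglePoissonKernel_periodic r R (θ - φ)]
  have := hp.intervalIntegral_add_eq 0 a
  rwa [zero_add] at this

/-- Lower bound for the Poisson extension of a set containing an interval of radius `s`. -/
theorem le_integral_indicator_anglePoissonKernel {r R s e φ : ℝ} {S : Set ℝ} (hr : 0 ≤ r)
    (hrR : r < R) (hS : MeasurableSet S)
    (hper : Function.Periodic (S.indicator (1 : ℝ → ℝ)) (2 * Real.pi)) (hs : 0 < s)
    (hsπ : s ≤ Real.pi) (hφ : |φ - e| < s) (hsub : Set.Ioo (e - s) (e + s) ⊆ S) :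
    2 * s * ((R ^ 2 - r ^ 2) / ((R - r) ^ 2 + R * r * (2 * s) ^ 2)) ≤
      ∫ θ in 0..2 * Real.pi, S.indicator 1 θ * anglePoissonKernel r R (θ - φ) := by
  have hcont : Continuous fun θ => anglePoissonKernel r R (θ - φ) :=
    (continuous_anglePoissonKernel hr hrR).comp (by fun_prop)
  rw [intervalIntegral_anglePoissonKernel_indicator_comm hper φ (e - s)]
  calc 2 * s * ((R ^ 2 - r ^ 2) / ((R - r) ^ 2 + R * r * (2 * s) ^ 2))
      = ∫ _ in (e - s)..(e + s), (R ^ 2 - r ^ 2) / ((R - r) ^ 2 + R * r * (2 * s) ^ 2) := by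
        rw [intervalIntegral.integral_const, smul_eq_mul]; ring
    _ ≤ ∫ θ in (e - s)..(e + s), S.indicator 1 θ * anglePoissonKernel r R (θ - φ) := by
        refine intervalIntegral.integral_mono_on_of_le_Ioo (by linarith) (by simp)
          (intervalIntegrable_indicator_mul hS hcont _ _) fun θ hθ => ?_
        rw [Set.indicator_of_mem (hsub hθ), Pi.one_apply, one_mul]
        refine le_anglePoissonKernel hr hrR ?_
        rw [abs_lt] at hφ
        rw [abs_le]
        constructor <;> linarith [hθ.1, hθ.2, hφ.1, hφ.2]
    _ ≤ ∫ θ in (e - s)..(e - s + 2 * Real.pi),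
          S.indicator 1 θ * anglePoissonKernel r R (θ - φ) := by
        refine intervalIntegral.integral_mono_interval le_rfl (by linarith) (by linarith) ?_
          (intervalIntegrable_indicator_mul hS hcont _ _)
        refine Filter.Eventually.of_forall fun θ => mul_nonneg ?_
          (anglePoissonKernel_nonneg hr hrR.le _)
        exact Set.indicator_nonneg (fun _ _ => zero_le_one) _

theorem integral_anglePoissonKernel_tail_le {r R s : ℝ} (hr : 0 < r) (hrR : r < R) (hs : 0 < s)
    (hsπ : s ≤ Real.pi) :
    ∫ t in s..Real.pi, anglePoissonKernel r R t ≤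
      (R ^ 2 - r ^ 2) * Real.pi ^ 2 / (4 * R * r) / s := by
  have hR : 0 < R := hr.trans hrR
  have hD : 0 ≤ (R ^ 2 - r ^ 2) * Real.pi ^ 2 / (4 * R * r) :=
    div_nonneg (mul_nonneg (by nlinarith) (by positivity)) (by positivity)
  have h0 : (0 : ℝ) ∉ Set.uIcc s Real.pi := by
    rw [Set.uIcc_of_le hsπ]; exact fun h => absurd h.1 (not_le.mpr hs)
  calc ∫ t in s..Real.pi, anglePoissonKernel r R t
      ≤ ∫ t in s..Real.pi, (R ^ 2 - r ^ 2) * Real.pi ^ 2 / (4 * R * r) * t ^ (-2 : ℤ) := by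
        refine intervalIntegral.integral_mono_on hsπ
          ((continuous_anglePoissonKernel hr.le hrR).intervalIntegrable _ _)
          ((intervalIntegral.intervalIntegrable_zpow (Or.inr h0)).const_mul _) fun t ht => ?_
        have htpos : 0 < t := hs.trans_le ht.1
        have := anglePoissonKernel_le hr hrR htpos.ne' (by rw [abs_of_pos htpos]; exact ht.2)
        simpa [zpow_neg] using this
    _ = (R ^ 2 - r ^ 2) * Real.pi ^ 2 / (4 * R * r) * (s⁻¹ - Real.pi⁻¹) := by
        rw [intervalIntegral.integral_const_mul, integral_zpow (Or.inr ⟨by norm_num, h0⟩)]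
        congr 1
        norm_num
        ring
    _ ≤ _ := by
        rw [div_eq_mul_inv _ s]
        refine mul_le_mul_of_nonneg_left ?_ hD
        have := inv_pos.mpr Real.pi_pos
        linarith

/-- The Poisson extension of a set containing the interval of radius `s` around `φ` is close to
one over `φ`. -/
theorem two_pi_sub_le_integral_indicator_anglePoissonKernel {r R s φ : ℝ} {S : Set ℝ} (hr : 0 < r)
    (hrR : r < R) (hS : MeasurableSet S)
    (hper : Function.Periodic (S.indicator (1 : ℝ → ℝ)) (2 * Real.pi)) (hs : 0 < s)
    (hsπ : s ≤ Real.pi) (hsub : Set.Ioo (φ - s) (φ + s) ⊆ S) :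
    2 * Real.pi - 2 * ((R ^ 2 - r ^ 2) * Real.pi ^ 2 / (4 * R * r) / s) ≤
      ∫ θ in 0..2 * Real.pi, S.indicator 1 θ * anglePoissonKernel r R (θ - φ) := by
  have hk := continuous_anglePoissonKernel hr.le hrR
  have hcont : Continuous fun θ => anglePoissonKernel r R (θ - φ) := hk.comp (by fun_prop)
  have htail := integral_anglePoissonKernel_tail_le hr hrR hs hsπ
  have hInt : ∀ a b, IntervalIntegrable (anglePoissonKernel r R) volume a b :=
    fun a b => hk.intervalIntegrable a b
  have htotal : ∫ t in (-Real.pi)..Real.pi, anglePoissonKernel r R t = 2 * Real.pi := by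
    have h1 := (anglePoissonKernel_periodic r R).intervalIntegral_add_eq (-Real.pi) (-2 * Real.pi)
    have h2 := integral_anglePoissonKernel hr.le hrR 0
    have h3 : -Real.pi + 2 * Real.pi = Real.pi := by ring
    have h4 : -2 * Real.pi + 2 * Real.pi = 0 := by ring
    rw [h3, h4] at h1
    rw [h1, ← h2]
    simp only [zero_sub]
    rw [intervalIntegral.integral_comp_neg]
    simp
  have hneg : ∫ t in (-Real.pi)..(-s), anglePoissonKernel r R t =
      ∫ t in s..Real.pi, anglePoissonKernel r R t := by
    rw [← intervalIntegral.integral_comp_neg]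
    simp only [anglePoissonKernel_neg]
  have hsplit1 := intervalIntegral.integral_add_adjacent_intervals (hInt (-Real.pi) (-s))
    (hInt (-s) s)
  have hsplit2 := intervalIntegral.integral_add_adjacent_intervals (hInt (-Real.pi) s)
    (hInt s Real.pi)
  have hmid : 2 * Real.pi - 2 * ((R ^ 2 - r ^ 2) * Real.pi ^ 2 / (4 * R * r) / s) ≤
      ∫ t in (-s)..s, anglePoissonKernel r R t := by linarith
  refine hmid.trans ?_
  rw [intervalIntegral_anglePoissonKernel_indicator_comm hper φ (φ - Real.pi)]
  calc ∫ t in (-s)..s, anglePoissonKernel r R t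
      = ∫ θ in (φ - s)..(φ + s), anglePoissonKernel r R (θ - φ) := by
        rw [intervalIntegral.integral_comp_sub_right (anglePoissonKernel r R)]
        congr 1 <;> ring
    _ ≤ ∫ θ in (φ - s)..(φ + s), S.indicator 1 θ * anglePoissonKernel r R (θ - φ) := by
        refine intervalIntegral.integral_mono_on_of_le_Ioo (by linarith)
          (hcont.intervalIntegrable _ _)
          (intervalIntegrable_indicator_mul hS hcont _ _) fun θ hθ => ?_
        rw [Set.indicator_of_mem (hsub hθ), Pi.one_apply, one_mul]
    _ ≤ _ := by
        refine intervalIntegral.integral_mono_interval (by linarith) (by linarith) (by linarith) ?_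
          (intervalIntegrable_indicator_mul hS hcont _ _)
        refine Filter.Eventually.of_forall fun θ => mul_nonneg ?_
          (anglePoissonKernel_nonneg hr.le hrR.le _)
        exact Set.indicator_nonneg (fun _ _ => zero_le_one) _

/-- Transfer of the mass of a nonnegative superharmonic function `K - log ‖f‖` over a set of
directions from one circle to a smaller one. -/
theorem mul_integral_indicator_le {f : ℂ → ℂ} {r R K b : ℝ} {S T : Set ℝ} (hr : 0 ≤ r)
    (hrR : r < R) (hf : AnalyticOnNhd ℂ f (Metric.closedBall 0 R))
    (hfr : ∀ z ∈ Metric.sphere 0 r, f z ≠ 0) (hfR : ∀ z ∈ Metric.sphere 0 R, f z ≠ 0)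
    (hK : ∀ z ∈ Metric.sphere 0 R, Real.log ‖f z‖ ≤ K)
    (hS : MeasurableSet S) (hT : MeasurableSet T)
    (hb : ∀ φ ∈ T, 2 * Real.pi * b ≤
      ∫ θ in 0..2 * Real.pi, S.indicator 1 θ * anglePoissonKernel r R (θ - φ)) :
    b * ∫ φ in 0..2 * Real.pi, T.indicator 1 φ * (K - Real.log ‖f (circleMap 0 R φ)‖) ≤
      ∫ θ in 0..2 * Real.pi, S.indicator 1 θ * (K - Real.log ‖f (circleMap 0 r θ)‖) := by
  have hR : 0 < R := hr.trans_lt hrR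
  have hpi := Real.two_pi_pos
  have hmemr : ∀ θ, circleMap 0 r θ ∈ Metric.sphere (0 : ℂ) r := fun θ => by
    simp [abs_of_nonneg hr]
  have hmemR : ∀ θ, circleMap 0 R θ ∈ Metric.sphere (0 : ℂ) R := fun θ => by
    simp [abs_of_pos hR]
  have hcont : ∀ s, s ≤ R → (∀ θ, circleMap 0 s θ ∈ Metric.sphere (0 : ℂ) s) →
      (∀ z ∈ Metric.sphere 0 s, f z ≠ 0) →
      Continuous fun θ => K - Real.log ‖f (circleMap 0 s θ)‖ := by
    intro s hs hmem hne
    have h1 : Continuous fun θ => f (circleMap 0 s θ) :=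
      hf.continuousOn.comp_continuous (continuous_circleMap 0 s) fun θ =>
        Metric.closedBall_subset_closedBall hs (Metric.sphere_subset_closedBall (hmem θ))
    exact continuous_const.sub (h1.norm.log fun θ => norm_ne_zero_iff.mpr (hne _ (hmem θ)))
  have hcr := hcont r hrR.le hmemr hfr
  have hcR := hcont R le_rfl hmemR hfR
  have hkc := continuous_anglePoissonKernel hr hrR
  have hVnn : ∀ φ, 0 ≤ K - Real.log ‖f (circleMap 0 R φ)‖ := fun φ =>
    sub_nonneg.mpr (hK _ (hmemR φ))
  have hpw : ∀ θ, ∫ φ in 0..2 * Real.pi, anglePoissonKernel r R (θ - φ) *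
      (K - Real.log ‖f (circleMap 0 R φ)‖) ≤
      2 * Real.pi * (K - Real.log ‖f (circleMap 0 r θ)‖) := by
    intro θ
    have h1 := log_norm_le_integral_anglePoissonKernel hr hrR hf (hfr _ (hmemr θ)) hfR
    have h2 := integral_anglePoissonKernel hr hrR θ
    have hkc' : Continuous fun φ => anglePoissonKernel r R (θ - φ) := hkc.comp (by fun_prop)
    have hlc : Continuous fun φ => Real.log ‖f (circleMap 0 R φ)‖ := by
      refine ((continuous_const (y := K)).sub hcR).congr fun φ => ?_
      simp
    have hi1 : IntervalIntegrable (fun φ => anglePoissonKernel r R (θ - φ) * K) volume 0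
        (2 * Real.pi) := (hkc'.mul continuous_const).intervalIntegrable _ _
    have hi2 : IntervalIntegrable (fun φ => anglePoissonKernel r R (θ - φ) *
        Real.log ‖f (circleMap 0 R φ)‖) volume 0 (2 * Real.pi) :=
      (hkc'.mul hlc).intervalIntegrable _ _
    simp only [mul_sub]
    rw [intervalIntegral.integral_sub hi1 hi2, intervalIntegral.integral_mul_const, h2]
    linarith
  have hprod : IntegrableOn (Function.uncurry fun θ φ => S.indicator 1 θ *
      (anglePoissonKernel r R (θ - φ) * (K - Real.log ‖f (circleMap 0 R φ)‖)))
      (Set.uIoc 0 (2 * Real.pi) ×ˢ Set.uIoc 0 (2 * Real.pi)) (volume.prod volume) := by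
    have hc2 : Continuous fun p : ℝ × ℝ => anglePoissonKernel r R (p.1 - p.2) *
        (K - Real.log ‖f (circleMap 0 R p.2)‖) :=
      (hkc.comp (by fun_prop)).mul (hcR.comp continuous_snd)
    have hi : IntegrableOn (fun p : ℝ × ℝ => anglePoissonKernel r R (p.1 - p.2) *
        (K - Real.log ‖f (circleMap 0 R p.2)‖))
        (Set.uIoc 0 (2 * Real.pi) ×ˢ Set.uIoc 0 (2 * Real.pi)) :=
      (hc2.continuousOn.integrableOn_compact (isCompact_uIcc.prod isCompact_uIcc)).mono_set
        (Set.prod_mono Set.uIoc_subset_uIcc Set.uIoc_subset_uIcc)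
    refine (Integrable.indicator hi (measurable_fst hS)).congr (Eventually.of_forall fun p => ?_)
    by_cases hp : p.1 ∈ S <;> simp [Function.uncurry, hp, Set.indicator]
  have hswap := intervalIntegral_intervalIntegral_swap hprod
  rw [IntegrableOn, ← Measure.prod_restrict] at hprod
  have hlow : ∫ φ in 0..2 * Real.pi, 2 * Real.pi * b *
      (T.indicator 1 φ * (K - Real.log ‖f (circleMap 0 R φ)‖)) ≤
      ∫ φ in 0..2 * Real.pi, ∫ θ in 0..2 * Real.pi, S.indicator 1 θ *
      (anglePoissonKernel r R (θ - φ) * (K - Real.log ‖f (circleMap 0 R φ)‖)) := by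
    refine intervalIntegral.integral_mono_on hpi.le
      ((intervalIntegrable_indicator_mul hT hcR _ _).const_mul _) ?_ fun φ _ => ?_
    · rw [intervalIntegrable_iff]
      refine hprod.integral_prod_right.congr (Eventually.of_forall fun φ => ?_)
      simp only [Function.uncurry]
      rw [intervalIntegral.integral_of_le hpi.le, Set.uIoc_of_le hpi.le]
    · have hJ : ∫ θ in 0..2 * Real.pi, S.indicator 1 θ *
          (anglePoissonKernel r R (θ - φ) * (K - Real.log ‖f (circleMap 0 R φ)‖)) =
          (∫ θ in 0..2 * Real.pi, S.indicator 1 θ * anglePoissonKernel r R (θ - φ)) *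
            (K - Real.log ‖f (circleMap 0 R φ)‖) := by
        rw [← intervalIntegral.integral_mul_const]
        simp only [mul_assoc]
      rw [hJ]
      by_cases hφ : φ ∈ T
      · rw [Set.indicator_of_mem hφ, Pi.one_apply, one_mul]
        exact mul_le_mul_of_nonneg_right (hb φ hφ) (hVnn φ)
      · rw [Set.indicator_of_notMem hφ, zero_mul, mul_zero]
        refine mul_nonneg (intervalIntegral.integral_nonneg hpi.le fun θ _ => mul_nonneg ?_
          (anglePoissonKernel_nonneg hr hrR.le _)) (hVnn φ)
        exact Set.indicator_nonneg (fun _ _ => zero_le_one) _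
  have hup : ∫ θ in 0..2 * Real.pi, ∫ φ in 0..2 * Real.pi, S.indicator 1 θ *
      (anglePoissonKernel r R (θ - φ) * (K - Real.log ‖f (circleMap 0 R φ)‖)) ≤
      ∫ θ in 0..2 * Real.pi, 2 * Real.pi *
        (S.indicator 1 θ * (K - Real.log ‖f (circleMap 0 r θ)‖)) := by
    refine intervalIntegral.integral_mono_on hpi.le ?_
      ((intervalIntegrable_indicator_mul hS hcr _ _).const_mul _) fun θ _ => ?_
    · rw [intervalIntegrable_iff]
      refine hprod.integral_prod_left.congr (Eventually.of_forall fun θ => ?_)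
      simp only [Function.uncurry]
      rw [intervalIntegral.integral_of_le hpi.le, Set.uIoc_of_le hpi.le]
    · rw [intervalIntegral.integral_const_mul]
      by_cases hθ : θ ∈ S
      · simpa [Set.indicator_of_mem hθ] using hpw θ
      · simp [Set.indicator_of_notMem hθ]
  rw [hswap] at hup
  have h := hlow.trans hup
  rw [intervalIntegral.integral_const_mul, intervalIntegral.integral_const_mul, mul_assoc] at h
  exact le_of_mul_le_mul_left h hpi

theorem norm_le_mul_exp_of_upperHalfDisc {g : ℂ → ℂ} {a b : ℝ}
    (hg : DiffContOnCl ℂ g (Metric.ball 0 1)) (ha : 0 < a) (hab : a ≤ b)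
    (hga : ∀ z ∈ Metric.closedBall (0 : ℂ) 1, z.im = 0 → ‖g z‖ ≤ a)
    (hgb : ∀ z ∈ Metric.closedBall (0 : ℂ) 1, ‖g z‖ ≤ b) {z : ℂ} (hz : ‖z‖ < 1) (hz0 : 0 ≤ z.im) :
    ‖g z‖ ≤ a * Real.exp ((Real.log b - Real.log a) * (‖z‖ ^ 2 + 2 * ‖z‖)) := by
  set L := Real.log b - Real.log a with hL
  have hL0 : 0 ≤ L := sub_nonneg.mpr (Real.log_le_log ha hab)
  have hexp : ∀ w : ℂ, ‖Complex.exp (-L * (w ^ 2 - 2 * Complex.I * w))‖ =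
      Real.exp (-L * (w.re ^ 2 - w.im ^ 2 + 2 * w.im)) := by
    intro w
    rw [Complex.norm_exp]
    congr 1
    simp [pow_two]
  set U : Set ℂ := Metric.ball 0 1 ∩ {w | 0 < w.im} with hU
  have hUo : IsOpen U := Metric.isOpen_ball.inter (isOpen_lt continuous_const Complex.continuous_im)
  have hUc : closure U ⊆ Metric.closedBall 0 1 ∩ {w | 0 ≤ w.im} :=
    closure_minimal
      (Set.inter_subset_inter Metric.ball_subset_closedBall fun w (hw : 0 < w.im) => hw.le)
      (Metric.isClosed_closedBall.inter (isClosed_le continuous_const Complex.continuous_im))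
  have hd : DiffContOnCl ℂ (fun w => Complex.exp (-L * (w ^ 2 - 2 * Complex.I * w)) • g w) U :=
    (Differentiable.diffContOnCl (by fun_prop)).smul (hg.mono Set.inter_subset_left)
  have hfr : ∀ w ∈ frontier U,
      ‖Complex.exp (-L * (w ^ 2 - 2 * Complex.I * w)) • g w‖ ≤ a := by
    intro w hw
    rw [hUo.frontier_eq] at hw
    obtain ⟨hw1, hw2⟩ := hUc hw.1
    rw [norm_smul, hexp]
    have hsq : w.re ^ 2 + w.im ^ 2 = ‖w‖ ^ 2 := by
      rw [← Complex.normSq_eq_norm_sq, Complex.normSq_apply]; ring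
    by_cases him : w.im = 0
    · refine (mul_le_mul ?_ (hga w hw1 him) (norm_nonneg _) zero_le_one).trans_eq (one_mul a)
      rw [Real.exp_le_one_iff, him]
      nlinarith [mul_nonneg hL0 (sq_nonneg w.re)]
    · have hw0 : 0 < w.im := lt_of_le_of_ne hw2 (Ne.symm him)
      have hn : ‖w‖ = 1 := by
        refine le_antisymm (mem_closedBall_zero_iff.mp hw1) (not_lt.mp fun h => hw.2 ⟨?_, hw0⟩)
        exact mem_ball_zero_iff.mpr h
      have hy : w.im ≤ 1 := (Complex.im_le_norm w).trans hn.le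
      calc Real.exp (-L * (w.re ^ 2 - w.im ^ 2 + 2 * w.im)) * ‖g w‖
          ≤ Real.exp (-L) * b := by
            refine mul_le_mul (Real.exp_le_exp.mpr ?_) (hgb w hw1) (norm_nonneg _)
              (Real.exp_pos _).le
            rw [hn] at hsq
            nlinarith [mul_nonneg hL0 (mul_nonneg hw0.le (sub_nonneg.mpr hy))]
        _ = a := by
            rw [hL, neg_sub, Real.exp_sub, Real.exp_log ha, Real.exp_log (ha.trans_le hab)]
            field_simp [(ha.trans_le hab).ne']
  have hle : ‖z‖ ^ 2 + 2 * ‖z‖ ≥ z.re ^ 2 - z.im ^ 2 + 2 * z.im := by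
    have hsq : z.re ^ 2 + z.im ^ 2 = ‖z‖ ^ 2 := by
      rw [← Complex.normSq_eq_norm_sq, Complex.normSq_apply]; ring
    nlinarith [Complex.im_le_norm z, sq_nonneg z.im]
  rcases hz0.eq_or_lt with h0 | h0
  · refine (hga z (by simpa using hz.le) h0.symm).trans (le_mul_of_one_le_right ha.le ?_)
    exact Real.one_le_exp (by positivity)
  · have hmax := Complex.norm_le_of_forall_mem_frontier_norm_le
      (Metric.isBounded_ball.subset Set.inter_subset_left) hd hfr
      (subset_closure (⟨by simpa using hz, h0⟩ : z ∈ U))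
    rw [norm_smul, hexp, neg_mul, Real.exp_neg, inv_mul_le_iff₀ (Real.exp_pos _), mul_comm] at hmax
    refine hmax.trans (mul_le_mul_of_nonneg_left (Real.exp_le_exp.mpr ?_) ha.le)
    exact mul_le_mul_of_nonneg_left hle hL0

/-- A two-constants estimate: a function bounded by `b` on the unit disc and by `a` on the real
diameter is almost bounded by `a` close to the centre. -/
theorem norm_le_mul_exp_of_diameter {g : ℂ → ℂ} {a b : ℝ}
    (hg : DiffContOnCl ℂ g (Metric.ball 0 1)) (ha : 0 < a) (hab : a ≤ b)
    (hga : ∀ z ∈ Metric.closedBall (0 : ℂ) 1, z.im = 0 → ‖g z‖ ≤ a)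
    (hgb : ∀ z ∈ Metric.closedBall (0 : ℂ) 1, ‖g z‖ ≤ b) {z : ℂ} (hz : ‖z‖ < 1) :
    ‖g z‖ ≤ a * Real.exp ((Real.log b - Real.log a) * (‖z‖ ^ 2 + 2 * ‖z‖)) := by
  rcases le_total 0 z.im with h0 | h0
  · exact norm_le_mul_exp_of_upperHalfDisc hg ha hab hga hgb hz h0
  · have hn : DiffContOnCl ℂ (fun w => g (-w)) (Metric.ball 0 1) :=
      hg.comp (differentiable_neg.diffContOnCl) fun w hw => by simpa using hw
    have := norm_le_mul_exp_of_upperHalfDisc hn ha hab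
      (fun w hw hw0 => hga (-w) (by simpa using hw) (by simpa using hw0))
      (fun w hw => hgb (-w) (by simpa using hw)) (z := -z) (by simpa using hz) (by simpa using h0)
    simpa using this

/-- The directions along which `f` decays like `(1 - r) ^ c` up to height `δ₀`. -/
def decayDirections (f : ℂ → ℂ) (c δ₀ : ℝ) : Set ℝ :=
  {θ | ∀ δ ∈ Set.Ioc 0 δ₀, ‖f (circleMap 0 (1 - δ) θ)‖ ≤ δ ^ c}

theorem norm_circleMap_sub_circleMap_le {r : ℝ} (hr : 0 ≤ r) (θ φ : ℝ) :
    ‖circleMap 0 r θ - circleMap 0 r φ‖ ≤ r * |θ - φ| := by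
  have h1 : circleMap 0 r θ - circleMap 0 r φ =
      circleMap 0 r φ * (Complex.exp (Complex.I * ((θ - φ : ℝ) : ℂ)) - 1) := by
    simp only [circleMap_zero, mul_sub, mul_one, mul_assoc, ← Complex.exp_add]
    congr 3
    push_cast
    ring
  rw [h1, norm_mul, norm_circleMap_zero, abs_of_nonneg hr]
  exact mul_le_mul_of_nonneg_left (Real.norm_exp_I_mul_ofReal_sub_one_le) hr

/-- Decay in a direction propagates to the directions at angle less than `ε * δ`. -/
theorem exists_norm_le_rpow_half_of_mem_decayDirections {f : ℂ → ℂ} {C k c δ₀ ε : ℝ}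
    (hf : DifferentiableOn ℂ f (Metric.ball 0 1)) (hC : 1 ≤ C) (hk : 0 < k)
    (hfC : ∀ z ∈ Metric.ball (0 : ℂ) 1, ‖f z‖ ≤ C / (1 - ‖z‖) ^ k) (hc : 0 < c) (hδ₀ : 0 < δ₀)
    (hε : 0 < ε) (hε4 : ε ≤ 1 / 4) (hεc : 20 * ε * (k + c) ≤ c) :
    ∃ δ₁ > 0, ∀ δ ∈ Set.Ioc 0 δ₁, ∀ θ₀ ∈ decayDirections f c δ₀, ∀ θ, |θ - θ₀| < ε * δ →
      ‖f (circleMap 0 (1 - δ) θ)‖ ≤ δ ^ (c / 2) := by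
  set Q := 4 / c * (c * Real.log (3 / 2) + 5 * ε * (Real.log C + k * Real.log 2)) with hQ
  refine ⟨min (min (1 / 2) (δ₀ / 2)) (Real.exp (-Q)), by positivity, ?_⟩
  rintro δ ⟨hδ, hδ1⟩ θ₀ hθ₀ θ hθ
  obtain ⟨⟨hδ2, hδ3⟩, hδQ⟩ := (le_min_iff.trans (and_congr_left' le_min_iff)).mp hδ1
  have hlogδ : Real.log δ ≤ -Q := by
    rw [← Real.log_exp (-Q)]; exact Real.log_le_log hδ hδQ
  set u := circleMap 0 1 θ₀ with hu
  have hun : ‖u‖ = 1 := by simp [hu]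
  have hu0 : u ≠ 0 := norm_ne_zero_iff.mp (by simp [hun])
  have hcu : ∀ r : ℝ, circleMap 0 r θ₀ = r * u := fun r => by simp [hu, circleMap]
  set p : ℂ → ℂ := fun ζ => ((1 - δ : ℝ) : ℂ) * u + u * ((δ / 2 : ℝ) : ℂ) * ζ with hp
  have hpn : ∀ ζ ∈ Metric.closedBall (0 : ℂ) 1, ‖p ζ‖ ≤ 1 - δ / 2 := by
    intro ζ hζ
    rw [mem_closedBall_zero_iff] at hζ
    refine (norm_add_le _ _).trans ?_
    rw [norm_mul, norm_mul, norm_mul, hun, Complex.norm_of_nonneg (by linarith),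
      Complex.norm_of_nonneg (by linarith)]
    nlinarith
  have hpball : ∀ ζ ∈ Metric.closedBall (0 : ℂ) 1, p ζ ∈ Metric.ball (0 : ℂ) 1 := fun ζ hζ =>
    mem_ball_zero_iff.mpr ((hpn ζ hζ).trans_lt (by linarith))
  have hg : DiffContOnCl ℂ (fun ζ => f (p ζ)) (Metric.ball 0 1) := by
    refine DifferentiableOn.diffContOnCl ?_
    rw [closure_ball _ one_ne_zero]
    exact hf.comp (by fun_prop) hpball
  have ha : 0 < (3 * δ / 2) ^ c := by positivity
  have hb : 1 ≤ C / (δ / 2) ^ k := by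
    rw [one_le_div (by positivity)]
    exact (Real.rpow_le_one (by positivity) (by linarith) hk.le).trans hC
  have ha1 : (3 * δ / 2) ^ c ≤ 1 := Real.rpow_le_one (by positivity) (by linarith) hc.le
  have hga : ∀ ζ ∈ Metric.closedBall (0 : ℂ) 1, ζ.im = 0 → ‖f (p ζ)‖ ≤ (3 * δ / 2) ^ c := by
    intro ζ hζ him
    have hre := abs_le.mp ((Complex.abs_re_le_norm ζ).trans (mem_closedBall_zero_iff.mp hζ))
    have hpt : p ζ = circleMap 0 (1 - δ * (1 - ζ.re / 2)) θ₀ := by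
      have : ζ = (ζ.re : ℂ) := Complex.ext rfl (by simp [him])
      rw [hcu, hp, this]
      push_cast
      simp
      ring
    rw [hpt]
    refine (hθ₀ _ ⟨by nlinarith, by nlinarith⟩).trans ?_
    exact Real.rpow_le_rpow (by nlinarith) (by nlinarith) hc.le
  have hgb : ∀ ζ ∈ Metric.closedBall (0 : ℂ) 1, ‖f (p ζ)‖ ≤ C / (δ / 2) ^ k := by
    intro ζ hζ
    refine (hfC _ (hpball ζ hζ)).trans ?_
    refine div_le_div_of_nonneg_left (by linarith) (by positivity) ?_
    exact Real.rpow_le_rpow (by positivity) (by linarith [hpn ζ hζ]) hk.le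
  set ζ : ℂ := (circleMap 0 (1 - δ) θ - circleMap 0 (1 - δ) θ₀) / (u * ((δ / 2 : ℝ) : ℂ)) with hζ
  have hδC : ((δ / 2 : ℝ) : ℂ) ≠ 0 := by exact_mod_cast (half_pos hδ).ne'
  have hpζ : p ζ = circleMap 0 (1 - δ) θ := by
    rw [hp, hζ]
    dsimp only
    rw [mul_div_cancel₀ _ (mul_ne_zero hu0 hδC), hcu]
    ring
  have hζn : ‖ζ‖ ≤ 2 * ε := by
    rw [hζ, norm_div, norm_mul, hun, one_mul, Complex.norm_of_nonneg (by positivity),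
      div_le_iff₀ (by positivity)]
    refine (norm_circleMap_sub_circleMap_le (by linarith) θ θ₀).trans ?_
    nlinarith [abs_nonneg (θ - θ₀)]
  have hmain := norm_le_mul_exp_of_diameter hg ha (ha1.trans hb) hga hgb (z := ζ) (by linarith)
  rw [hpζ] at hmain
  refine hmain.trans ?_
  have hlogb : Real.log (C / (δ / 2) ^ k) = Real.log C + k * Real.log 2 - k * Real.log δ := by
    rw [Real.log_div (by positivity) (by positivity), Real.log_rpow (by positivity),
      Real.log_div hδ.ne' two_ne_zero]
    ring
  have hloga : Real.log ((3 * δ / 2) ^ c) = c * Real.log (3 / 2) + c * Real.log δ := by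
    rw [Real.log_rpow (by positivity), show 3 * δ / 2 = 3 / 2 * δ by ring,
      Real.log_mul (by norm_num) hδ.ne']
    ring
  rw [← Real.exp_log ha, ← Real.exp_add, Real.rpow_def_of_pos hδ, Real.exp_le_exp,
    Real.exp_log ha]
  have hLnn : 0 ≤ Real.log (C / (δ / 2) ^ k) - Real.log ((3 * δ / 2) ^ c) :=
    sub_nonneg.mpr (Real.log_le_log ha (ha1.trans hb))
  have h5 : ‖ζ‖ ^ 2 + 2 * ‖ζ‖ ≤ 5 * ε := by nlinarith [norm_nonneg ζ]
  have h6 := mul_le_mul_of_nonneg_left h5 hLnn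
  have h7 : 0 ≤ Real.log (3 / 2) := Real.log_nonneg (by norm_num)
  have h8 : c / 4 * Q = c * Real.log (3 / 2) + 5 * ε * (Real.log C + k * Real.log 2) := by
    rw [hQ]; field_simp
  have h9 : 0 ≤ Q := by
    have := Real.log_nonneg hC
    have := Real.log_nonneg (one_le_two (α := ℝ))
    positivity
  rw [hloga, hlogb] at h6 ⊢
  have h10 : 0 ≤ 5 * ε * (c * Real.log (3 / 2)) := by positivity
  nlinarith [mul_le_mul_of_nonneg_right hεc (by linarith : 0 ≤ -Real.log δ)]

theorem measurableSet_thickening (s : ℝ) (E : Set ℝ) : MeasurableSet (Metric.thickening s E) :=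
  Metric.isOpen_thickening.measurableSet

theorem periodic_indicator_thickening {E : Set ℝ} {p : ℝ} (hE : ∀ θ, θ + p ∈ E ↔ θ ∈ E) (s : ℝ) :
    Function.Periodic ((Metric.thickening s E).indicator (1 : ℝ → ℝ)) p := by
  intro θ
  have h : θ + p ∈ Metric.thickening s E ↔ θ ∈ Metric.thickening s E := by
    simp only [Metric.mem_thickening_iff, Real.dist_eq]
    constructor
    · rintro ⟨e, he, h⟩
      refine ⟨e - p, (hE _).mp (by simpa using he), ?_⟩
      rwa [show θ - (e - p) = θ + p - e by ring]
    · rintro ⟨e, he, h⟩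
      refine ⟨e + p, (hE _).mpr he, ?_⟩
      rwa [add_sub_add_right_eq_sub]
  by_cases hθ : θ ∈ Metric.thickening s E
  · rw [Set.indicator_of_mem hθ, Set.indicator_of_mem (h.mpr hθ)]; rfl
  · rw [Set.indicator_of_notMem hθ, Set.indicator_of_notMem (mt h.mp hθ)]

theorem mul_integral_thickening_le_inner {f : ℂ → ℂ} {E : Set ℝ} {ε δ K : ℝ}
    (hf : DifferentiableOn ℂ f (Metric.ball 0 1)) (hE : ∀ θ, θ + 2 * Real.pi ∈ E ↔ θ ∈ E)
    (hε : 0 < ε) (hε4 : ε ≤ 1 / 4) (hδ : 0 < δ) (hδ4 : δ ≤ 1 / 4)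
    (hfr : ∀ z ∈ Metric.sphere 0 (1 - δ), f z ≠ 0)
    (hfR : ∀ z ∈ Metric.sphere 0 (1 - ε ^ 2 * δ), f z ≠ 0)
    (hK : ∀ z ∈ Metric.sphere 0 (1 - ε ^ 2 * δ), Real.log ‖f z‖ ≤ K) :
    ε / (4 * Real.pi) * ∫ φ in 0..2 * Real.pi, (Metric.thickening (ε * δ) E).indicator 1 φ *
        (K - Real.log ‖f (circleMap 0 (1 - ε ^ 2 * δ) φ)‖) ≤
      ∫ θ in 0..2 * Real.pi, (Metric.thickening (ε * δ) E).indicator 1 θ *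
        (K - Real.log ‖f (circleMap 0 (1 - δ) θ)‖) := by
  have hε2 : ε ^ 2 ≤ 1 / 16 := by nlinarith
  have hεδ : ε ^ 2 * δ ≤ 1 / 16 * δ := mul_le_mul_of_nonneg_right hε2 hδ.le
  have hεδ0 : 0 < ε ^ 2 * δ := by positivity
  have hs0 : 0 < ε * δ := by positivity
  have hs1 : ε * δ ≤ Real.pi := by nlinarith [Real.pi_gt_three]
  refine mul_integral_indicator_le (by linarith) (by linarith)
    ((hf.analyticOnNhd Metric.isOpen_ball).mono
      (Metric.closedBall_subset_ball (by linarith))) hfr hfR hK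
    (measurableSet_thickening _ _) (measurableSet_thickening _ _) fun φ hφ => ?_
  obtain ⟨e, he, hφe⟩ := Metric.mem_thickening_iff.mp hφ
  refine le_trans ?_ (le_integral_indicator_anglePoissonKernel (s := ε * δ) (e := e)
    (by linarith) (by linarith)
    (measurableSet_thickening _ _) (periodic_indicator_thickening hE _) hs0 hs1 hφe
    fun x hx => Metric.mem_thickening_iff.mpr ⟨e, he, ?_⟩)
  · have hpi := Real.pi_pos
    have h1 : 2 * Real.pi * (ε / (4 * Real.pi)) = 2 * (ε * δ) * (1 / (4 * δ)) := by
      field_simp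
    rw [h1]
    refine mul_le_mul_of_nonneg_left ?_ (by positivity)
    have hden : 0 < ((1 - ε ^ 2 * δ) - (1 - δ)) ^ 2 +
        (1 - ε ^ 2 * δ) * (1 - δ) * (2 * (ε * δ)) ^ 2 := by
      have : 0 < (1 - ε ^ 2 * δ) - (1 - δ) := by linarith
      have : 0 < 1 - ε ^ 2 * δ := by linarith
      have : 0 < 1 - δ := by linarith
      positivity
    rw [div_le_div_iff₀ (by positivity) hden]
    have h2 : ((1 - ε ^ 2 * δ) - (1 - δ)) ^ 2 ≤ δ ^ 2 := by
      refine pow_le_pow_left₀ (by linarith) (by linarith) 2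
    have h3 : (1 - ε ^ 2 * δ) * (1 - δ) * (2 * (ε * δ)) ^ 2 ≤ 1 / 4 * δ ^ 2 := by
      have : (1 - ε ^ 2 * δ) * (1 - δ) ≤ 1 := by nlinarith
      calc _ ≤ 1 * (2 * (ε * δ)) ^ 2 := mul_le_mul_of_nonneg_right this (sq_nonneg _)
        _ = 4 * ε ^ 2 * δ ^ 2 := by ring
        _ ≤ _ := mul_le_mul_of_nonneg_right (by linarith) (sq_nonneg _)
    have h4 : δ / 2 ≤ (1 - ε ^ 2 * δ) ^ 2 - (1 - δ) ^ 2 := by nlinarith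
    nlinarith
  · rw [Real.dist_eq, abs_lt]
    constructor <;> linarith [hx.1, hx.2]

theorem mul_integral_thickening_le_outer {f : ℂ → ℂ} {E : Set ℝ} {ε δ δ' K : ℝ}
    (hf : DifferentiableOn ℂ f (Metric.ball 0 1)) (hE : ∀ θ, θ + 2 * Real.pi ∈ E ↔ θ ∈ E)
    (hε : 0 < ε) (hε4 : ε ≤ 1 / 4) (hδ : 0 < δ) (hδ4 : δ ≤ 1 / 4) (hδ' : 0 < δ')
    (hδδ' : δ' < ε ^ 2 * δ)
    (hfr : ∀ z ∈ Metric.sphere 0 (1 - ε ^ 2 * δ), f z ≠ 0)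
    (hfR : ∀ z ∈ Metric.sphere 0 (1 - δ'), f z ≠ 0)
    (hK : ∀ z ∈ Metric.sphere 0 (1 - δ'), Real.log ‖f z‖ ≤ K) :
    (1 - 4 * Real.pi * ε) * ∫ φ in 0..2 * Real.pi,
        (Metric.thickening (ε * δ') E).indicator 1 φ *
        (K - Real.log ‖f (circleMap 0 (1 - δ') φ)‖) ≤
      ∫ θ in 0..2 * Real.pi, (Metric.thickening (ε * δ) E).indicator 1 θ *
        (K - Real.log ‖f (circleMap 0 (1 - ε ^ 2 * δ) θ)‖) := by
  have hε2 : ε ^ 2 ≤ 1 / 16 := by nlinarith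
  have hεδ : ε ^ 2 * δ ≤ 1 / 16 * δ := mul_le_mul_of_nonneg_right hε2 hδ.le
  have hεδ0 : 0 < ε ^ 2 * δ := by positivity
  have hs0 : 0 < ε * δ / 2 := by positivity
  have hs1 : ε * δ / 2 ≤ Real.pi := by nlinarith [Real.pi_gt_three]
  refine mul_integral_indicator_le (by linarith) (by linarith)
    ((hf.analyticOnNhd Metric.isOpen_ball).mono
      (Metric.closedBall_subset_ball (by linarith))) hfr hfR hK
    (measurableSet_thickening _ _) (measurableSet_thickening _ _) fun φ hφ => ?_
  obtain ⟨e, he, hφe⟩ := Metric.mem_thickening_iff.mp hφ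
  refine le_trans ?_ (two_pi_sub_le_integral_indicator_anglePoissonKernel (s := ε * δ / 2)
    (by linarith) (by linarith)
    (measurableSet_thickening _ _) (periodic_indicator_thickening hE _) hs0 hs1
    fun x hx => Metric.mem_thickening_iff.mpr ⟨e, he, ?_⟩)
  · have h1 : (1 - δ') ^ 2 - (1 - ε ^ 2 * δ) ^ 2 ≤ 2 * (ε ^ 2 * δ) := by nlinarith
    have h2 : 1 ≤ 4 * (1 - δ') * (1 - ε ^ 2 * δ) := by nlinarith
    have h3 : ((1 - δ') ^ 2 - (1 - ε ^ 2 * δ) ^ 2) * Real.pi ^ 2 /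
        (4 * (1 - δ') * (1 - ε ^ 2 * δ)) / (ε * δ / 2) ≤ 4 * Real.pi ^ 2 * ε := by
      rw [div_le_iff₀ hs0, div_le_iff₀ (by linarith)]
      calc _ ≤ 2 * (ε ^ 2 * δ) * Real.pi ^ 2 := mul_le_mul_of_nonneg_right h1 (sq_nonneg _)
        _ = 4 * Real.pi ^ 2 * ε * (ε * δ / 2) * 1 := by ring
        _ ≤ _ := mul_le_mul_of_nonneg_left h2 (by positivity)
    linarith
  · rw [Real.dist_eq, abs_lt] at hφe ⊢
    have : ε * δ' ≤ ε * (δ / 2) := mul_le_mul_of_nonneg_left (by linarith) hε.le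
    constructor <;> linarith [hx.1, hx.2]

/-- The integral over the `ε * δ`-neighbourhood of `E` of a nonnegative superharmonic majorant of
`-log ‖f‖` at height `δ`. -/
def decayMass (f : ℂ → ℂ) (E : Set ℝ) (k A ε δ : ℝ) : ℝ :=
  ∫ θ in 0..2 * Real.pi, (Metric.thickening (ε * δ) E).indicator 1 θ *
    (A - k * Real.log δ - Real.log ‖f (circleMap 0 (1 - δ) θ)‖)

theorem continuous_log_norm_circleMap {f : ℂ → ℂ} {r : ℝ}
    (hf : DifferentiableOn ℂ f (Metric.ball 0 1)) (hr0 : 0 ≤ r) (hr1 : r < 1)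
    (hfr : ∀ z ∈ Metric.sphere 0 r, f z ≠ 0) :
    Continuous fun θ => Real.log ‖f (circleMap 0 r θ)‖ := by
  have h1 : Continuous fun θ => f (circleMap 0 r θ) :=
    hf.continuousOn.comp_continuous (continuous_circleMap 0 r) fun θ => by
      simpa [abs_of_nonneg hr0] using hr1
  exact h1.norm.log fun θ => norm_ne_zero_iff.mpr (hfr _ (by simp [abs_of_nonneg hr0]))

theorem intervalIntegrable_indicator_one {S : Set ℝ} (hS : MeasurableSet S) (a b : ℝ) :
    IntervalIntegrable (S.indicator (1 : ℝ → ℝ)) volume a b := by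
  simpa using intervalIntegrable_indicator_mul hS (continuous_const (y := (1 : ℝ))) a b

theorem integral_indicator_mul_add {S : Set ℝ} (hS : MeasurableSet S) {g : ℝ → ℝ}
    (hg : Continuous g) (a b x : ℝ) :
    ∫ θ in a..b, S.indicator 1 θ * (x + g θ) =
      x * (∫ θ in a..b, S.indicator (1 : ℝ → ℝ) θ) + ∫ θ in a..b, S.indicator 1 θ * g θ := by
  rw [← intervalIntegral.integral_const_mul, ← intervalIntegral.integral_add
    ((intervalIntegrable_indicator_one hS a b).const_mul x)
    (intervalIntegrable_indicator_mul hS hg a b)]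
  simp only [mul_add, mul_comm x]

theorem mul_integral_indicator_le_decayMass {f : ℂ → ℂ} {E : Set ℝ} {k c A ε δ : ℝ}
    (hf : DifferentiableOn ℂ f (Metric.ball 0 1)) (hA : 0 ≤ A) (hδ : 0 < δ) (hδ1 : δ ≤ 1)
    (hfr : ∀ z ∈ Metric.sphere 0 (1 - δ), f z ≠ 0)
    (hsmall : ∀ θ ∈ Metric.thickening (ε * δ) E, ‖f (circleMap 0 (1 - δ) θ)‖ ≤ δ ^ (c / 2)) :
    (k + c / 2) * -Real.log δ *
        ∫ θ in 0..2 * Real.pi, (Metric.thickening (ε * δ) E).indicator (1 : ℝ → ℝ) θ ≤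
      decayMass f E k A ε δ := by
  have hS := measurableSet_thickening (ε * δ) E
  rw [decayMass, ← intervalIntegral.integral_const_mul]
  refine intervalIntegral.integral_mono_on Real.two_pi_pos.le
    ((intervalIntegrable_indicator_one hS _ _).const_mul _)
    (intervalIntegrable_indicator_mul hS (continuous_const.sub
      (continuous_log_norm_circleMap hf (by linarith) (by linarith) hfr)) _ _) fun θ _ => ?_
  by_cases hθ : θ ∈ Metric.thickening (ε * δ) E
  · rw [Set.indicator_of_mem hθ, Pi.one_apply, mul_one, one_mul]
    have h0 : 0 < ‖f (circleMap 0 (1 - δ) θ)‖ :=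
      norm_pos_iff.mpr (hfr _ (by simp [abs_of_nonneg (sub_nonneg.mpr hδ1)]))
    have := Real.log_le_log h0 (hsmall θ hθ)
    rw [Real.log_rpow hδ] at this
    linarith
  · simp [Set.indicator_of_notMem hθ]

theorem log_norm_le_of_norm_le_div_rpow {f : ℂ → ℂ} {C k δ : ℝ} (hC : 0 < C)
    (hfC : ∀ z ∈ Metric.ball (0 : ℂ) 1, ‖f z‖ ≤ C / (1 - ‖z‖) ^ k) (hδ : 0 < δ)
    (hfr : ∀ z ∈ Metric.sphere 0 (1 - δ), f z ≠ 0) {z : ℂ} (hz : z ∈ Metric.sphere 0 (1 - δ)) :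
    Real.log ‖f z‖ ≤ Real.log C - k * Real.log δ := by
  have hzn : ‖z‖ = 1 - δ := mem_sphere_zero_iff_norm.mp hz
  have h1 := hfC z (mem_ball_zero_iff.mpr (by linarith))
  rw [hzn, sub_sub_cancel] at h1
  have h2 := Real.log_le_log (norm_pos_iff.mpr (hfr z hz)) h1
  rwa [Real.log_div hC.ne' (Real.rpow_pos_of_pos hδ k).ne', Real.log_rpow hδ] at h2

theorem mul_decayMass_pow_le {f : ℂ → ℂ} {E : Set ℝ} {C k c A ε δ : ℝ} {M : ℕ}
    (hf : DifferentiableOn ℂ f (Metric.ball 0 1)) (hE : ∀ θ, θ + 2 * Real.pi ∈ E ↔ θ ∈ E)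
    (hC : 1 ≤ C) (hk : 0 < k) (hfC : ∀ z ∈ Metric.ball (0 : ℂ) 1, ‖f z‖ ≤ C / (1 - ‖z‖) ^ k)
    (hc : 0 < c) (hε : 0 < ε) (hε4 : ε ≤ 1 / 4) (hA : A = Real.log C - 2 * k * Real.log ε)
    (hδ : 0 < δ) (hδ4 : δ ≤ 1 / 4) (hM : 1 ≤ M) (hδM : δ ^ M < ε ^ 2 * δ)
    (hf1 : ∀ z ∈ Metric.sphere 0 (1 - δ), f z ≠ 0)
    (hf2 : ∀ z ∈ Metric.sphere 0 (1 - ε ^ 2 * δ), f z ≠ 0)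
    (hf3 : ∀ z ∈ Metric.sphere 0 (1 - δ ^ M), f z ≠ 0)
    (hsmall : ∀ θ ∈ Metric.thickening (ε * δ) E, ‖f (circleMap 0 (1 - δ) θ)‖ ≤ δ ^ (c / 2)) :
    (1 - 4 * Real.pi * ε) * decayMass f E k A ε (δ ^ M) ≤
      (4 * Real.pi / ε + k * M / (k + c / 2)) * decayMass f E k A ε δ := by
  have hpi := Real.pi_pos
  have hlogε : Real.log ε ≤ 0 := Real.log_nonpos hε.le (by linarith)
  have hlogδ : Real.log δ < 0 := Real.log_neg hδ (by linarith)
  have hlogC := Real.log_nonneg hC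
  have hA0 : 0 ≤ A := by rw [hA]; nlinarith
  have hεδ : ε ^ 2 * δ ≤ 1 / 16 * δ := mul_le_mul_of_nonneg_right (by nlinarith) hδ.le
  have hεδ0 : 0 < ε ^ 2 * δ := by positivity
  have hpow : Real.log (δ ^ M) = M * Real.log δ := by rw [Real.log_pow]
  have hM' : (1 : ℝ) ≤ M := by exact_mod_cast hM
  have hinner := mul_integral_thickening_le_inner (K := A - k * Real.log δ) hf hE hε hε4 hδ hδ4
    hf1 hf2 fun z hz => by
      have := log_norm_le_of_norm_le_div_rpow (by linarith) hfC hεδ0 hf2 hz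
      rw [Real.log_mul (by positivity) hδ.ne', Real.log_pow] at this
      push_cast at this
      rw [hA]
      linarith
  have houter := mul_integral_thickening_le_outer (K := A - k * Real.log (δ ^ M)) hf hE hε hε4 hδ
    hδ4 (pow_pos hδ M) hδM hf2 hf3 fun z hz => by
      have := log_norm_le_of_norm_le_div_rpow (by linarith) hfC (pow_pos hδ M) hf3 hz
      have h2 := mul_nonpos_of_nonneg_of_nonpos hk.le hlogε
      rw [hA]
      linarith
  have hP := mul_integral_indicator_le_decayMass (k := k) (A := A) hf hA0 hδ (by linarith) hf1
    hsmall
  have hsplit := integral_indicator_mul_add (measurableSet_thickening (ε * δ) E)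
    ((continuous_const (y := A - k * Real.log δ)).sub
      (continuous_log_norm_circleMap hf (by linarith) (by linarith) hf2))
    0 (2 * Real.pi) (-(k * (M - 1) * Real.log δ))
  have hrw : ∀ θ, -(k * (M - 1) * Real.log δ) + (A - k * Real.log δ -
      Real.log ‖f (circleMap 0 (1 - ε ^ 2 * δ) θ)‖) = A - k * Real.log (δ ^ M) -
      Real.log ‖f (circleMap 0 (1 - ε ^ 2 * δ) θ)‖ := by
    intro θ; rw [hpow]; ring
  simp only [Pi.sub_apply, hrw] at hsplit
  rw [hsplit] at houter
  rw [← decayMass] at hinner houter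
  set P := ∫ θ in 0..2 * Real.pi, (Metric.thickening (ε * δ) E).indicator (1 : ℝ → ℝ) θ with hPdef
  have hP0 : 0 ≤ P := intervalIntegral.integral_nonneg Real.two_pi_pos.le fun θ _ =>
    Set.indicator_nonneg (fun _ _ => zero_le_one) _
  refine houter.trans ?_
  rw [add_comm, add_mul]
  refine add_le_add ?_ ?_
  · rw [div_mul_eq_mul_div, le_div_iff₀ hε]
    rw [div_mul_eq_mul_div, div_le_iff₀ (by positivity)] at hinner
    linarith
  · rw [div_mul_eq_mul_div, le_div_iff₀ (by positivity)]
    have h1 := mul_le_mul_of_nonneg_left hP (by positivity : 0 ≤ k * (M : ℝ))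
    have h2 : 0 ≤ k * (k + c / 2) * -Real.log δ * P := by
      have : 0 ≤ -Real.log δ := by linarith
      positivity
    linarith

theorem countable_zeros_ball {f : ℂ → ℂ} (hf : DifferentiableOn ℂ f (Metric.ball 0 1))
    (hne : ∃ z ∈ Metric.ball (0 : ℂ) 1, f z ≠ 0) :
    {z ∈ Metric.ball (0 : ℂ) 1 | f z = 0}.Countable := by
  have hfa := hf.analyticOnNhd Metric.isOpen_ball
  rcases hfa.eqOn_zero_or_eventually_ne_zero_of_preconnected
    (convex_ball 0 1).isPreconnected with h | h
  · obtain ⟨z, hz, hfz⟩ := hne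
    exact absurd (h hz) hfz
  · have h2 := isDiscrete_of_codiscreteWithin (s := {z | f z = 0}) (U := Metric.ball (0 : ℂ) 1) h
    have h3 := (HereditarilyLindelofSpace.isLindelof _).countable_of_isDiscrete h2
    refine h3.mono ?_
    rintro z ⟨hz1, hz2⟩
    exact ⟨hz2, hz1⟩

theorem exists_forall_pow_notMem_of_countable {Z : Set ℝ} (hZ : Z.Countable) {n : ℕ → ℕ}
    (hn : ∀ j, n j ≠ 0) {ε δ₁ : ℝ} (hε : 0 < ε) (hδ₁ : 0 < δ₁) :
    ∃ δ ∈ Set.Ioo 0 δ₁, ∀ j, 1 - δ ^ n j ∉ Z ∧ 1 - ε * δ ^ n j ∉ Z := by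
  have hbad : (⋃ j, ⋃ z ∈ Z, {δ : ℝ | 0 < δ ∧ 1 - δ ^ n j = z} ∪
      {δ : ℝ | 0 < δ ∧ 1 - ε * δ ^ n j = z}).Countable := by
    refine Set.countable_iUnion fun j => hZ.biUnion fun z _ => Set.Countable.union ?_ ?_
    · refine Set.Subsingleton.countable fun a ha b hb => ?_
      exact (pow_left_inj₀ ha.1.le hb.1.le (hn j)).mp (by linarith [ha.2, hb.2])
    · refine Set.Subsingleton.countable fun a ha b hb => ?_
      refine (pow_left_inj₀ ha.1.le hb.1.le (hn j)).mp (mul_left_cancel₀ hε.ne' ?_)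
      linarith [ha.2, hb.2]
  have hunc : ¬ (Set.Ioo 0 δ₁).Countable := by
    rw [← Cardinal.le_aleph0_iff_set_countable, Cardinal.mk_Ioo_real hδ₁, not_le]
    exact Cardinal.aleph0_lt_continuum
  obtain ⟨δ, hδ, hδbad⟩ := Set.not_subset.mp fun h => hunc (hbad.mono h)
  refine ⟨δ, hδ, fun j => ⟨fun hz => hδbad ?_, fun hz => hδbad ?_⟩⟩
  · exact Set.mem_iUnion.mpr ⟨j, Set.mem_biUnion hz (Or.inl ⟨hδ.1, rfl⟩)⟩
  · exact Set.mem_iUnion.mpr ⟨j, Set.mem_biUnion hz (Or.inr ⟨hδ.1, rfl⟩)⟩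

/-- A set in `[0, 2π)` is covered by a grid of intervals whose total length is controlled by the
measure of a neighbourhood of the set. -/
theorem exists_finset_cover_of_thickening (E : Set ℝ) {s : ℝ} (hs : 0 < s) (hs1 : s ≤ 1) :
    ∃ t ∈ Set.Icc (s / 2) s, ∃ I : Finset ℕ,
      (E ∩ Set.Ico 0 (2 * Real.pi) ⊆ ⋃ i : I, Set.Icc ((i : ℕ) * t) (((i : ℕ) + 1) * t)) ∧
      I.card * t ≤
        ∫ θ in 0..2 * Real.pi, (Metric.thickening s E).indicator (1 : ℝ → ℝ) θ := by
  classical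
  have hpi := Real.two_pi_pos
  set N := ⌈2 * Real.pi / s⌉₊ with hN
  have hN1 : 2 * Real.pi / s ≤ N := Nat.le_ceil _
  have hN2 : (N : ℝ) < 2 * Real.pi / s + 1 := Nat.ceil_lt_add_one (by positivity)
  have hN0 : (0 : ℝ) < N := (by positivity : 0 < 2 * Real.pi / s).trans_le hN1
  set t := 2 * Real.pi / N with ht
  have ht0 : 0 < t := by positivity
  have hNt : N * t = 2 * Real.pi := by rw [ht]; field_simp
  have hts : t ≤ s := by
    rw [ht, div_le_iff₀ hN0]
    rw [div_le_iff₀ hs] at hN1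
    linarith
  have hst : s / 2 ≤ t := by
    rw [ht, le_div_iff₀ hN0]
    have h1 : s * (2 * Real.pi / s + 1) = 2 * Real.pi + s := by field_simp
    nlinarith [Real.pi_gt_three]
  set I := (Finset.range N).filter
    fun i : ℕ => (E ∩ Set.Ico ((i : ℝ) * t) ((i + 1) * t)).Nonempty with hI
  have hInt := fun a b : ℝ => intervalIntegrable_indicator_one (measurableSet_thickening s E) a b
  refine ⟨t, ⟨hst, hts⟩, I, ?_, ?_⟩
  · rintro θ ⟨hθE, hθ0, hθ1⟩
    have hf1 : (⌊θ / t⌋₊ : ℝ) * t ≤ θ := by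
      rw [← le_div_iff₀ ht0]; exact Nat.floor_le (by positivity)
    have hf2 : θ < (⌊θ / t⌋₊ + 1) * t := by
      rw [← div_lt_iff₀ ht0]; exact Nat.lt_floor_add_one _
    have hmem : ⌊θ / t⌋₊ ∈ I := by
      rw [hI, Finset.mem_filter, Finset.mem_range]
      refine ⟨?_, θ, hθE, hf1, hf2⟩
      rw [Nat.floor_lt (by positivity), div_lt_iff₀ ht0, hNt]
      exact hθ1
    exact Set.mem_iUnion.mpr ⟨⟨_, hmem⟩, hf1, hf2.le⟩
  · have hsum := intervalIntegral.sum_integral_adjacent_intervals (μ := volume)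
      (f := (Metric.thickening s E).indicator (1 : ℝ → ℝ)) (a := fun i : ℕ => (i : ℝ) * t) (n := N)
      fun i _ => hInt _ _
    simp only [Nat.cast_zero, zero_mul, hNt] at hsum
    rw [← hsum, ← nsmul_eq_mul, ← Finset.sum_const]
    refine (Finset.sum_le_sum fun i hi => ?_).trans (Finset.sum_le_sum_of_subset_of_nonneg
      (Finset.filter_subset _ _) fun i _ _ => ?_)
    · obtain ⟨e, heE, he1, he2⟩ := (Finset.mem_filter.mp hi).2
      push_cast
      calc t = ∫ _ in (i : ℝ) * t..(i + 1) * t, (1 : ℝ) := by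
            rw [intervalIntegral.integral_const, smul_eq_mul]; ring
        _ ≤ _ := by
            refine intervalIntegral.integral_mono_on_of_le_Ioo (by linarith) (by simp)
              (hInt _ _) fun θ hθ => ?_
            rw [Set.indicator_of_mem, Pi.one_apply]
            refine Metric.mem_thickening_iff.mpr ⟨e, heE, ?_⟩
            rw [Real.dist_eq, abs_lt]
            constructor <;> linarith [hθ.1, hθ.2]
    · push_cast
      exact intervalIntegral.integral_nonneg (by linarith) fun θ _ =>
        Set.indicator_nonneg (fun _ _ => zero_le_one) _

theorem hausdorffGauge_eq_zero_of_covers {lam : ℝ → ℝ} {ω : ℝ}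
    (hlam : Tendsto (fun t : ℝ => lam t / (t * |Real.log t| ^ ω))
      (nhdsWithin 0 (Set.Ioi 0)) (nhds 0)) {D : Set ℝ} {t : ℕ → ℝ} {I : ℕ → Finset ℕ}
    (ht0 : ∀ j, 0 < t j) (ht : Tendsto t atTop (nhds 0))
    (hD : ∀ j, D ⊆ ⋃ i : I j, Set.Icc ((i : ℕ) * t j) (((i : ℕ) + 1) * t j))
    (hsum : Tendsto (fun j => (I j).card * t j * |Real.log (t j)| ^ ω) atTop (nhds 0)) :
    hausdorffGauge lam D = 0 := by
  have hdiam : ∀ j, ∀ i : I j,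
      Metric.ediam (Set.Icc ((i : ℕ) * t j) (((i : ℕ) + 1) * t j)) = ENNReal.ofReal (t j) := by
    intro j i
    rw [Real.ediam_Icc]
    congr 1
    ring
  have htend : Tendsto (fun j => ENNReal.ofReal (t j)) atTop (nhds 0) := by
    simpa using ENNReal.tendsto_ofReal ht
  have hle := Measure.mkMetric_le_liminf_sum D (fun j => ENNReal.ofReal (t j)) htend
    (fun j (i : I j) => Set.Icc ((i : ℕ) * t j) (((i : ℕ) + 1) * t j))
    (Eventually.of_forall fun j i => (hdiam j i).le) (Eventually.of_forall hD)
    fun d => ENNReal.ofReal (lam d.toReal)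
  refine le_antisymm (hle.trans ?_) bot_le
  have hlim : Tendsto (fun j => ENNReal.ofReal ((I j).card * t j * |Real.log (t j)| ^ ω)) atTop
      (nhds 0) := by
    simpa using ENNReal.tendsto_ofReal hsum
  rw [← hlim.liminf_eq]
  refine liminf_le_liminf ?_
  have ht' : Tendsto t atTop (nhdsWithin 0 (Set.Ioi 0)) :=
    tendsto_nhdsWithin_iff.mpr ⟨ht, Eventually.of_forall ht0⟩
  filter_upwards [(hlam.comp ht').eventually (ge_mem_nhds zero_lt_one),
    ht.eventually (gt_mem_nhds zero_lt_one)] with j hj1 hj2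
  have hlog : 0 < |Real.log (t j)| := abs_pos.mpr (Real.log_neg (ht0 j) hj2).ne
  have hpos : 0 < t j * |Real.log (t j)| ^ ω := mul_pos (ht0 j) (Real.rpow_pos_of_pos hlog _)
  rw [Function.comp_apply, div_le_one hpos] at hj1
  simp only [hdiam, Finset.sum_const, Finset.card_univ, Fintype.card_coe,
    ENNReal.toReal_ofReal (ht0 j).le]
  rw [nsmul_eq_mul, mul_assoc, ENNReal.ofReal_mul (Nat.cast_nonneg _), ENNReal.ofReal_natCast]
  gcongr

theorem exists_iteration_parameters {k c : ℝ} (hk : 0 < k) (hc : 0 < c) :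
    ∃ ε > 0, ε ≤ 1 / 4 ∧ 20 * ε * (k + c) ≤ c ∧ 0 < 1 - 4 * Real.pi * ε ∧
      ∃ M : ℕ, 2 ≤ M ∧ ∃ q ∈ Set.Ioo (0 : ℝ) 1,
        4 * Real.pi / ε + k * M / (k + c / 2) = M * q * (1 - 4 * Real.pi * ε) := by
  have hpi := Real.pi_pos
  set g := c / 2 / (k + c / 2) with hg
  have hg0 : 0 < g := by positivity
  have hkg : k / (k + c / 2) = 1 - g := by rw [hg]; field_simp; ring
  set ε := min (min (1 / 4) (c / (20 * (k + c)))) (g / (8 * Real.pi)) with hε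
  have hε0 : 0 < ε := by positivity
  have h1 : ε ≤ 1 / 4 := (min_le_left _ _).trans (min_le_left _ _)
  have h2 : ε ≤ c / (20 * (k + c)) := (min_le_left _ _).trans (min_le_right _ _)
  have h3 : ε ≤ g / (8 * Real.pi) := min_le_right _ _
  rw [le_div_iff₀ (by positivity)] at h2 h3
  have hg1 : 0 < 1 - g := hkg ▸ (by positivity)
  have hb : 1 - g + g / 2 ≤ 1 - 4 * Real.pi * ε := by linarith
  have hb0 : 0 < 1 - 4 * Real.pi * ε := by linarith
  obtain ⟨M, hM⟩ := exists_nat_gt (max 2 (4 * Real.pi / ε / (g / 2)))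
  obtain ⟨hM2, hMg⟩ := max_lt_iff.mp hM
  have hM0 : (0 : ℝ) < M := by linarith
  rw [div_lt_iff₀ (by positivity)] at hMg
  have hX : 4 * Real.pi / ε + k * M / (k + c / 2) < M * (1 - 4 * Real.pi * ε) := by
    rw [mul_div_right_comm k, hkg]
    nlinarith
  refine ⟨ε, hε0, h1, by linarith, hb0, M, by exact_mod_cast hM2.le,
    (4 * Real.pi / ε + k * M / (k + c / 2)) / (M * (1 - 4 * Real.pi * ε)),
    ⟨by positivity, (div_lt_one (by positivity)).mpr hX⟩, ?_⟩
  field_simp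

theorem hausdorffGauge_decayDirections_inter_eq_zero {lam : ℝ → ℝ}
    (hlam : ∀ ω : ℝ, 0 < ω → Tendsto (fun t : ℝ => lam t / (t * |Real.log t| ^ ω))
      (nhdsWithin 0 (Set.Ioi 0)) (nhds 0))
    {f : ℂ → ℂ} {C k c δ₀ : ℝ} (hf : DifferentiableOn ℂ f (Metric.ball 0 1)) (hC : 1 ≤ C)
    (hk : 0 < k) (hfC : ∀ z ∈ Metric.ball (0 : ℂ) 1, ‖f z‖ ≤ C / (1 - ‖z‖) ^ k)
    (hne : ∃ z ∈ Metric.ball (0 : ℂ) 1, f z ≠ 0) (hc : 0 < c) (hδ₀ : 0 < δ₀) :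
    hausdorffGauge lam (decayDirections f c δ₀ ∩ Set.Ico 0 (2 * Real.pi)) = 0 := by
  have hpi := Real.pi_pos
  set E := decayDirections f c δ₀ with hEdef
  have hE : ∀ θ, θ + 2 * Real.pi ∈ E ↔ θ ∈ E := fun θ => by
    simp only [hEdef, decayDirections, Set.mem_ofPred_eq, periodic_circleMap 0 _ θ]
  obtain ⟨ε, hε, hε4, hεc, hb0, M, hM, q, ⟨hq0, hq1⟩, hq⟩ := exists_iteration_parameters hk hc
  obtain ⟨δ₁, hδ₁, hsmall⟩ :=
    exists_norm_le_rpow_half_of_mem_decayDirections hf hC hk hfC hc hδ₀ hε hε4 hεc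
  have hMj : ∀ j, M ^ j ≠ 0 := fun j => pow_ne_zero _ (by omega)
  obtain ⟨δ, ⟨hδ0, hδ⟩, hδZ⟩ := exists_forall_pow_notMem_of_countable
    ((countable_zeros_ball hf hne).image fun z => ‖z‖) (n := fun j => M ^ j) hMj
    (ε := ε ^ 2) (δ₁ := min (min δ₁ (1 / 4)) (min (ε ^ 2) (ε / 2))) (by positivity) (by positivity)
  simp only [lt_min_iff] at hδ
  obtain ⟨⟨hδδ₁, hδ4⟩, hδε2, hδε⟩ := hδ
  set d : ℕ → ℝ := fun j => δ ^ M ^ j with hd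
  have hd0 : ∀ j, 0 < d j := fun j => pow_pos hδ0 _
  have hdδ : ∀ j, d j ≤ δ := fun j => pow_le_of_le_one hδ0.le (by linarith) (hMj j)
  have hdsucc : ∀ j, d (j + 1) = d j ^ M := fun j => by simp only [hd, ← pow_mul, pow_succ]
  have hdlog : ∀ j, Real.log (d j) = M ^ j * Real.log δ := fun j => by
    simp only [hd, Real.log_pow]; push_cast; rfl
  have hℓ : 0 < -Real.log δ := by linarith [Real.log_neg hδ0 (by linarith)]
  have hf1 : ∀ j, ∀ z ∈ Metric.sphere 0 (1 - d j), f z ≠ 0 := fun j z hz hfz =>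
    (hδZ j).1 ⟨z, ⟨mem_ball_zero_iff.mpr (by
      rw [mem_sphere_zero_iff_norm.mp hz]; linarith [hd0 j]), hfz⟩, mem_sphere_zero_iff_norm.mp hz⟩
  have hf2 : ∀ j, ∀ z ∈ Metric.sphere 0 (1 - ε ^ 2 * d j), f z ≠ 0 := fun j z hz hfz =>
    (hδZ j).2 ⟨z, ⟨mem_ball_zero_iff.mpr (by
      rw [mem_sphere_zero_iff_norm.mp hz]
      linarith [mul_pos (pow_pos hε 2) (hd0 j)]), hfz⟩, mem_sphere_zero_iff_norm.mp hz⟩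
  have hsm : ∀ j, ∀ θ ∈ Metric.thickening (ε * d j) E,
      ‖f (circleMap 0 (1 - d j) θ)‖ ≤ d j ^ (c / 2) := by
    intro j θ hθ
    obtain ⟨θ₀, hθ₀, hθθ₀⟩ := Metric.mem_thickening_iff.mp hθ
    exact hsmall _ ⟨hd0 j, (hdδ j).trans hδδ₁.le⟩ θ₀ hθ₀ θ hθθ₀
  set A := Real.log C - 2 * k * Real.log ε with hA
  have hA0 : 0 ≤ A := by
    have h1 := Real.log_nonneg hC
    have h2 : Real.log ε ≤ 0 := Real.log_nonpos hε.le (by linarith)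
    rw [hA]
    nlinarith
  have hMR : (2 : ℝ) ≤ M := by exact_mod_cast hM
  have hΦ : ∀ j, decayMass f E k A ε (d j) ≤ (M * q) ^ j * decayMass f E k A ε (d 0) := by
    intro j
    induction j with
    | zero => simp
    | succ j ih =>
      have hlt : d j ^ M < ε ^ 2 * d j := by
        calc d j ^ M ≤ d j ^ 2 := pow_le_pow_of_le_one (hd0 j).le (by linarith [hdδ j]) hM
          _ = d j * d j := sq _
          _ < ε ^ 2 * d j := mul_lt_mul_of_pos_right (by linarith [hdδ j]) (hd0 j)
      have h := mul_decayMass_pow_le (M := M) (C := C) (c := c) hf hE hC hk hfC hc hε hε4 hA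
        (hd0 j) (by linarith [hdδ j]) (by omega) hlt (hf1 j) (hf2 j) (hdsucc j ▸ hf1 (j + 1))
        (hsm j)
      rw [hq, ← hdsucc, mul_comm, mul_right_comm _ (1 - 4 * Real.pi * ε)] at h
      have h' := le_of_mul_le_mul_right h hb0
      rw [pow_succ', mul_assoc]
      exact h'.trans (mul_le_mul_of_nonneg_left ih (by positivity))
  set P : ℕ → ℝ := fun j =>
    ∫ θ in 0..2 * Real.pi, (Metric.thickening (ε * d j) E).indicator (1 : ℝ → ℝ) θ with hP
  set B := decayMass f E k A ε (d 0) / ((k + c / 2) * -Real.log δ) with hB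
  have hPB : ∀ j, P j ≤ B * q ^ j := by
    intro j
    have h := (mul_integral_indicator_le_decayMass (k := k) hf hA0 (hd0 j)
      (by linarith [hdδ j]) (hf1 j) (hsm j)).trans (hΦ j)
    rw [hdlog, mul_pow] at h
    have hMpos : (0 : ℝ) < M ^ j := by positivity
    have h2 : (M : ℝ) ^ j * ((k + c / 2) * -Real.log δ * P j) ≤
        M ^ j * (q ^ j * decayMass f E k A ε (d 0)) := by
      linarith
    have h3 := le_of_mul_le_mul_left h2 hMpos
    rw [hB, div_mul_eq_mul_div, le_div_iff₀ (by positivity)]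
    linarith
  choose t ht I hID hIP using fun j => exists_finset_cover_of_thickening E
    (mul_pos hε (hd0 j)) (by nlinarith [hdδ j, hd0 j] : ε * d j ≤ 1)
  have ht0 : ∀ j, 0 < t j := fun j => (half_pos (mul_pos hε (hd0 j))).trans_le (ht j).1
  have hdle : ∀ j, d j ≤ δ ^ j := fun j =>
    pow_le_pow_of_le_one hδ0.le (by linarith) (Nat.lt_pow_self (by omega)).le
  have htlim : Tendsto t atTop (nhds 0) := by
    refine squeeze_zero (fun j => (ht0 j).le) (fun j => ?_)
      (tendsto_pow_atTop_nhds_zero_of_lt_one hδ0.le (by linarith : δ < 1))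
    exact (ht j).2.trans ((mul_le_of_le_one_left (hd0 j).le (by linarith)).trans (hdle j))
  have htlog : ∀ j, |Real.log (t j)| ≤ 2 * (M ^ j * -Real.log δ) := by
    intro j
    have h1 : t j ≤ 1 := (ht j).2.trans (by nlinarith [hdδ j, hd0 j])
    rw [abs_of_nonpos (Real.log_nonpos (ht0 j).le h1)]
    have h2 : d j * d j ≤ t j := by
      refine le_trans ?_ (ht j).1
      have := mul_le_mul_of_nonneg_right ((hdδ j).trans hδε.le) (hd0 j).le
      linarith
    have h3 := Real.log_le_log (mul_pos (hd0 j) (hd0 j)) h2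
    rw [Real.log_mul (hd0 j).ne' (hd0 j).ne', hdlog] at h3
    linarith
  obtain ⟨ω, hω, hω0⟩ : ∃ ω : ℝ, q * (M : ℝ) ^ ω < 1 ∧ 0 < ω := by
    have hcont : Tendsto (fun ω : ℝ => q * (M : ℝ) ^ ω) (nhdsWithin 0 (Set.Ioi 0)) (nhds q) := by
      have := ((Real.continuousAt_const_rpow (a := (M : ℝ)) (b := 0)
        (by linarith)).tendsto.const_mul q)
      rw [Real.rpow_zero, mul_one] at this
      exact this.mono_left nhdsWithin_le_nhds
    exact ((hcont.eventually (gt_mem_nhds hq1)).and self_mem_nhdsWithin).exists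
  refine hausdorffGauge_eq_zero_of_covers (hlam ω hω0) ht0 htlim hID ?_
  have hlim : Tendsto (fun j => B * (2 * -Real.log δ) ^ ω * (q * (M : ℝ) ^ ω) ^ j) atTop
      (nhds 0) := by
    simpa using (tendsto_pow_atTop_nhds_zero_of_lt_one (by positivity) hω).const_mul
      (B * (2 * -Real.log δ) ^ ω)
  refine squeeze_zero (fun j => ?_) (fun j => ?_) hlim
  · have := (ht0 j).le
    positivity
  · calc (I j).card * t j * |Real.log (t j)| ^ ω
        ≤ B * q ^ j * (2 * (M ^ j * -Real.log δ)) ^ ω := by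
          refine mul_le_mul ((hIP j).trans (hPB j))
            (Real.rpow_le_rpow (abs_nonneg _) (htlog j) hω0.le) (by positivity) ?_
          exact le_trans (mul_nonneg (Nat.cast_nonneg _) (ht0 j).le) ((hIP j).trans (hPB j))
      _ = _ := by
          rw [show 2 * ((M : ℝ) ^ j * -Real.log δ) = 2 * -Real.log δ * M ^ j by ring,
            Real.mul_rpow (by positivity) (by positivity), mul_pow, ← Real.rpow_natCast_mul
            (by positivity), mul_comm (j : ℝ) ω, Real.rpow_mul_natCast (by positivity)]
          ring

theorem Dminus_subset_iUnion_decayDirections (f : ℂ → ℂ) :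
    Dminus f ⊆ ⋃ n : ℕ, decayDirections f (1 / (n + 1)) (1 / (n + 1)) ∩
      Set.Ico 0 (2 * Real.pi) := by
  rintro θ ⟨hθ, c, hc, hev⟩
  obtain ⟨l, hl1, hl⟩ := mem_nhdsLT_iff_exists_Ioo_subset.mp hev
  obtain ⟨n, hn⟩ := exists_nat_one_div_lt (lt_min (lt_min hc (sub_pos.mpr hl1)) one_pos)
  simp only [lt_min_iff] at hn
  obtain ⟨⟨hnc, hnl⟩, hn1⟩ := hn
  refine Set.mem_iUnion.mpr ⟨n, fun δ hδ => ?_, hθ⟩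
  have hδ1 : δ < 1 := hδ.2.trans_lt hn1
  have h := hl (⟨by linarith [hδ.2], by linarith [hδ.1]⟩ : 1 - δ ∈ Set.Ioo l 1)
  have hcm : circleMap 0 (1 - δ) θ = ((1 - δ : ℝ) : ℂ) * Complex.exp (Complex.I * (θ : ℂ)) := by
    rw [circleMap_zero, mul_comm Complex.I]
  simp only [Set.mem_ofPred_eq, ← hcm, sub_sub_cancel] at h
  have hlog : Real.log δ < 0 := Real.log_neg hδ.1 hδ1
  rw [abs_of_neg hlog, div_le_iff₀ (neg_pos.mpr hlog), neg_mul_neg] at h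
  rcases (norm_nonneg (f (circleMap 0 (1 - δ) θ))).eq_or_lt with h0 | h0
  · rw [← h0]
    exact Real.rpow_nonneg hδ.1.le _
  · rw [← Real.exp_log h0, Real.rpow_def_of_pos hδ.1, Real.exp_le_exp]
    refine h.trans ?_
    nlinarith

theorem Dminus_eq_empty_of_eqOn_zero {f : ℂ → ℂ} (h : ∀ z ∈ Metric.ball (0 : ℂ) 1, f z = 0) :
    Dminus f = ∅ := by
  refine Set.eq_empty_of_forall_notMem ?_
  rintro θ ⟨-, c, hc, hev⟩
  have h2 : ∀ᶠ r : ℝ in nhdsWithin 1 (Set.Iio 1), r ∈ Set.Ioo (0 : ℝ) 1 :=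
    Ioo_mem_nhdsLT zero_lt_one
  obtain ⟨r, hr, hr0, hr1⟩ := (hev.and h2).exists
  rw [h _ (by simpa [Complex.norm_exp, abs_of_pos hr0] using hr1)] at hr
  simp at hr
  linarith

/-- If `λ` is increasing with `λ(0)=0` and `λ(t) = o(t |log t|^ω)` as `t → 0⁺` for every
`ω > 0`, then `H_λ(D_-(f)) = 0` for every `f ∈ A^{-∞}`. -/
theorem stmt1 (lam : ℝ → ℝ)
    (hmono : MonotoneOn lam (Set.Ico 0 1))
    (hnonneg : ∀ t ∈ Set.Ico (0:ℝ) 1, 0 ≤ lam t)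
    (hlam0 : lam 0 = 0)
    (hsmall : ∀ ω : ℝ, 0 < ω →
      Tendsto (fun t : ℝ => lam t / (t * |Real.log t| ^ ω))
        (nhdsWithin 0 (Set.Ioi 0)) (nhds 0))
    (f : ℂ → ℂ) (hf : Korenblum f) :
    hausdorffGauge lam (Dminus f) = 0 := by
  obtain ⟨hfd, C, k, hC, hk, hfC⟩ := hf
  by_cases hne : ∃ z ∈ Metric.ball (0 : ℂ) 1, f z ≠ 0
  · refine measure_mono_null (Dminus_subset_iUnion_decayDirections f)
      (measure_iUnion_null fun n => ?_)
    refine hausdorffGauge_decayDirections_inter_eq_zero hsmall (C := max C 1) hfd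
      (le_max_right _ _) hk (fun z hz => (hfC z hz).trans ?_) hne (by positivity) (by positivity)
    have : 0 < 1 - ‖z‖ := sub_pos.mpr (mem_ball_zero_iff.mp hz)
    gcongr
    exact le_max_left _ _
  · push Not at hne
    rw [Dminus_eq_empty_of_eqOn_zero hne, measure_empty]
end
end

section
/- Let λ : [0,1) → [0,∞) be an increasing function with λ(0) = 0 such that λ(t) = o(t·|log t|^ω) as t → 0 for every ω > 0. Then for every function u in the class K, the Hausdorff measure H_λ of the set E_+(u) is zero. -/
open Filter MeasureTheory

noncomputable section

/-- `u` is harmonic on the open unit disc; on the (simply connected) disc this is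
equivalent to `u` being the real part of a holomorphic function. -/
def HarmonicOnDisc (u : ℂ → ℝ) : Prop :=
  ∃ F : ℂ → ℂ, DifferentiableOn ℂ F (Metric.ball 0 1) ∧
    ∀ z ∈ Metric.ball (0:ℂ) 1, u z = (F z).re

/-- The class `K`: harmonic functions on the unit disc with
`u(z) ≤ C log(e/(1-|z|))`. -/
def ClassK (u : ℂ → ℝ) : Prop :=
  HarmonicOnDisc u ∧
    ∃ C : ℝ, ∀ z ∈ Metric.ball (0:ℂ) 1, u z ≤ C * Real.log (Real.exp 1 / (1 - ‖z‖))

/-- `E_+(u)`: the set of `θ ∈ [0, 2π)` such that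
`liminf_{r→1⁻} u(re^{iθ}) / |log(1-r)| > 0`. -/
def Eplus (u : ℂ → ℝ) : Set ℝ :=
  {θ | θ ∈ Set.Ico 0 (2 * Real.pi) ∧
    ∃ c : ℝ, 0 < c ∧ ∀ᶠ r : ℝ in nhdsWithin 1 (Set.Iio 1),
      c ≤ u ((r : ℂ) * Complex.exp (Complex.I * (θ : ℂ))) / |Real.log (1 - r)|}

/-- `G` is holomorphic on the upper half plane and `Re G(w) ≤ C log (1 / Im w)` near the
real axis. -/
structure LogBounded (G : ℂ → ℂ) (C : ℝ) : Prop where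
  pos : 0 < C
  diff : DifferentiableOn ℂ G {w | 0 < w.im}
  bound : ∀ w : ℂ, 0 < w.im → w.im ≤ 1 / 4 → (G w).re ≤ C * -Real.log w.im

lemma two_le_neg_log {y : ℝ} (hy : 0 < y) (hy' : y ≤ 1 / 8) : 2 ≤ -Real.log y := by
  have h1 : Real.log y ≤ Real.log (1 / 8) := Real.log_le_log hy hy'
  have h2 : Real.log (1 / 8) = -(3 * Real.log 2) := by
    rw [one_div, Real.log_inv, show (8 : ℝ) = 2 ^ 3 by norm_num, Real.log_pow]; norm_num
  have := Real.log_two_gt_d9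
  linarith

namespace LogBounded

variable {G : ℂ → ℂ} {C : ℝ}

lemma norm_sub_le (h : LogBounded G C) {w z : ℂ} (hw : 0 < w.im) (hw' : w.im ≤ 1 / 8)
    (hG : 0 ≤ (G w).re) (hz : ‖z - w‖ ≤ w.im / 4) :
    ‖G z - G w‖ ≤ 16 * C * -Real.log w.im * (‖z - w‖ / w.im) := by
  have hC := h.pos
  have hL := two_le_neg_log hw hw'
  have hmem : ∀ x ∈ Metric.ball (0 : ℂ) (w.im / 2),
      w.im / 2 < (w + x).im ∧ (w + x).im < 3 * w.im / 2 := by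
    intro x hx
    have h1 := (Complex.abs_im_le_norm x).trans_lt (mem_ball_zero_iff.mp hx)
    rw [abs_lt] at h1
    rw [Complex.add_im]
    constructor <;> linarith
  have key := Complex.borelCaratheodory_zero (f := fun x => G (w + x) - G w)
    (M := 2 * C * -Real.log w.im) (R := w.im / 2) (z := z - w) (by positivity) ?_ ?_ (by positivity)
    (by rw [mem_ball_zero_iff]; linarith) (by simp)
  · simp only [add_sub_cancel] at key
    refine key.trans ?_
    calc 2 * (2 * C * -Real.log w.im) * ‖z - w‖ / (w.im / 2 - ‖z - w‖)
        ≤ 2 * (2 * C * -Real.log w.im) * ‖z - w‖ / (w.im / 4) := by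
          gcongr
          linarith
      _ = _ := by field_simp; ring
  · refine DifferentiableOn.sub_const ?_ _
    refine h.diff.comp (by fun_prop) fun x hx => ?_
    have := hmem x hx
    simp only [Set.mem_ofPred_eq]
    linarith
  · intro x hx
    obtain ⟨h1, h2⟩ := hmem x hx
    have h3 := h.bound (w + x) (by linarith) (by linarith)
    have h4 : Real.log (w.im / 2) ≤ Real.log (w + x).im := Real.log_le_log (by linarith) h1.le
    rw [Real.log_div hw.ne' two_ne_zero] at h4
    have h5 := Real.log_two_lt_d9
    simp only [Set.mem_ofPred_eq, Complex.sub_re]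
    have h6 : C * -Real.log (w + x).im ≤ C * (2 * -Real.log w.im) :=
      mul_le_mul_of_nonneg_left (by linarith) hC.le
    linarith

lemma differentiableAt (h : LogBounded G C) {w : ℂ} (hw : 0 < w.im) : DifferentiableAt ℂ G w :=
  h.diff.differentiableAt ((isOpen_lt continuous_const Complex.continuous_im).mem_nhds hw)

end LogBounded

lemma neg_log_le_mul_sqrt {y T : ℝ} (hy : 0 < y) (hyT : y ≤ T) (hT : T ≤ 1 / 8) :
    -Real.log y ≤ -Real.log T * √(T / y) := by
  have hT0 : 0 < T := hy.trans_le hyT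
  have hL := two_le_neg_log hT0 hT
  have h1 : 1 ≤ T / y := by rwa [one_le_div hy]
  have h2 : 1 ≤ √(T / y) := Real.one_le_sqrt.mpr h1
  have h3 : Real.log √(T / y) ≤ √(T / y) - 1 := Real.log_le_sub_one_of_pos (by linarith)
  rw [Real.log_sqrt (by linarith), Real.log_div hT0.ne' hy.ne'] at h3
  nlinarith

lemma LogBounded.norm_vertical_sub_le {G : ℂ → ℂ} {C : ℝ} (h : LogBounded G C) {a T : ℝ}
    (hT : T ≤ 1 / 8) (hG : ∀ y : ℝ, 0 < y → y ≤ T → 0 ≤ (G (a + y * Complex.I)).re)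
    {y : ℝ} (hy : 0 < y) (hyT : y ≤ T) :
    ‖G (a + y * Complex.I) - G (a + T * Complex.I)‖ ≤ 28 * C * (-Real.log T * √(T / y)) := by
  have hC := h.pos
  have hT0 : 0 < T := hy.trans_le hyT
  have hL := two_le_neg_log hT0 hT
  have hstep : ∀ y Y : ℝ, 0 < y → y ≤ Y → Y ≤ T → 3 / 4 * Y ≤ y →
      ‖G (a + y * Complex.I) - G (a + Y * Complex.I)‖ ≤ 4 * C * -Real.log Y := by
    intro y Y hy hyY hYT hYy
    have hY : 0 < Y := hy.trans_le hyY
    have hn : ‖((a : ℂ) + y * Complex.I) - (a + Y * Complex.I)‖ = Y - y := by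
      rw [show ((a : ℂ) + y * Complex.I) - (a + Y * Complex.I) = ((y - Y : ℝ) : ℂ) * Complex.I by
        push_cast; ring, norm_mul, Complex.norm_I, mul_one, Complex.norm_real, Real.norm_eq_abs,
        abs_sub_comm, abs_of_nonneg (by linarith)]
    have hL := two_le_neg_log hY (hYT.trans hT)
    have := h.norm_sub_le (w := a + Y * Complex.I) (z := a + y * Complex.I) (by simpa using hY)
      (by simpa using hYT.trans hT) (hG Y hY hYT) (by rw [hn]; simp; linarith)
    rw [hn] at this
    refine this.trans ?_
    have him : ((a : ℂ) + Y * Complex.I).im = Y := by simp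
    rw [him]
    have h1 : (Y - y) / Y ≤ 1 / 4 := by rw [div_le_iff₀ hY]; linarith
    calc 16 * C * -Real.log Y * ((Y - y) / Y) ≤ 16 * C * -Real.log Y * (1 / 4) := by gcongr
      _ = _ := by ring
  have main : ∀ n : ℕ, ∀ y : ℝ, 0 < y → y ≤ T → T ≤ (4 / 3) ^ n * y →
      ‖G (a + y * Complex.I) - G (a + T * Complex.I)‖ ≤ 28 * C * (-Real.log T * √(T / y)) := by
    intro n
    induction n with
    | zero =>
      intro y hy hyT hn
      have : y = T := le_antisymm hyT (by simpa using hn)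
      subst this
      simp only [sub_self, norm_zero]
      positivity
    | succ n ih =>
      intro y hy hyT hn
      rcases le_or_gt (4 / 3 * y) T with hc | hc
      · have h1 := ih (4 / 3 * y) (by positivity) hc (by rw [pow_succ] at hn; linarith)
        have h2 := hstep y (4 / 3 * y) hy (by linarith) hc (by linarith)
        have h3 := neg_log_le_mul_sqrt (by positivity) hc hT
        have h4 : √(T / (4 / 3 * y)) ≤ 7 / 8 * √(T / y) := by
          rw [show T / (4 / 3 * y) = 3 / 4 * (T / y) by field_simp,
            Real.sqrt_mul (by norm_num)]
          gcongr
          rw [Real.sqrt_le_left (by norm_num)]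
          norm_num
        have h5 := norm_sub_le_norm_sub_add_norm_sub (G (a + y * Complex.I))
          (G (a + (4 / 3 * y : ℝ) * Complex.I)) (G (a + T * Complex.I))
        have h6 : 4 * C * -Real.log (4 / 3 * y) ≤ 4 * C * (-Real.log T * √(T / (4 / 3 * y))) := by
          gcongr
        have h7 : 32 * C * (-Real.log T * √(T / (4 / 3 * y)))
            ≤ 32 * C * (-Real.log T * (7 / 8 * √(T / y))) := by gcongr
        linarith
      · have h2 := hstep y T hy hyT le_rfl (by linarith)
        have h3 : 1 ≤ √(T / y) := Real.one_le_sqrt.mpr (by rwa [one_le_div hy])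
        have h4 : C * (-Real.log T * 1) ≤ C * (-Real.log T * √(T / y)) := by gcongr
        have h5 : 0 < C * (-Real.log T * √(T / y)) := by positivity
        linarith
  obtain ⟨n, hn⟩ := pow_unbounded_of_one_lt (T / y) (by norm_num : (1 : ℝ) < 4 / 3)
  exact main n y hy hyT (by rw [div_lt_iff₀ hy] at hn; exact hn.le)

lemma integral_sqrt_div_le {η T : ℝ} (hη : 0 < η) (hηT : η ≤ T) :
    ∫ y in η..T, √(T / y) ≤ 2 * T := by
  have hT : 0 < T := hη.trans_le hηT
  have hd : ∀ y ∈ Set.uIcc η T, HasDerivAt (fun y => 2 * √T * √y) (√(T / y)) y := by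
    intro y hy
    rw [Set.uIcc_of_le hηT] at hy
    have hy0 : 0 < y := hη.trans_le hy.1
    refine ((Real.hasDerivAt_sqrt hy0.ne').const_mul (2 * √T)).congr_deriv ?_
    rw [Real.sqrt_div hT.le]
    field_simp
  have hc : ContinuousOn (fun y => √(T / y)) (Set.uIcc η T) := by
    rw [Set.uIcc_of_le hηT]
    refine Real.continuous_sqrt.comp_continuousOn (continuousOn_const.div continuousOn_id ?_)
    exact fun y hy => (hη.trans_le hy.1).ne'
  rw [intervalIntegral.integral_eq_sub_of_hasDerivAt hd hc.intervalIntegrable]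
  have : √T * √T = T := Real.mul_self_sqrt hT.le
  have h2 : 0 ≤ 2 * √T * √η := by positivity
  linarith

lemma LogBounded.continuous_horizontal {G : ℂ → ℂ} {C : ℝ} (h : LogBounded G C) {η : ℝ}
    (hη : 0 < η) : Continuous fun x : ℝ => G (x + η * Complex.I) := by
  refine continuous_iff_continuousAt.mpr fun x => ?_
  have : ContinuousAt G (x + η * Complex.I) := (h.differentiableAt (by simpa using hη)).continuousAt
  exact ContinuousAt.comp' (f := fun x : ℝ => (x : ℂ) + η * Complex.I) this (by fun_prop)

lemma LogBounded.norm_horizontal_sub_le {G : ℂ → ℂ} {C : ℝ} (h : LogBounded G C) {a x y : ℝ}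
    (hy : 0 < y) (hy' : y ≤ 1 / 8) (hG : 0 ≤ (G (a + y * Complex.I)).re) (hx : |x - a| ≤ y / 4) :
    ‖G (x + y * Complex.I) - G (a + y * Complex.I)‖ ≤ 16 * C * -Real.log y * (|x - a| / y) := by
  have hn : ‖((x : ℂ) + y * Complex.I) - (a + y * Complex.I)‖ = |x - a| := by
    rw [add_sub_add_right_eq_sub, ← Complex.ofReal_sub, Complex.norm_real, Real.norm_eq_abs]
  have him : ((a : ℂ) + y * Complex.I).im = y := by simp
  have := h.norm_sub_le (w := a + y * Complex.I) (z := x + y * Complex.I) (by rwa [him])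
    (by rwa [him]) hG (by rwa [hn, him])
  rwa [hn, him] at this

lemma LogBounded.abs_integral_re_le {G : ℂ → ℂ} {C : ℝ} (h : LogBounded G C) {a b η : ℝ}
    (hab : a < b) (hba : 4 * (b - a) ≤ 1 / 8)
    (ha : ∀ y : ℝ, 0 < y → y ≤ 4 * (b - a) → 0 ≤ (G (a + y * Complex.I)).re)
    (hb : ∀ y : ℝ, 0 < y → y ≤ 4 * (b - a) → 0 ≤ (G (b + y * Complex.I)).re)
    (hη : 0 < η) (hη' : η ≤ 4 * (b - a)) :
    |∫ x in a..b, (G (x + η * Complex.I)).re| ≤ 500 * C * -Real.log (4 * (b - a)) * (b - a) := by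
  have hC := h.pos
  obtain ⟨T, hT⟩ : ∃ T, T = 4 * (b - a) := ⟨_, rfl⟩
  rw [← hT] at hba ha hb hη' ⊢
  have hT0 : 0 < T := by linarith
  have hL := two_le_neg_log hT0 hba
  obtain ⟨L, hLdef⟩ : ∃ L, L = -Real.log T := ⟨_, rfl⟩
  set w₀ : ℂ := a + T * Complex.I with hw₀
  have htop : ∀ x : ℝ, a ≤ x → x ≤ b → ‖G (x + T * Complex.I) - G w₀‖ ≤ 4 * C * L := by
    intro x hax hxb
    have hxa : |x - a| ≤ T / 4 := by rw [abs_of_nonneg (by linarith)]; linarith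
    refine (h.norm_horizontal_sub_le hT0 hba (ha T hT0 le_rfl) hxa).trans ?_
    have : |x - a| / T ≤ 1 / 4 := by rw [div_le_iff₀ hT0]; linarith
    calc 16 * C * -Real.log T * (|x - a| / T) ≤ 16 * C * -Real.log T * (1 / 4) := by gcongr
      _ = _ := by rw [hLdef]; ring
  have hside : ∀ p : ℝ, a ≤ p → p ≤ b →
      (∀ y : ℝ, 0 < y → y ≤ T → 0 ≤ (G (p + y * Complex.I)).re) →
      ‖∫ y in η..T, (G (p + y * Complex.I) - G w₀)‖ ≤ 60 * C * L * T := by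
    intro p hap hpb hp
    have hci : IntervalIntegrable (fun y => √(T / y)) volume η T := by
      refine ContinuousOn.intervalIntegrable ?_
      rw [Set.uIcc_of_le hη']
      refine Real.continuous_sqrt.comp_continuousOn (continuousOn_const.div continuousOn_id ?_)
      exact fun y hy => (hη.trans_le hy.1).ne'
    have h1 : ‖∫ y in η..T, (G (p + y * Complex.I) - G w₀)‖
        ≤ ∫ y in η..T, (4 * C * L + 28 * C * L * √(T / y)) := by
      refine intervalIntegral.norm_integral_le_of_norm_le hη' ?_
        (intervalIntegrable_const.add (hci.const_mul _))
      refine Eventually.of_forall fun y hy => ?_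
      have h2 := h.norm_vertical_sub_le hba hp (hη.trans hy.1) hy.2
      rw [← hLdef] at h2
      have h3 := norm_sub_le_norm_sub_add_norm_sub (G (p + y * Complex.I))
          (G (p + T * Complex.I)) (G w₀)
      have h4 := htop p hap hpb
      linarith
    rw [intervalIntegral.integral_add intervalIntegrable_const (hci.const_mul _),
      intervalIntegral.integral_const, intervalIntegral.integral_const_mul, smul_eq_mul] at h1
    have h5 := integral_sqrt_div_le hη hη'
    have hCL : 0 ≤ C * L := by rw [hLdef]; positivity
    have h6 := mul_le_mul_of_nonneg_left h5 (by linarith : 0 ≤ 28 * (C * L))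
    have h7 : 0 ≤ C * L * η := by positivity
    linarith
  have hrect := Complex.integral_boundary_rect_eq_zero_of_differentiableOn (fun w => G w - G w₀)
    (a + η * Complex.I) (b + T * Complex.I) (by
      refine (h.diff.mono ?_).sub_const _
      intro w hw
      rw [Complex.mem_reProdIm] at hw
      have := hw.2
      simp only [Complex.add_im, Complex.ofReal_im, Complex.mul_im, Complex.ofReal_re,
        Complex.I_im, Complex.I_re, mul_one, mul_zero, add_zero, zero_add,
        Set.uIcc_of_le hη'] at this
      exact hη.trans_le this.1)
  simp only [Complex.add_im, Complex.ofReal_im, Complex.mul_im, Complex.ofReal_re, Complex.I_im,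
    Complex.I_re, mul_one, mul_zero, add_zero, zero_add, Complex.add_re, Complex.mul_re,
    sub_self, smul_eq_mul] at hrect
  have h1 := hside a le_rfl hab.le ha
  have h2 := hside b hab.le le_rfl hb
  have h3 : ‖∫ x in a..b, (G (x + T * Complex.I) - G w₀)‖ ≤ 4 * C * L * (b - a) := by
    have := intervalIntegral.norm_integral_le_of_norm_le_const (a := a) (b := b)
      (f := fun x : ℝ => G (x + T * Complex.I) - G w₀) (C := 4 * C * L) (by
        intro x hx
        rw [Set.uIoc_of_le hab.le] at hx
        exact htop x hx.1.le hx.2)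
    rwa [abs_of_pos (by linarith)] at this
  have h4 : ‖∫ x in a..b, (G (x + η * Complex.I) - G w₀)‖ ≤ 484 * C * L * (b - a) := by
    have e : ∫ x in a..b, (G (x + η * Complex.I) - G w₀)
        = (∫ x in a..b, (G (x + T * Complex.I) - G w₀))
          - Complex.I * (∫ y in η..T, (G (b + y * Complex.I) - G w₀))
          + Complex.I * (∫ y in η..T, (G (a + y * Complex.I) - G w₀)) := by
      linear_combination hrect
    rw [e]
    refine (norm_add_le_of_le (_root_.norm_sub_le _ _) le_rfl).trans ?_
    rw [norm_mul, norm_mul, Complex.norm_I, one_mul, one_mul]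
    have e' : 60 * C * L * T = 240 * (C * L * (b - a)) := by rw [hT]; ring
    linarith
  have hcont := h.continuous_horizontal hη
  have h5 : ∫ x in a..b, (G (x + η * Complex.I)).re
      = (∫ x in a..b, (G (x + η * Complex.I) - G w₀)).re + (b - a) * (G w₀).re := by
    rw [intervalIntegral.integral_sub (hcont.intervalIntegrable _ _) intervalIntegrable_const,
      intervalIntegral.integral_const, Complex.sub_re, Complex.smul_re, smul_eq_mul,
      sub_add_cancel]
    exact Complex.reCLM.intervalIntegral_comp_comm (hcont.intervalIntegrable _ _)
  have h6 : 0 ≤ (G w₀).re := ha T hT0 le_rfl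
  have him : w₀.im = T := by simp [hw₀]
  have h7 : (G w₀).re ≤ C * L := by
    have := h.bound w₀ (by rwa [him]) (by rw [him]; linarith)
    rwa [him, ← hLdef] at this
  have h8 := Complex.abs_re_le_norm (∫ x in a..b, (G (x + η * Complex.I) - G w₀))
  rw [h5, ← hLdef]
  refine (abs_add_le _ _).trans ?_
  rw [abs_of_nonneg (mul_nonneg (by linarith) h6)]
  have h9 := mul_le_mul_of_nonneg_left h7 (by linarith : 0 ≤ b - a)
  have h10 : 0 ≤ C * L * (b - a) :=
    mul_nonneg (mul_nonneg hC.le (by linarith)) (by linarith)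
  linarith

lemma exists_finset_Icc_subset {a b ρ : ℝ} (hab : a ≤ b) (hρ : 0 < ρ) :
    ∃ P : Finset ℝ, Set.Icc a b ⊆ ⋃ p ∈ P, Set.Icc p (p + ρ) ∧
      (P.card : ℝ) ≤ (b - a) / ρ + 1 := by
  classical
  refine ⟨(Finset.range (⌊(b - a) / ρ⌋₊ + 1)).image fun i : ℕ => a + i * ρ, ?_, ?_⟩
  · intro x hx
    have h0 : 0 ≤ (x - a) / ρ := div_nonneg (by linarith [hx.1]) hρ.le
    have h1 := Nat.floor_le h0
    have h2 := (Nat.lt_floor_add_one ((x - a) / ρ)).le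
    rw [le_div_iff₀ hρ] at h1
    rw [div_le_iff₀ hρ] at h2
    have h3 : ⌊(x - a) / ρ⌋₊ ≤ ⌊(b - a) / ρ⌋₊ :=
      Nat.floor_mono (div_le_div_of_nonneg_right (by linarith [hx.2]) hρ.le)
    simp only [Set.mem_iUnion, Finset.mem_image, Finset.mem_range]
    refine ⟨_, ⟨⌊(x - a) / ρ⌋₊, by omega, rfl⟩, ?_, ?_⟩ <;> linarith
  · have h1 : (((Finset.range (⌊(b - a) / ρ⌋₊ + 1)).image fun i : ℕ => a + i * ρ).card : ℝ)
        ≤ (⌊(b - a) / ρ⌋₊ + 1 : ℕ) := by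
      exact_mod_cast Finset.card_image_le.trans (Finset.card_range _).le
    have h2 := Nat.floor_le (div_nonneg (sub_nonneg.mpr hab) hρ.le)
    push_cast at h1
    linarith

/-- A compact set `E` with `f` large near `E` and not too negative on average between points of
`E` has an efficient covering, unless the integral of `f` is large. -/
lemma exists_cover_of_integral {E : Set ℝ} (hE : IsCompact E) {f : ℝ → ℝ} (hf : Continuous f)
    {g ρ α β τ : ℝ} (hg : 0 < g) (hρ : 0 < ρ)
    (hshort : ∀ a ∈ E, ∀ x, a ≤ x → x ≤ a + g → α ≤ f x)
    (hgap : ∀ a ∈ E, ∀ b ∈ E, a < b → b - a ≤ τ → -β * (b - a) ≤ ∫ x in a..b, f x) (n : ℕ) :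
    ∀ a ∈ E, ∀ b ∈ E, a ≤ b → b - a ≤ τ → b - a ≤ n * g →
      ∃ S : ℝ, ∃ P : Finset ℝ, E ∩ Set.Icc a b ⊆ ⋃ p ∈ P, Set.Icc p (p + ρ) ∧
        (P.card : ℝ) ≤ S / ρ + n + 1 ∧ α * S - β * (b - a - S) ≤ ∫ x in a..b, f x := by
  classical
  have hshort' : ∀ a ∈ E, ∀ b, a ≤ b → b ≤ a + g → α * (b - a) ≤ ∫ x in a..b, f x := by
    intro a ha b hab hb
    have := intervalIntegral.integral_mono_on (μ := volume) hab
      (intervalIntegrable_const (c := α)) (hf.intervalIntegrable a b)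
      fun x hx => hshort a ha x hx.1 (hx.2.trans hb)
    rw [intervalIntegral.integral_const, smul_eq_mul] at this
    linarith
  induction n with
  | zero =>
    intro a ha b hb hab _ hn
    have : a = b := by
      simp only [Nat.cast_zero, zero_mul] at hn
      linarith
    subst this
    refine ⟨0, {a}, ?_, by simp, by simp⟩
    rintro x ⟨-, hx⟩
    simp only [Finset.mem_singleton, Set.iUnion_iUnion_eq_left]
    exact ⟨hx.1, by linarith [hx.2]⟩
  | succ n ih =>
    intro a ha b hb hab hτ hn
    push_cast at hn
    obtain ⟨x₁, ⟨hx₁E, hax₁, hx₁b⟩, hx₁max⟩ := (hE.inter_right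
      (isClosed_Icc (a := a) (b := min b (a + g)))).exists_isGreatest
      ⟨a, ha, le_rfl, le_min hab (by linarith)⟩
    obtain ⟨hx₁b, hx₁g⟩ := le_min_iff.mp hx₁b
    obtain ⟨P₁, hP₁, hP₁c⟩ := exists_finset_Icc_subset hax₁ hρ
    rcases hx₁b.eq_or_lt with rfl | hlt
    · refine ⟨x₁ - a, P₁, Set.inter_subset_right.trans hP₁, ?_, ?_⟩
      · push_cast
        linarith [(n.cast_nonneg : (0 : ℝ) ≤ n)]
      · have := hshort' a ha x₁ hab hx₁g
        linarith
    · have hbg : a + g < b := by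
        by_contra! hcon
        exact hlt.not_ge (hx₁max ⟨hb, hab, le_min le_rfl hcon⟩)
      obtain ⟨x₂, ⟨hx₂E, hgx₂, hx₂b⟩, hx₂min⟩ := (hE.inter_right
        (isClosed_Icc (a := a + g) (b := b))).exists_isLeast ⟨b, hb, hbg.le, le_rfl⟩
      obtain ⟨S, P, hP, hPc, hS⟩ := ih x₂ hx₂E b hb hx₂b (by linarith) (by linarith)
      refine ⟨x₁ - a + S, P₁ ∪ P, ?_, ?_, ?_⟩
      · rintro y ⟨hyE, hy⟩
        rw [Finset.set_biUnion_union]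
        rcases le_total y (a + g) with hyg | hyg
        · exact Or.inl (hP₁ ⟨hy.1, hx₁max ⟨hyE, hy.1, le_min hy.2 hyg⟩⟩)
        · exact Or.inr (hP ⟨hyE, hx₂min ⟨hyE, hyg, hy.2⟩, hy.2⟩)
      · have : ((P₁ ∪ P).card : ℝ) ≤ P₁.card + P.card := by
          exact_mod_cast Finset.card_union_le P₁ P
        push_cast
        rw [add_div]
        linarith
      · have h1 := hshort' a ha x₁ hax₁ hx₁g
        have h2 : -β * (x₂ - x₁) ≤ ∫ x in x₁..x₂, f x := by
          rcases (hx₁g.trans hgx₂).eq_or_lt with h | h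
          · rw [h]; simp
          · exact hgap x₁ hx₁E x₂ hx₂E h (by linarith)
        rw [← intervalIntegral.integral_add_adjacent_intervals (hf.intervalIntegrable a x₁)
          (hf.intervalIntegrable x₁ b),
          ← intervalIntegral.integral_add_adjacent_intervals (hf.intervalIntegrable x₁ x₂)
          (hf.intervalIntegrable x₂ b)]
        linarith

set_option maxHeartbeats 1000000 in
/-- Passing from scale `ρ` to a scale `ρ'` comparable to a fixed power of `ρ`, a covering of a set
on which `Re G` grows logarithmically loses a fixed proportion of its length. -/
lemma LogBounded.exists_refinement {G : ℂ → ℂ} {C : ℝ} (h : LogBounded G C) {E : Set ℝ}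
    (hE : IsCompact E) {c y₀ : ℝ} (hc : 0 < c) (hy₀ : 0 < y₀) (hy₀' : y₀ ≤ 1 / 8)
    (hG : ∀ x ∈ E, ∀ y : ℝ, 0 < y → y ≤ y₀ → c * -Real.log y ≤ (G (x + y * Complex.I)).re) :
    ∃ q B ρ₀ : ℝ, 0 < q ∧ q < 1 ∧ 1 < B ∧ 0 < ρ₀ ∧ ρ₀ ≤ 1 / 8 ∧ ∀ ρ, 0 < ρ → ρ ≤ ρ₀ →
      ∃ ρ', 0 < ρ' ∧ ρ' ≤ ρ / 2 ∧ -Real.log ρ' ≤ B * -Real.log ρ ∧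
        ∀ a ∈ E, ∀ b ∈ E, a ≤ b → b - a ≤ ρ →
          ∃ P : Finset ℝ, E ∩ Set.Icc a b ⊆ ⋃ p ∈ P, Set.Icc p (p + ρ') ∧ P.card * ρ' ≤ q * ρ := by
  have hC := h.pos
  have hpos : ∀ x ∈ E, ∀ y : ℝ, 0 < y → y ≤ y₀ → 0 ≤ (G (x + y * Complex.I)).re := by
    intro x hx y hy hyy
    have := two_le_neg_log hy (hyy.trans hy₀')
    exact le_trans (by positivity) (hG x hx y hy hyy)
  obtain ⟨K, hK⟩ : ∃ K, K = 500 * C := ⟨_, rfl⟩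
  have hK0 : 0 < K := by rw [hK]; positivity
  obtain ⟨A, hA⟩ := exists_nat_ge (max 1 (4 * K / c))
  obtain ⟨hA1, hAc⟩ := max_le_iff.mp hA
  have hA0 : (0 : ℝ) < A := by linarith
  have hA1' : 1 ≤ A := by exact_mod_cast hA1
  have hKA : K / A ≤ c / 4 := by
    rw [div_le_iff₀ hc] at hAc
    rw [div_le_iff₀ hA0]
    linarith
  obtain ⟨δ, hδ0, hδ1, hδ2⟩ : ∃ δ : ℝ, 0 < δ ∧ δ ≤ 1 / 4 ∧ 16 * C * δ ≤ c / 2 := by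
    refine ⟨min (1 / 4) (c / (32 * C)), by positivity, min_le_left _ _, ?_⟩
    calc 16 * C * min (1 / 4) (c / (32 * C)) ≤ 16 * C * (c / (32 * C)) := by
          gcongr
          exact min_le_right _ _
      _ = c / 2 := by field_simp; norm_num
  obtain ⟨q₀, hq₀⟩ : ∃ q₀, q₀ = (K + c / 4) / (K + c / 2) := ⟨_, rfl⟩
  have hq₀0 : 0 < q₀ := by rw [hq₀]; positivity
  have hq₀1 : q₀ < 1 := by rw [hq₀, div_lt_one (by positivity)]; linarith
  obtain ⟨ε, hε⟩ : ∃ ε, ε = (1 - q₀) / 4 := ⟨_, rfl⟩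
  have hε0 : 0 < ε := by rw [hε]; linarith
  have hε1 : ε ≤ 1 / 4 := by rw [hε]; linarith
  refine ⟨q₀ + 2 * ε, 2 * A + 1, min (y₀ / 4) (ε * δ), by positivity, by linarith, by linarith,
    by positivity, (min_le_left _ _).trans (by linarith), ?_⟩
  intro ρ hρ hρ₀
  obtain ⟨hρ1, hρ2⟩ := le_min_iff.mp hρ₀
  have hρε : ρ ≤ ε := hρ2.trans (by nlinarith)
  have hLρ := two_le_neg_log hρ (by linarith)
  obtain ⟨η, hη⟩ : ∃ η, η = ρ ^ (2 * A) := ⟨_, rfl⟩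
  have hη0 : 0 < η := by rw [hη]; positivity
  have hηρ2 : η ≤ ρ ^ 2 := by
    rw [hη]
    exact pow_le_pow_of_le_one hρ.le (by linarith) (by omega)
  have hηρ : η ≤ ρ := hηρ2.trans (by nlinarith)
  have hLη : -Real.log η = 2 * A * -Real.log ρ := by
    rw [hη, Real.log_pow]; push_cast; ring
  have hLη0 : 2 ≤ -Real.log η := two_le_neg_log hη0 (by linarith)
  obtain ⟨L, hL⟩ : ∃ L, L = -Real.log η := ⟨_, rfl⟩
  have hL0 : 0 < L := by linarith
  obtain ⟨g, hg⟩ : ∃ g, g = δ * η := ⟨_, rfl⟩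
  have hg0 : 0 < g := by rw [hg]; positivity
  have hgη : g ≤ η / 4 := by rw [hg]; nlinarith
  have hρ'0 : 0 < ε * g := by positivity
  have hρ'g : ε * g ≤ η / 16 := by nlinarith
  have hηερ : η ≤ ε * ρ := hηρ2.trans (by nlinarith)
  have hosc : ∀ a ∈ E, ∀ x r, a ≤ x → x ≤ a + r → r ≤ η / 4 →
      c * L - 16 * C * L * (r / η) ≤ (G (x + η * Complex.I)).re := by
    intro a ha x r hax hxr hr
    have hxa : |x - a| ≤ r := by rw [abs_of_nonneg (by linarith)]; linarith
    have h1 := h.norm_horizontal_sub_le hη0 (by linarith) (hpos a ha η hη0 (by linarith))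
      (hxa.trans hr)
    rw [← hL] at h1
    have h2 : 16 * C * L * (|x - a| / η) ≤ 16 * C * L * (r / η) := by gcongr
    have h3 := hG a ha η hη0 (by linarith)
    rw [← hL] at h3
    have h4 := (abs_le.mp ((Complex.abs_re_le_norm _).trans h1)).1
    rw [Complex.sub_re] at h4
    linarith
  have hcont : Continuous fun x : ℝ => (G (x + η * Complex.I)).re :=
    Complex.continuous_re.comp (h.continuous_horizontal hη0)
  have hint : ∀ a ∈ E, ∀ b ∈ E, a < b → b - a ≤ ρ → η ≤ 4 * (b - a) →
      |∫ x in a..b, (G (x + η * Complex.I)).re| ≤ K * -Real.log (4 * (b - a)) * (b - a) := by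
    intro a ha b hb hab hba hη4
    rw [hK]
    exact h.abs_integral_re_le hab (by linarith)
      (fun y hy hyT => hpos a ha y hy (by linarith))
      (fun y hy hyT => hpos b hb y hy (by linarith)) hη0 hη4
  have hshort : ∀ a ∈ E, ∀ x, a ≤ x → x ≤ a + g → c / 2 * L ≤ (G (x + η * Complex.I)).re := by
    intro a ha x hax hxg
    have h1 := hosc a ha x g hax hxg hgη
    have h2 : g / η = δ := by rw [hg]; field_simp
    rw [h2] at h1
    have h3 := mul_le_mul_of_nonneg_right hδ2 hL0.le
    linarith
  have hgap : ∀ a ∈ E, ∀ b ∈ E, a < b → b - a ≤ ρ →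
      -(K * L) * (b - a) ≤ ∫ x in a..b, (G (x + η * Complex.I)).re := by
    intro a ha b hb hab hba
    rcases le_or_gt η (4 * (b - a)) with hcase | hcase
    · have h1 := (abs_le.mp (hint a ha b hb hab hba hcase)).1
      have h2 : -Real.log (4 * (b - a)) ≤ L := by
        rw [hL]
        exact neg_le_neg (Real.log_le_log hη0 hcase)
      have h3 : K * -Real.log (4 * (b - a)) * (b - a) ≤ K * L * (b - a) := by
        have : 0 ≤ b - a := by linarith
        gcongr
      linarith
    · have := intervalIntegral.integral_mono_on (μ := volume) hab.le
        (intervalIntegrable_const (c := -(K * L))) (hcont.intervalIntegrable a b) (by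
          intro x hx
          have h1 := hosc a ha x (η / 4) hx.1 (by linarith [hx.2]) le_rfl
          have h2 : η / 4 / η = 1 / 4 := by field_simp
          rw [h2] at h1
          have h3 : 0 < c * L := by positivity
          have h4 : 0 < C * L := by positivity
          rw [hK]
          linarith)
      rw [intervalIntegral.integral_const, smul_eq_mul] at this
      linarith
  refine ⟨ε * g, hρ'0, by linarith, ?_, ?_⟩
  · rw [hg, ← mul_assoc, Real.log_mul (by positivity) hη0.ne']
    have : Real.log ρ ≤ Real.log (ε * δ) := Real.log_le_log hρ hρ2
    linarith
  intro a ha b hb hab hba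
  rcases le_or_gt (b - a) (ρ ^ 2) with hcase | hcase
  · obtain ⟨P, hP, hPc⟩ := exists_finset_Icc_subset hab hρ'0
    refine ⟨P, Set.inter_subset_right.trans hP, ?_⟩
    have h1 := mul_le_mul_of_nonneg_right hPc hρ'0.le
    rw [add_mul, div_mul_cancel₀ _ hρ'0.ne'] at h1
    have h2 : ρ ^ 2 ≤ ε * ρ := by nlinarith
    have h3 : 0 < q₀ * ρ := by positivity
    linarith
  · have hab' : a < b := by linarith [sq_nonneg ρ]
    have ht0 : 0 < b - a := by linarith
    obtain ⟨S, P, hP, hPc, hS⟩ := exists_cover_of_integral hE hcont hg0 hρ'0 hshort hgap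
      ⌈(b - a) / g⌉₊ a ha b hb hab hba (by
        have := Nat.le_ceil ((b - a) / g)
        rwa [div_le_iff₀ hg0] at this)
    refine ⟨P, hP, ?_⟩
    have h1 := (abs_le.mp (hint a ha b hb hab' hba (by linarith))).2
    have h2 : -Real.log (4 * (b - a)) ≤ L / A := by
      have h3 : Real.log (ρ ^ 2) ≤ Real.log (4 * (b - a)) :=
        Real.log_le_log (by positivity) (by linarith)
      rw [Real.log_pow] at h3
      push_cast at h3
      rw [hL, hLη, le_div_iff₀ hA0]
      nlinarith
    have h3 : K * -Real.log (4 * (b - a)) * (b - a) ≤ K * (L / A) * (b - a) := by gcongr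
    have h4 : K * (L / A) * (b - a) ≤ c / 4 * L * (b - a) := by
      rw [show K * (L / A) = K / A * L by ring]
      gcongr
    have h5 : S ≤ q₀ * (b - a) := by
      have h6 : L * ((K + c / 2) * S) ≤ L * ((K + c / 4) * (b - a)) := by linarith
      have h7 := le_of_mul_le_mul_left h6 hL0
      rw [hq₀, div_mul_eq_mul_div, le_div_iff₀ (by positivity)]
      linarith
    have h6 : q₀ * (b - a) ≤ q₀ * ρ := by gcongr
    have h7 := (Nat.ceil_lt_add_one (div_nonneg ht0.le hg0.le)).le
    have h8 : (P.card : ℝ) ≤ S / (ε * g) + (b - a) / g + 2 := by linarith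
    have h9 := mul_le_mul_of_nonneg_right h8 hρ'0.le
    have h10 : (S / (ε * g) + (b - a) / g + 2) * (ε * g) = S + ε * (b - a) + 2 * (ε * g) := by
      field_simp
    have h11 : ε * (b - a) ≤ ε * ρ := by gcongr
    linarith

/-- Iterating a refinement of coverings along a sequence of scales. -/
lemma exists_iterated_cover {E : Set ℝ} (hE : IsCompact E) {q B ρ₀ : ℝ} (hq : 0 < q) (hB : 1 < B)
    (hρ₀ : 0 < ρ₀)
    (href : ∀ ρ, 0 < ρ → ρ ≤ ρ₀ → ∃ ρ', 0 < ρ' ∧ ρ' ≤ ρ / 2 ∧ -Real.log ρ' ≤ B * -Real.log ρ ∧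
      ∀ a ∈ E, ∀ b ∈ E, a ≤ b → b - a ≤ ρ →
        ∃ P : Finset ℝ, E ∩ Set.Icc a b ⊆ ⋃ p ∈ P, Set.Icc p (p + ρ') ∧ P.card * ρ' ≤ q * ρ) :
    ∃ M, ∀ n : ℕ, ∃ ρ, ∃ P : Finset ℝ, 0 < ρ ∧ ρ ≤ ρ₀ ∧ ρ ≤ ρ₀ * (1 / 2) ^ n ∧
      -Real.log ρ ≤ B ^ n * -Real.log ρ₀ ∧ E ⊆ ⋃ p ∈ P, Set.Icc p (p + ρ) ∧
      P.card * ρ ≤ M * q ^ n := by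
  classical
  obtain ⟨R, hR⟩ := hE.isBounded.subset_closedBall 0
  rw [Real.closedBall_eq_Icc] at hR
  obtain ⟨P₀, hP₀⟩ : ∃ P : Finset ℝ, E ⊆ ⋃ p ∈ P, Set.Icc p (p + ρ₀) := by
    rcases le_total (0 - R) (0 + R) with h | h
    · obtain ⟨P, hP, -⟩ := exists_finset_Icc_subset h hρ₀
      exact ⟨P, hR.trans hP⟩
    · obtain ⟨P, hP, -⟩ := exists_finset_Icc_subset (le_refl (0 - R)) hρ₀
      exact ⟨P, (hR.trans (Set.Icc_subset_Icc_right h)).trans hP⟩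
  refine ⟨P₀.card * ρ₀, fun n => ?_⟩
  induction n with
  | zero => exact ⟨ρ₀, P₀, hρ₀, le_rfl, by simp, by simp, hP₀, by simp⟩
  | succ n ih =>
    obtain ⟨ρ, P, hρ, hρle, hρn, hlog, hP, hPc⟩ := ih
    obtain ⟨ρ', hρ', hρ'2, hlog', hcov⟩ := href ρ hρ hρle
    have hcell : ∀ p : ℝ, ∃ Q : Finset ℝ,
        E ∩ Set.Icc p (p + ρ) ⊆ ⋃ x ∈ Q, Set.Icc x (x + ρ') ∧ Q.card * ρ' ≤ q * ρ := by
      intro p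
      have hcpt : IsCompact (E ∩ Set.Icc p (p + ρ)) := hE.inter_right isClosed_Icc
      rcases (E ∩ Set.Icc p (p + ρ)).eq_empty_or_nonempty with hem | hne
      · refine ⟨∅, by simp [hem], ?_⟩
        simp only [Finset.card_empty, Nat.cast_zero, zero_mul]
        positivity
      · obtain ⟨a, ha, hamin⟩ := hcpt.exists_isLeast hne
        obtain ⟨b, hb, hbmax⟩ := hcpt.exists_isGreatest hne
        obtain ⟨Q, hQ, hQc⟩ := hcov a ha.1 b hb.1 (hamin hb) (by linarith [ha.2.1, hb.2.2])
        exact ⟨Q, fun x hx => hQ ⟨hx.1, hamin hx, hbmax hx⟩, hQc⟩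
    choose Q hQ hQc using hcell
    refine ⟨ρ', P.biUnion Q, hρ', by linarith, ?_, ?_, ?_, ?_⟩
    · rw [pow_succ]; linarith
    · have := mul_le_mul_of_nonneg_left hlog (by linarith : 0 ≤ B)
      rw [pow_succ]; linarith
    · intro x hx
      obtain ⟨p, hp, hxp⟩ := Set.mem_iUnion₂.mp (hP hx)
      obtain ⟨y, hy, hxy⟩ := Set.mem_iUnion₂.mp (hQ p ⟨hx, hxp⟩)
      exact Set.mem_iUnion₂.mpr ⟨y, Finset.mem_biUnion.mpr ⟨p, hp, hy⟩, hxy⟩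
    · have h1 : ((P.biUnion Q).card : ℝ) ≤ ∑ p ∈ P, ((Q p).card : ℝ) := by
        exact_mod_cast Finset.card_biUnion_le
      calc ((P.biUnion Q).card : ℝ) * ρ' ≤ (∑ p ∈ P, ((Q p).card : ℝ)) * ρ' := by gcongr
        _ = ∑ p ∈ P, (Q p).card * ρ' := Finset.sum_mul _ _ _
        _ ≤ ∑ _p ∈ P, q * ρ := Finset.sum_le_sum fun p _ => hQc p
        _ = q * (P.card * ρ) := by rw [Finset.sum_const, nsmul_eq_mul]; ring
        _ ≤ q * (P₀.card * ρ₀ * q ^ n) := by gcongr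
        _ = _ := by rw [pow_succ]; ring

lemma hausdorffGauge_eq_zero_of_cover {lam : ℝ → ℝ}
    (hsmall : ∀ ω : ℝ, 0 < ω →
      Tendsto (fun t : ℝ => lam t / (t * |Real.log t| ^ ω))
        (nhdsWithin 0 (Set.Ioi 0)) (nhds 0))
    {E : Set ℝ} {q B ρ₀ M : ℝ} (hq : 0 < q) (hq1 : q < 1) (hB : 1 < B)
    (hρ₀ : 0 < ρ₀) (hρ₀1 : ρ₀ < 1)
    (hcov : ∀ n : ℕ, ∃ ρ, ∃ P : Finset ℝ, 0 < ρ ∧ ρ ≤ ρ₀ ∧ ρ ≤ ρ₀ * (1 / 2) ^ n ∧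
      -Real.log ρ ≤ B ^ n * -Real.log ρ₀ ∧ E ⊆ ⋃ p ∈ P, Set.Icc p (p + ρ) ∧
      P.card * ρ ≤ M * q ^ n) :
    hausdorffGauge lam E = 0 := by
  choose ρ P hρ hρle hρn hlog hP hPc using hcov
  have hB0 : 0 < B := by linarith
  have hlogB : 0 < Real.log B := Real.log_pos hB
  have hlogq : Real.log q < 0 := Real.log_neg hq hq1
  have hL₀ : 0 < -Real.log ρ₀ := by linarith [Real.log_neg hρ₀ hρ₀1]
  obtain ⟨ω, hω⟩ : ∃ ω, ω = -Real.log q / 2 / Real.log B := ⟨_, rfl⟩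
  have hω0 : 0 < ω := by rw [hω]; apply div_pos _ hlogB; linarith
  have hqB : q * B ^ ω < 1 := by
    rw [← Real.log_neg_iff (by positivity), Real.log_mul hq.ne' (by positivity), Real.log_rpow hB0,
      hω, div_mul_cancel₀ _ hlogB.ne']
    linarith
  have hρ0 : Tendsto ρ atTop (nhds 0) := by
    refine squeeze_zero (fun n => (hρ n).le) hρn ?_
    simpa using (tendsto_pow_atTop_nhds_zero_of_lt_one (by norm_num : (0 : ℝ) ≤ 1 / 2)
      (by norm_num)).const_mul ρ₀
  have hρ0' : Tendsto ρ atTop (nhdsWithin 0 (Set.Ioi 0)) :=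
    tendsto_nhdsWithin_iff.mpr ⟨hρ0, Eventually.of_forall hρ⟩
  have hev : ∀ᶠ n in atTop, (P n).card * lam (ρ n)
      ≤ M * (-Real.log ρ₀) ^ ω * (q * B ^ ω) ^ n := by
    filter_upwards [((hsmall ω hω0).comp hρ0').eventually_lt_const one_pos] with n hn
    have hneg : Real.log (ρ n) < 0 := Real.log_neg (hρ n) ((hρle n).trans_lt hρ₀1)
    have hden : 0 < ρ n * |Real.log (ρ n)| ^ ω :=
      mul_pos (hρ n) (Real.rpow_pos_of_pos (abs_pos.mpr hneg.ne) _)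
    simp only [Function.comp_apply] at hn
    rw [div_lt_one hden, abs_of_neg hneg] at hn
    have h1 : (-Real.log (ρ n)) ^ ω ≤ (B ^ n * -Real.log ρ₀) ^ ω :=
      Real.rpow_le_rpow (by linarith) (hlog n) hω0.le
    have h2 : (0 : ℝ) ≤ (P n).card * ρ n := mul_nonneg (Nat.cast_nonneg _) (hρ n).le
    calc (P n).card * lam (ρ n) ≤ (P n).card * (ρ n * (-Real.log (ρ n)) ^ ω) := by gcongr
      _ = (P n).card * ρ n * (-Real.log (ρ n)) ^ ω := by ring
      _ ≤ (M * q ^ n) * (B ^ n * -Real.log ρ₀) ^ ω :=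
        mul_le_mul (hPc n) h1 (Real.rpow_nonneg (by linarith) _) (h2.trans (hPc n))
      _ = _ := by
        rw [Real.mul_rpow (by positivity) hL₀.le, ← Real.rpow_natCast B n, ← Real.rpow_mul hB0.le,
          mul_comm (n : ℝ) ω, Real.rpow_mul hB0.le, Real.rpow_natCast, mul_pow]
        ring
  have hbound : Tendsto (fun n => ENNReal.ofReal (M * (-Real.log ρ₀) ^ ω * (q * B ^ ω) ^ n))
      atTop (nhds 0) := by
    have := ((tendsto_pow_atTop_nhds_zero_of_lt_one (by positivity) hqB).const_mul
      (M * (-Real.log ρ₀) ^ ω))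
    rw [mul_zero] at this
    simpa using ENNReal.tendsto_ofReal this
  have hdiam : ∀ n (p : ℝ), Metric.ediam (Set.Icc p (p + ρ n)) = ENNReal.ofReal (ρ n) := by
    intro n p
    rw [Real.ediam_Icc, add_sub_cancel_left]
  have key := Measure.mkMetric_le_liminf_sum (ι := fun n => P n) E (l := atTop)
    (fun n => ENNReal.ofReal (ρ n)) (by simpa using ENNReal.tendsto_ofReal hρ0)
    (fun n p => Set.Icc (p : ℝ) (p + ρ n)) (Eventually.of_forall fun n p => (hdiam n p).le)
    (Eventually.of_forall fun n => by
      rw [Set.iUnion_subtype (fun p => p ∈ P n) (fun p => Set.Icc (p : ℝ) (p + ρ n))]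
      exact hP n)
    (fun d => ENNReal.ofReal (lam d.toReal))
  refine le_antisymm (key.trans ?_) zero_le
  refine (Tendsto.liminf_eq ?_).le
  refine tendsto_of_tendsto_of_tendsto_of_le_of_le' tendsto_const_nhds hbound
    (Eventually.of_forall fun _ => zero_le) ?_
  filter_upwards [hev] with n hn
  simp only [hdiam, ENNReal.toReal_ofReal (hρ n).le, Finset.sum_const, Finset.card_univ,
    Fintype.card_coe, nsmul_eq_mul]
  rw [← ENNReal.ofReal_natCast, ← ENNReal.ofReal_mul (Nat.cast_nonneg _)]
  exact ENNReal.ofReal_le_ofReal hn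

lemma logBounded_of_classK {F : ℂ → ℂ} (hF : DifferentiableOn ℂ F (Metric.ball 0 1)) {C : ℝ}
    (hC : ∀ z ∈ Metric.ball (0 : ℂ) 1, (F z).re ≤ C * Real.log (Real.exp 1 / (1 - ‖z‖))) :
    LogBounded (fun w => F (Complex.exp (Complex.I * w))) (3 * (|C| + 1)) := by
  have hnorm : ∀ w : ℂ, ‖Complex.exp (Complex.I * w)‖ = Real.exp (-w.im) := by
    intro w
    rw [Complex.norm_exp]
    simp
  have hmem : ∀ w : ℂ, 0 < w.im → Complex.exp (Complex.I * w) ∈ Metric.ball (0 : ℂ) 1 := by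
    intro w hw
    rw [mem_ball_zero_iff, hnorm, Real.exp_lt_one_iff]
    linarith
  refine ⟨by positivity, hF.comp (by fun_prop) fun w hw => hmem w hw, fun w hw hw' => ?_⟩
  refine (hC _ (hmem w hw)).trans ?_
  rw [hnorm]
  obtain ⟨y, hy⟩ : ∃ y, y = w.im := ⟨_, rfl⟩
  rw [← hy] at hw hw' ⊢
  have h1 : y / 2 ≤ 1 - Real.exp (-y) := by
    have h2 : Real.exp (-y) * (1 + y) ≤ 1 := by
      have := mul_le_mul_of_nonneg_left (Real.add_one_le_exp y) (Real.exp_pos (-y)).le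
      rw [← Real.exp_add, neg_add_cancel, Real.exp_zero] at this
      linarith
    nlinarith [Real.exp_pos (-y)]
  have h3 : 1 - Real.exp (-y) ≤ 1 := by linarith [Real.exp_pos (-y)]
  have h4 : 0 < 1 - Real.exp (-y) := by linarith
  have h5 : Real.log (y / 2) ≤ Real.log (1 - Real.exp (-y)) := Real.log_le_log (by linarith) h1
  have h6 := Real.log_nonpos h4.le h3
  rw [Real.log_div hw.ne' two_ne_zero] at h5
  rw [Real.log_div (Real.exp_pos 1).ne' h4.ne', Real.log_exp]
  have h7 : Real.log y ≤ Real.log (1 / 4) := Real.log_le_log hw hw'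
  rw [one_div, Real.log_inv, show (4 : ℝ) = 2 ^ 2 by norm_num, Real.log_pow] at h7
  have h8 := Real.log_two_gt_d9
  push_cast at h7
  have h9 : 0 ≤ 1 - Real.log (1 - Real.exp (-y)) := by linarith
  calc C * (1 - Real.log (1 - Real.exp (-y)))
      ≤ (|C| + 1) * (1 - Real.log (1 - Real.exp (-y))) := by
        gcongr
        linarith [le_abs_self C]
    _ ≤ (|C| + 1) * (3 * -Real.log y) := by
        gcongr
        linarith
    _ = _ := by ring

lemma Eplus_subset_iUnion {u : ℂ → ℝ} {F : ℂ → ℂ}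
    (hu : ∀ z ∈ Metric.ball (0 : ℂ) 1, u z = (F z).re) :
    Eplus u ⊆ ⋃ n : ℕ, {θ : ℝ | θ ∈ Set.Icc 0 (2 * Real.pi) ∧
      ∀ y ∈ Set.Ioc (0 : ℝ) (1 / (n + 8)), 1 / ((n : ℝ) + 1) * -Real.log y ≤
        (F (Complex.exp (Complex.I * (θ + y * Complex.I)))).re} := by
  rintro θ ⟨hθ, c, hc, hev⟩
  obtain ⟨r₁, hr₁, hr⟩ := (mem_nhdsLT_iff_exists_Ioo_subset (a := (1 : ℝ))).mp hev
  have hr₁' : r₁ < 1 := hr₁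
  obtain ⟨n, hn⟩ := exists_nat_one_div_lt (lt_min hc (sub_pos.mpr hr₁'))
  obtain ⟨hn1, hn2⟩ := lt_min_iff.mp hn
  refine Set.mem_iUnion.mpr ⟨n, ⟨hθ.1, hθ.2.le⟩, ?_⟩
  rintro y ⟨hy, hyn⟩
  have hn0 : (0 : ℝ) ≤ n := n.cast_nonneg
  have h8 : (1 : ℝ) / (n + 8) ≤ 1 / (n + 1) := by gcongr; norm_num
  have h8' : (1 : ℝ) / (n + 8) ≤ 1 / 8 := by gcongr; linarith
  have hL := two_le_neg_log hy (hyn.trans h8')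
  have hexp := Real.add_one_le_exp (-y)
  have hexp1 : Real.exp (-y) < 1 := by rw [Real.exp_lt_one_iff]; linarith
  have h1 := hr ⟨(by linarith : r₁ < Real.exp (-y)), hexp1⟩
  simp only [Set.mem_ofPred_eq] at h1
  have hz : (Real.exp (-y) : ℂ) * Complex.exp (Complex.I * θ)
      = Complex.exp (Complex.I * (θ + y * Complex.I)) := by
    rw [Complex.ofReal_exp, ← Complex.exp_add]
    congr 1
    push_cast
    linear_combination -(y : ℂ) * Complex.I_mul_I
  have hlog : Real.log (1 - Real.exp (-y)) ≤ Real.log y :=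
    Real.log_le_log (by linarith) (by linarith)
  have habs := neg_le_abs (Real.log (1 - Real.exp (-y)))
  rw [le_div_iff₀ (by linarith), hz, hu] at h1
  · refine le_trans ?_ h1
    exact mul_le_mul hn1.le (by linarith) (by linarith) hc.le
  · rw [mem_ball_zero_iff, Complex.norm_exp, Real.exp_lt_one_iff]
    simpa using hy

/-- If `λ` is increasing with `λ(0)=0` and `λ(t) = o(t |log t|^ω)` as `t → 0⁺` for every
`ω > 0`, then `H_λ(E_+(u)) = 0` for every `u` in the class `K`. -/
theorem stmt2 (lam : ℝ → ℝ)
    (hmono : MonotoneOn lam (Set.Ico 0 1))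
    (hnonneg : ∀ t ∈ Set.Ico (0:ℝ) 1, 0 ≤ lam t)
    (hlam0 : lam 0 = 0)
    (hsmall : ∀ ω : ℝ, 0 < ω →
      Tendsto (fun t : ℝ => lam t / (t * |Real.log t| ^ ω))
        (nhdsWithin 0 (Set.Ioi 0)) (nhds 0))
    (u : ℂ → ℝ) (hu : ClassK u) :
    hausdorffGauge lam (Eplus u) = 0 := by
  obtain ⟨⟨F, hF, huF⟩, C, hC⟩ := hu
  have h := logBounded_of_classK hF fun z hz => (huF z hz) ▸ hC z hz
  refine measure_mono_null (Eplus_subset_iUnion huF) (measure_iUnion_null fun n => ?_)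
  have hn0 : (0 : ℝ) ≤ n := n.cast_nonneg
  set E : Set ℝ := {θ : ℝ | θ ∈ Set.Icc 0 (2 * Real.pi) ∧
      ∀ y ∈ Set.Ioc (0 : ℝ) (1 / (n + 8)), 1 / ((n : ℝ) + 1) * -Real.log y ≤
        (F (Complex.exp (Complex.I * (θ + y * Complex.I)))).re}
  have hE : IsCompact E := by
    refine isCompact_Icc.inter_right (t := {θ : ℝ | ∀ y ∈ Set.Ioc (0 : ℝ) (1 / (n + 8)),
      1 / ((n : ℝ) + 1) * -Real.log y ≤
        (F (Complex.exp (Complex.I * (θ + y * Complex.I)))).re}) ?_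
    simp only [Set.ofPred_forall]
    exact isClosed_biInter fun y hy => isClosed_le continuous_const
      (Complex.continuous_re.comp (h.continuous_horizontal hy.1))
  obtain ⟨q, B, ρ₀, hq, hq1, hB, hρ₀, hρ₀8, href⟩ := h.exists_refinement hE
    (c := 1 / ((n : ℝ) + 1)) (y₀ := 1 / (n + 8)) (by positivity) (by positivity)
    (by gcongr; linarith) fun x hx y hy hy' => hx.2 y ⟨hy, hy'⟩
  obtain ⟨M, hM⟩ := exists_iterated_cover hE hq hB hρ₀ href
  exact hausdorffGauge_eq_zero_of_cover hsmall hq hq1 hB hρ₀ (by linarith) hM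
end
end
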